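/- arXiv:1211.1559 — 2 statements merged into one kernel-verified Lean document; each statement's English description precedes it below -/
import Mathlib

section
/- Let H be a Hilbert space, X a Banach space, and T : H → X a bounded linear operator with l(T) < ∞. Then for all k, n ∈ ℕ: k^{1/2} d_{k+n−1}(T) ≤ √2 · a_n(T; l), where a_n(T; l) := inf{ l(T − A) : A : H → X linear bounded with rank A < n }. -/
open MeasureTheory

/-- The `n`-th entropy number of a subset `A` of a pseudometric space. -/
noncomputable def entropyNum {X : Type*} [PseudoMetricSpace X] (A : Set X) (n : ℕ) : ℝ :=
  sInf {ε : ℝ | 0 ≤ ε ∧ ∃ T : Finset X, T.card ≤ n ∧ A ⊆ ⋃ x ∈ T, Metric.closedBall x ε}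

/-- The `n`-th dyadic entropy number of a subset `A`. -/
noncomputable def dyadEntropyNum {X : Type*} [PseudoMetricSpace X] (A : Set X) (n : ℕ) : ℝ :=
  entropyNum A (2 ^ (n - 1))

/-- The `n`-th entropy number of a bounded linear operator. -/
noncomputable def opEntropyNum {X Y : Type*} [SeminormedAddCommGroup X] [SeminormedAddCommGroup Y]
    [NormedSpace ℝ X] [NormedSpace ℝ Y] (T : X →L[ℝ] Y) (n : ℕ) : ℝ :=
  entropyNum (T '' Metric.closedBall 0 1) n

/-- The `n`-th dyadic entropy number of a bounded linear operator. -/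
noncomputable def opDyadEntropyNum {X Y : Type*} [SeminormedAddCommGroup X]
    [SeminormedAddCommGroup Y] [NormedSpace ℝ X] [NormedSpace ℝ Y]
    (T : X →L[ℝ] Y) (n : ℕ) : ℝ :=
  opEntropyNum T (2 ^ (n - 1))

/-- The absolutely convex hull of a set: all finite sums `∑ λ i • a i` with `∑ |λ i| ≤ 1`. -/
def absConvHull {X : Type*} [AddCommGroup X] [Module ℝ X] (A : Set X) : Set X :=
  {x | ∃ (n : ℕ) (a : Fin n → X) (lam : Fin n → ℝ),
    (∀ i, a i ∈ A) ∧ (∑ i, |lam i|) ≤ 1 ∧ x = ∑ i, lam i • a i}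

/-- The `i`-th Rademacher function. -/
noncomputable def rademacherFn (i : ℕ) (t : ℝ) : ℝ :=
  Real.sign (Real.sin (2 ^ i * Real.pi * t))

/-- `X` is of type `p` with constant `ρ`. -/
def IsTypePWith (X : Type*) [SeminormedAddCommGroup X] [NormedSpace ℝ X] (p ρ : ℝ) : Prop :=
  ∀ (k : ℕ) (x : Fin k → X),
    (∫ t in (0:ℝ)..1, ‖∑ i : Fin k, rademacherFn (i.1 + 1) t • x i‖) ≤
      ρ * (∑ i : Fin k, ‖x i‖ ^ p) ^ (1 / p)

/-- `X` is a Banach space of type `p`. -/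
def IsTypeP (X : Type*) [SeminormedAddCommGroup X] [NormedSpace ℝ X] (p : ℝ) : Prop :=
  ∃ ρ > 0, IsTypePWith X p ρ

/-- Membership in the generalized Lorentz sequence space `l_{r,s,α}`, `0 < s < ∞`:
`∑_{n ≥ 1} (log₂(n+1))^{-αs} n^{s/r-1} ξ_n^s < ∞`. -/
def MemLorentz (r s α : ℝ) (ξ : ℕ → ℝ) : Prop :=
  Summable fun n : ℕ =>
    (Real.logb 2 ((n : ℝ) + 2)) ^ (-(α * s)) * ((n : ℝ) + 1) ^ (s / r - 1) * ξ (n + 1) ^ s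

/-- Membership in the generalized Lorentz sequence space `l_{r,∞,α}`:
`sup_{n ≥ 1} (log₂(n+1))^{-α} n^{1/r} ξ_n < ∞`. -/
def MemLorentzTop (r α : ℝ) (ξ : ℕ → ℝ) : Prop :=
  ∃ C : ℝ, ∀ n : ℕ, 1 ≤ n →
    (Real.logb 2 ((n : ℝ) + 1)) ^ (-α) * (n : ℝ) ^ (1 / r) * ξ n ≤ C

/-- The `n`-th Kolmogorov number of a bounded linear operator. -/
noncomputable def kolmogorovNum {X Y : Type*} [SeminormedAddCommGroup X] [NormedSpace ℝ X]
    [NormedAddCommGroup Y] [NormedSpace ℝ Y] (T : X →L[ℝ] Y) (n : ℕ) : ℝ :=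
  sInf {c : ℝ | ∃ F : Submodule ℝ Y, Module.rank ℝ F < (n : Cardinal) ∧
    ∀ x ∈ Metric.closedBall (0 : X) 1, Metric.infDist (T x) (F : Set Y) ≤ c}

/-- The `l`-norm of an operator from a finite-dimensional Euclidean space. -/
noncomputable def ellNormFin {Y : Type*} [SeminormedAddCommGroup Y] [NormedSpace ℝ Y] {n : ℕ}
    (S : EuclideanSpace ℝ (Fin n) →L[ℝ] Y) : ℝ :=
  (∫ x : Fin n → ℝ, ‖S ((WithLp.equiv 2 (Fin n → ℝ)).symm x)‖ ^ 2
      ∂(Measure.pi fun _ : Fin n => ProbabilityTheory.gaussianReal 0 1)) ^ ((1 : ℝ) / 2)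

/-- The `l`-norm of an operator between Banach spaces. -/
noncomputable def ellNorm {X Y : Type*} [SeminormedAddCommGroup X] [NormedSpace ℝ X]
    [SeminormedAddCommGroup Y] [NormedSpace ℝ Y] (T : X →L[ℝ] Y) : ℝ :=
  sSup {c : ℝ | ∃ (n : ℕ) (A : EuclideanSpace ℝ (Fin n) →L[ℝ] X),
    ‖A‖ ≤ 1 ∧ c = ellNormFin (T.comp A)}

/-- The `n`-th approximation number of `T` with respect to the `l`-norm. -/
noncomputable def approxNumEll {X Y : Type*} [SeminormedAddCommGroup X] [NormedSpace ℝ X]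
    [SeminormedAddCommGroup Y] [NormedSpace ℝ Y] (T : X →L[ℝ] Y) (n : ℕ) : ℝ :=
  sInf {c : ℝ | ∃ A : X →L[ℝ] Y,
    Module.rank ℝ (LinearMap.range (A : X →ₗ[ℝ] Y)) < (n : Cardinal) ∧ c = ellNorm (T - A)}

open ProbabilityTheory

section GaussianProduct

/-- The standard Gaussian measure on `ι → ℝ`. -/
noncomputable abbrev piGauss (ι : Type*) [Fintype ι] : Measure (ι → ℝ) :=
  Measure.pi fun _ : ι => gaussianReal 0 1

variable {ι : Type*} [Fintype ι]

lemma measurePreserving_update_piGauss [DecidableEq ι] (i : ι) :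
    MeasurePreserving (fun p : (ι → ℝ) × ℝ => Function.update p.1 i p.2)
      ((piGauss ι).prod (gaussianReal 0 1)) (piGauss ι) := by
  have hmeas : Measurable (fun p : (ι → ℝ) × ℝ => Function.update p.1 i p.2) := by
    refine measurable_pi_lambda _ fun j => ?_
    by_cases h : j = i
    · subst h; simpa using measurable_snd
    · simpa [h, Function.comp_def] using (measurable_pi_apply j).comp measurable_fst
  refine ⟨hmeas, ?_⟩
  symm
  refine Measure.pi_eq fun s hs => ?_
  rw [Measure.map_apply hmeas (MeasurableSet.univ_pi hs)]
  have : (fun p : (ι → ℝ) × ℝ => Function.update p.1 i p.2) ⁻¹' (Set.univ.pi s)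
      = (Set.univ.pi (Function.update s i Set.univ)) ×ˢ (s i) := by
    ext ⟨w, t⟩
    simp only [Set.mem_preimage, Set.mem_pi, Set.mem_univ, true_imp_iff, Set.mem_prod]
    constructor
    · intro h
      refine ⟨fun j => ?_, by simpa using h i⟩
      by_cases hj : j = i
      · subst hj; simp
      · simpa [hj] using h j
    · rintro ⟨h, ht⟩ j
      by_cases hj : j = i
      · subst hj; simpa using ht
      · simpa [hj] using h j
  rw [this, Measure.prod_prod, Measure.pi_pi, ← Finset.prod_erase_mul _ _ (Finset.mem_univ i),
    ← Finset.prod_erase_mul (Finset.univ) (fun j => gaussianReal 0 1 (s j)) (Finset.mem_univ i)]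
  simp only [Function.update_self, measure_univ, mul_one]
  congr 1
  refine Finset.prod_congr rfl fun j hj => ?_
  rw [Function.update_of_ne (Finset.ne_of_mem_erase hj)]

lemma memLp_eval_piGauss (i : ι) (p : ENNReal) (hp : p ≠ ⊤) :
    MemLp (fun w : ι → ℝ => w i) p (piGauss ι) :=
  (memLp_id_gaussianReal' p hp).comp_measurePreserving
    (measurePreserving_eval (fun _ : ι => gaussianReal 0 1) i)

lemma integrable_eval_piGauss (i : ι) : Integrable (fun w : ι → ℝ => w i) (piGauss ι) :=
  memLp_one_iff_integrable.1 (memLp_eval_piGauss i 1 (by simp))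

/-- Gaussian integration by parts in dimension one. -/
lemma integral_id_mul_gaussianReal {φ φ' : ℝ → ℝ} {C : ℝ} (hφ : ∀ s, HasDerivAt φ (φ' s) s)
    (hφ' : Measurable φ') (hb : ∀ s, |φ s| ≤ C) (hb' : ∀ s, |φ' s| ≤ C) :
    ∫ s, s * φ s ∂(gaussianReal 0 1) = ∫ s, φ' s ∂(gaussianReal 0 1) := by
  have hc : Continuous φ := continuous_iff_continuousAt.2 fun s => (hφ s).continuousAt
  have hg : ∀ s : ℝ, HasDerivAt (gaussianPDFReal 0 1) (-(s * gaussianPDFReal 0 1 s)) s := by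
    intro s
    have : HasDerivAt (fun s : ℝ => (Real.sqrt (2 * Real.pi * (1 : NNReal)))⁻¹ *
        Real.exp (-(s - 0) ^ 2 / (2 * (1 : NNReal))))
        ((Real.sqrt (2 * Real.pi * (1 : NNReal)))⁻¹ * (Real.exp (-(s - 0) ^ 2 / (2 * (1 : NNReal))) *
          (-((2 : ℕ) * (s - 0) ^ (2 - 1) * 1) / (2 * (1 : NNReal))))) s := by
      refine HasDerivAt.const_mul _ (HasDerivAt.exp ?_)
      exact ((((hasDerivAt_id s).sub_const 0).pow 2).neg).div_const _
    rw [gaussianPDFReal_def]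
    convert this using 1
    simp
    ring
  have hint : Integrable (fun s => s * φ s) (gaussianReal 0 1) :=
    (memLp_one_iff_integrable.1 (memLp_id_gaussianReal' 1 (by simp))).mul_bdd (c := C)
      hc.aestronglyMeasurable (ae_of_all _ hb)
  have hsm : Integrable (fun s => gaussianPDFReal 0 1 s * (s * φ s)) := by
    have := hint
    rw [gaussianReal_of_var_ne_zero _ one_ne_zero, integrable_withDensity_iff_integrable_smul'
      (measurable_gaussianPDF _ _) (ae_of_all _ fun _ => gaussianPDF_lt_top)] at this
    simpa using this
  rw [integral_gaussianReal_eq_integral_smul one_ne_zero,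
    integral_gaussianReal_eq_integral_smul one_ne_zero]
  simp only [smul_eq_mul]
  have key := integral_mul_deriv_eq_deriv_mul_of_integrable (u := φ) (v := gaussianPDFReal 0 1)
    (u' := φ') (v' := fun s => -(s * gaussianPDFReal 0 1 s)) (fun x _ => hφ x) (fun x _ => hg x)
    (by
      refine hsm.neg.congr (ae_of_all _ fun s => ?_)
      simp only [Pi.neg_apply, Pi.mul_apply]; ring)
    ((integrable_gaussianPDFReal 0 1).bdd_mul (c := C) hφ'.aestronglyMeasurable (ae_of_all _ hb'))
    ((integrable_gaussianPDFReal 0 1).bdd_mul (c := C) hc.aestronglyMeasurable (ae_of_all _ hb))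
  have h1 : ∫ x, gaussianPDFReal 0 1 x * (x * φ x) = - ∫ x, φ x * -(x * gaussianPDFReal 0 1 x) := by
    rw [← integral_neg]; congr 1; ext x; ring
  rw [h1, key, neg_neg]
  congr 1; ext x; ring

/-- Gaussian integration by parts for the standard Gaussian measure on `ι → ℝ`. -/
lemma integral_eval_mul_piGauss [DecidableEq ι] (i : ι) {φ φ' : (ι → ℝ) → ℝ} {C : ℝ}
    (hφ : ∀ w s, HasDerivAt (fun s => φ (Function.update w i s)) (φ' (Function.update w i s)) s)
    (hm : Measurable φ) (hφ' : Measurable φ') (hb : ∀ w, |φ w| ≤ C) (hb' : ∀ w, |φ' w| ≤ C) :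
    ∫ w, w i * φ w ∂(piGauss ι) = ∫ w, φ' w ∂(piGauss ι) := by
  have hmp := measurePreserving_update_piGauss i
  have hint : Integrable (fun w => w i * φ w) (piGauss ι) :=
    (integrable_eval_piGauss i).mul_bdd (c := C) hm.aestronglyMeasurable (ae_of_all _ hb)
  have hint' : Integrable φ' (piGauss ι) :=
    Integrable.of_bound hφ'.aestronglyMeasurable C (ae_of_all _ hb')
  have e : ∀ f : (ι → ℝ) → ℝ, Integrable f (piGauss ι) → ∫ w, f w ∂(piGauss ι) =
      ∫ w, ∫ s, f (Function.update w i s) ∂(gaussianReal 0 1) ∂(piGauss ι) := by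
    intro f hf
    have h2 : Integrable (f ∘ fun p : (ι → ℝ) × ℝ => Function.update p.1 i p.2)
        ((piGauss ι).prod (gaussianReal 0 1)) := hmp.integrable_comp_of_integrable hf
    have h3 : ∫ w, f w ∂(piGauss ι) = ∫ p, f (Function.update p.1 i p.2)
        ∂((piGauss ι).prod (gaussianReal 0 1)) := by
      conv_lhs => rw [← hmp.map_eq]
      rw [integral_map hmp.aemeasurable]
      rw [hmp.map_eq]; exact hf.aestronglyMeasurable
    rw [h3]
    exact integral_prod _ h2
  rw [e _ hint, e _ hint']
  congr 1
  ext w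
  simp only [Function.update_self]
  have hum : Measurable fun s : ℝ => Function.update w i s := measurable_update w
  exact integral_id_mul_gaussianReal (hφ w) (hφ'.comp hum) (fun s => hb _) (fun s => hb' _)

end GaussianProduct

section Interpolation

variable {ι : Type*} [Fintype ι] {Y : Type*} [NormedAddCommGroup Y] [NormedSpace ℝ Y]

/-- If `F` has first and second directional derivatives `D y v`, `D₂ y v` that are bounded for
each fixed direction, the derivative of the Gaussian average of `F (∑ i, c i θ * w i • v i)` in `θ`
is the average of `∑ i, c i θ * c' i θ * D₂ _ (v i)`. -/
lemma hasDerivAt_integral_piGauss_curve {F : Y → ℝ} {D : Y → Y →ₗ[ℝ] ℝ} {D₂ : Y → Y → ℝ}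
    (hF : ∀ (y : ℝ → Y) (y' : Y) (t : ℝ), HasDerivAt y y' t →
      HasDerivAt (fun s => F (y s)) (D (y t) y') t)
    (hD : ∀ (y v : Y) (a t : ℝ), HasDerivAt (fun s : ℝ => D (y + s • a • v) v)
      (a * D₂ (y + t • a • v) v) t)
    (hFc : Continuous F) (hDc : ∀ v, Continuous fun y => D y v)
    (hD₂c : ∀ v, Continuous fun y => D₂ y v)
    (hb : ∀ v, ∃ C, ∀ y, |D y v| ≤ C ∧ |D₂ y v| ≤ C)
    (v : ι → Y) {c c' : ι → ℝ → ℝ} (hc : ∀ i θ, HasDerivAt (c i) (c' i θ) θ)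
    (hc1 : ∀ i θ, |c i θ| ≤ 1) (hc'1 : ∀ i θ, |c' i θ| ≤ 1) (θ : ℝ) :
    HasDerivAt (fun θ => ∫ w, F (∑ i, (c i θ * w i) • v i) ∂(piGauss ι))
      (∫ w, ∑ i, c i θ * c' i θ * D₂ (∑ i, (c i θ * w i) • v i) (v i) ∂(piGauss ι)) θ := by
  classical
  choose C hC using fun i => hb (v i)
  have hC0 : ∀ i, 0 ≤ C i := fun i => (abs_nonneg _).trans (hC i 0).1
  have hyc : ∀ θ, Continuous fun w : ι → ℝ => ∑ i, (c i θ * w i) • v i := fun θ => by fun_prop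
  have hy : ∀ (w : ι → ℝ) θ, HasDerivAt (fun θ => ∑ i, (c i θ * w i) • v i)
      (∑ i, (c' i θ * w i) • v i) θ := fun w θ =>
    HasDerivAt.fun_sum fun i _ => ((hc i θ).mul_const (w i)).smul_const (v i)
  have hDb : ∀ (y : Y) (b : ι → ℝ), |D y (∑ i, b i • v i)| ≤ ∑ i, |b i| * C i := by
    intro y b
    rw [map_sum]
    refine (Finset.abs_sum_le_sum_abs _ _).trans (Finset.sum_le_sum fun i _ => ?_)
    rw [map_smul, smul_eq_mul, abs_mul]
    exact mul_le_mul_of_nonneg_left (hC i y).1 (abs_nonneg _)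
  have hbint : Integrable (fun w : ι → ℝ => ∑ i, |w i| * C i) (piGauss ι) :=
    integrable_finsetSum _ fun i _ => (integrable_eval_piGauss i).abs.mul_const _
  have hFb : ∀ θ (w : ι → ℝ), |F (∑ i, (c i θ * w i) • v i)| ≤ |F 0| + ∑ i, |w i| * C i := by
    intro θ w
    set y := ∑ i, (c i θ * w i) • v i with hydef
    have hyb : ∀ z, |D z y| ≤ ∑ i, |w i| * C i := fun z => by
      refine (hDb z _).trans (Finset.sum_le_sum fun i _ => ?_)
      refine mul_le_mul_of_nonneg_right ?_ (hC0 i)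
      rw [abs_mul]
      exact mul_le_of_le_one_left (abs_nonneg _) (hc1 i θ)
    have hline : ∀ t : ℝ, HasDerivAt (fun s : ℝ => F (s • y)) (D (t • y) y) t := fun t =>
      hF (fun s => s • y) y t (by simpa using (hasDerivAt_id t).smul_const y)
    have := Convex.norm_image_sub_le_of_norm_hasDerivWithin_le (s := Set.univ) (x := (0 : ℝ))
      (y := 1) (fun t _ => (hline t).hasDerivWithinAt) (fun t _ => hyb (t • y)) convex_univ
      (Set.mem_univ _) (Set.mem_univ _)
    simp only [one_smul, zero_smul, sub_zero, norm_one, mul_one, Real.norm_eq_abs] at this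
    calc |F y| = |F 0 + (F y - F 0)| := by ring_nf
      _ ≤ |F 0| + |F y - F 0| := abs_add_le _ _
      _ ≤ _ := by gcongr
  have main := hasDerivAt_integral_of_dominated_loc_of_deriv_le (μ := piGauss ι) (x₀ := θ)
    (s := Set.univ) (F := fun θ w => F (∑ i, (c i θ * w i) • v i))
    (F' := fun θ w => D (∑ i, (c i θ * w i) • v i) (∑ i, (c' i θ * w i) • v i))
    (bound := fun w => ∑ i, |w i| * C i) Filter.univ_mem
    (Filter.Eventually.of_forall fun θ => (hFc.comp (hyc θ)).aestronglyMeasurable)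
    (((integrable_const |F 0|).add hbint).mono' (hFc.comp (hyc θ)).aestronglyMeasurable
      (ae_of_all _ fun w => hFb θ w))
    (by
      simp only [map_sum, map_smul, smul_eq_mul]
      refine Continuous.aestronglyMeasurable ?_
      refine continuous_finsetSum _ fun i _ => ?_
      exact (by fun_prop : Continuous fun w : ι → ℝ => c' i θ * w i).mul
        ((hDc (v i)).comp (hyc θ)))
    (ae_of_all _ fun w θ _ => by
      refine (hDb _ _).trans (Finset.sum_le_sum fun i _ => ?_)
      refine mul_le_mul_of_nonneg_right ?_ (hC0 i)
      rw [abs_mul]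
      exact mul_le_of_le_one_left (abs_nonneg _) (hc'1 i θ))
    hbint
    (ae_of_all _ fun w θ _ => hF _ _ θ (hy w θ))
  refine main.2.congr_deriv ?_
  simp only [map_sum, map_smul, smul_eq_mul]
  symm
  rw [integral_finsetSum _ fun i _ => ?_, integral_finsetSum _ fun i _ => ?_]
  · refine Finset.sum_congr rfl fun i _ => ?_
    have ibp := integral_eval_mul_piGauss i (C := C i)
      (φ := fun w => D (∑ i, (c i θ * w i) • v i) (v i))
      (φ' := fun w => c i θ * D₂ (∑ i, (c i θ * w i) • v i) (v i))
      (fun w s => by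
        have hupd : ∀ s : ℝ, ∑ j, (c j θ * Function.update w i s j) • v j =
            (∑ j ∈ Finset.univ.erase i, (c j θ * w j) • v j) + s • c i θ • v i := by
          intro s
          rw [← Finset.sum_erase_add _ _ (Finset.mem_univ i)]
          congr 1
          · refine Finset.sum_congr rfl fun j hj => ?_
            rw [Function.update_of_ne (Finset.ne_of_mem_erase hj)]
          · rw [Function.update_self, smul_smul, mul_comm]
        simp only [hupd]
        exact hD _ (v i) (c i θ) s)
      ((hDc (v i)).comp (hyc θ)).measurable
      (((hD₂c (v i)).comp (hyc θ)).measurable.const_mul _)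
      (fun w => (hC i _).1)
      (fun w => by
        rw [abs_mul]
        exact (mul_le_of_le_one_left (abs_nonneg _) (hc1 i θ)).trans (hC i _).2)
    calc _ = c' i θ * ∫ w, c i θ * D₂ (∑ i, (c i θ * w i) • v i) (v i) ∂(piGauss ι) := by
          rw [← integral_const_mul]; congr 1; ext w; ring
      _ = _ := by
          rw [← ibp, ← integral_const_mul]; congr 1; ext w; ring
  · have : Integrable (fun w : ι → ℝ => (c' i θ * w i) * D (∑ i, (c i θ * w i) • v i) (v i))
        (piGauss ι) :=
      ((integrable_eval_piGauss i).const_mul _).mul_bdd (c := C i)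
        ((hDc (v i)).comp (hyc θ)).aestronglyMeasurable (ae_of_all _ fun w => (hC i _).1)
    exact this
  · refine (Integrable.of_bound (C := C i) ((hD₂c (v i)).comp (hyc θ)).aestronglyMeasurable
      (ae_of_all _ fun w => (hC i _).2)).const_mul _

end Interpolation

section SmoothNorm

variable {E : Type*} [NormedAddCommGroup E]

/-- A smooth approximation of the norm. -/
noncomputable def smoothNorm (ε : ℝ) (w : E) : ℝ :=
  Real.sqrt (ε ^ 2 + ‖w‖ ^ 2)

lemma smoothNorm_pos {ε : ℝ} (hε : 0 < ε) (w : E) : 0 < smoothNorm ε w :=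
  Real.sqrt_pos.2 (by positivity)

lemma norm_le_smoothNorm (ε : ℝ) (w : E) : ‖w‖ ≤ smoothNorm ε w :=
  Real.le_sqrt_of_sq_le (by nlinarith [sq_nonneg ε])

lemma le_smoothNorm (ε : ℝ) (w : E) : ε ≤ smoothNorm ε w :=
  Real.le_sqrt_of_sq_le (by nlinarith [sq_nonneg ‖w‖])

lemma smoothNorm_le {ε : ℝ} (hε : 0 ≤ ε) (w : E) : smoothNorm ε w ≤ ε + ‖w‖ :=
  Real.sqrt_le_iff.2 ⟨by positivity, by nlinarith [norm_nonneg w]⟩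

lemma continuous_smoothNorm (ε : ℝ) : Continuous (smoothNorm ε : E → ℝ) := by
  unfold smoothNorm; fun_prop

variable {σ : Type*}

/-- The family of levels `smoothNorm ε w + s` of a family of pairs `(w, s)`. -/
noncomputable def level (ε : ℝ) (y : σ → E × ℝ) (x : σ) : ℝ :=
  smoothNorm ε (y x).1 + (y x).2

lemma continuous_level (ε : ℝ) (x : σ) : Continuous fun y : σ → E × ℝ => level ε y x :=
  ((continuous_smoothNorm ε).comp (continuous_apply x).fst).add (continuous_apply x).snd

variable [InnerProductSpace ℝ E]

lemma hasDerivAt_smoothNorm {ε : ℝ} (hε : 0 < ε) {w : ℝ → E} {w' : E} {t : ℝ}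
    (hw : HasDerivAt w w' t) :
    HasDerivAt (fun s => smoothNorm ε (w s)) (inner ℝ (w t) w' / smoothNorm ε (w t)) t := by
  have h := (hw.norm_sq.const_add (ε ^ 2)).sqrt (by positivity)
  refine h.congr_deriv ?_
  rw [smoothNorm]
  ring

lemma abs_inner_div_smoothNorm_le {ε : ℝ} (hε : 0 < ε) (w w' : E) :
    |inner ℝ w w' / smoothNorm ε w| ≤ ‖w'‖ := by
  have hN := smoothNorm_pos hε w
  rw [abs_div, abs_of_pos hN, div_le_iff₀ hN, mul_comm]
  exact (abs_real_inner_le_norm _ _).trans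
    (mul_le_mul_of_nonneg_right (norm_le_smoothNorm ε w) (norm_nonneg _))

/-- The directional derivative of `level`. -/
noncomputable def levelDeriv (ε : ℝ) (y v : σ → E × ℝ) (x : σ) : ℝ :=
  inner ℝ (y x).1 (v x).1 / smoothNorm ε (y x).1 + (v x).2

/-- The second directional derivative of `level`. -/
noncomputable def levelDeriv₂ (ε : ℝ) (y v : σ → E × ℝ) (x : σ) : ℝ :=
  (‖(v x).1‖ ^ 2 - (inner ℝ (y x).1 (v x).1 / smoothNorm ε (y x).1) ^ 2) / smoothNorm ε (y x).1

lemma hasDerivAt_level {ε : ℝ} (hε : 0 < ε) {y : ℝ → σ → E × ℝ} {y' : σ → E × ℝ} {t : ℝ}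
    (hy : ∀ x, HasDerivAt (fun s => y s x) (y' x) t) (x : σ) :
    HasDerivAt (fun s => level ε (y s) x) (levelDeriv ε (y t) y' x) t :=
  (hasDerivAt_smoothNorm hε (hy x).fst).add (hy x).snd

lemma continuous_levelDeriv {ε : ℝ} (hε : 0 < ε) (v : σ → E × ℝ) (x : σ) :
    Continuous fun y : σ → E × ℝ => levelDeriv ε y v x := by
  refine (Continuous.div ?_ ((continuous_smoothNorm ε).comp (continuous_apply x).fst)
    fun _ => (smoothNorm_pos hε _).ne').add continuous_const
  fun_prop

lemma continuous_levelDeriv₂ {ε : ℝ} (hε : 0 < ε) (v : σ → E × ℝ) (x : σ) :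
    Continuous fun y : σ → E × ℝ => levelDeriv₂ ε y v x := by
  have hN := (continuous_smoothNorm (E := E) ε).comp (continuous_apply (A := fun _ : σ => E × ℝ) x).fst
  refine Continuous.div (continuous_const.sub ((Continuous.div ?_ hN
    fun _ => (smoothNorm_pos hε _).ne').pow 2)) hN fun _ => (smoothNorm_pos hε _).ne'
  fun_prop

end SmoothNorm

section SoftMin

variable {σ : Type*} [Fintype σ]

/-- The soft minimum of a finite family, with inverse temperature `β`. -/
noncomputable def softMin (β : ℝ) (r : σ → ℝ) : ℝ :=
  -β⁻¹ * Real.log (∑ x, Real.exp (-β * r x))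

/-- The Gibbs weights, which form the gradient of `softMin`. -/
noncomputable def gibbs (β : ℝ) (r : σ → ℝ) (x : σ) : ℝ :=
  Real.exp (-β * r x) / ∑ z, Real.exp (-β * r z)

lemma softMin_add_const [Nonempty σ] {β : ℝ} (hβ : 0 < β) (r : σ → ℝ) (c : ℝ) :
    softMin β (fun x => c + r x) = c + softMin β r := by
  have hZ : 0 < ∑ z, Real.exp (-β * r z) :=
    Finset.sum_pos (fun _ _ => Real.exp_pos _) Finset.univ_nonempty
  have h : ∑ z, Real.exp (-β * (c + r z)) = Real.exp (-β * c) * ∑ z, Real.exp (-β * r z) := by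
    rw [Finset.mul_sum]
    exact Finset.sum_congr rfl fun z _ => by rw [← Real.exp_add]; ring_nf
  rw [softMin, softMin, h, Real.log_mul (Real.exp_pos _).ne' hZ.ne', Real.log_exp]
  field_simp
  ring

lemma softMin_le {β : ℝ} (hβ : 0 < β) (r : σ → ℝ) (x : σ) : softMin β r ≤ r x := by
  have h : Real.exp (-β * r x) ≤ ∑ z, Real.exp (-β * r z) :=
    Finset.single_le_sum (f := fun z => Real.exp (-β * r z)) (fun z _ => (Real.exp_pos _).le)
      (Finset.mem_univ x)
  have h2 := Real.log_le_log (Real.exp_pos _) h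
  rw [Real.log_exp] at h2
  have h3 := mul_le_mul_of_nonneg_left h2 (inv_pos.2 hβ).le
  rw [softMin]
  have : β⁻¹ * (-β * r x) = -r x := by field_simp
  linarith

lemma le_softMin [Nonempty σ] {β : ℝ} (hβ : 0 < β) {r : σ → ℝ} {M : ℝ} (hr : ∀ x, M ≤ r x) :
    M - β⁻¹ * Real.log (Fintype.card σ) ≤ softMin β r := by
  have hZ : 0 < ∑ z, Real.exp (-β * r z) :=
    Finset.sum_pos (fun _ _ => Real.exp_pos _) Finset.univ_nonempty
  have h : ∑ z, Real.exp (-β * r z) ≤ Fintype.card σ * Real.exp (-β * M) := by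
    refine (Finset.sum_le_card_nsmul _ _ (Real.exp (-β * M)) fun x _ => ?_).trans ?_
    · exact Real.exp_le_exp.2 (by nlinarith [hr x])
    · simp
  have h2 := Real.log_le_log hZ h
  rw [Real.log_mul (by simp) (Real.exp_pos _).ne', Real.log_exp] at h2
  have h3 := mul_le_mul_of_nonneg_left h2 (inv_pos.2 hβ).le
  rw [softMin]
  have : β⁻¹ * (-β * M) = -M := by field_simp
  linarith

lemma gibbs_nonneg (β : ℝ) (r : σ → ℝ) (x : σ) : 0 ≤ gibbs β r x :=
  div_nonneg (Real.exp_pos _).le (Finset.sum_nonneg fun _ _ => (Real.exp_pos _).le)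

lemma sum_exp_pos [Nonempty σ] (β : ℝ) (r : σ → ℝ) : 0 < ∑ z, Real.exp (-β * r z) :=
  Finset.sum_pos (fun _ _ => Real.exp_pos _) Finset.univ_nonempty

lemma sum_gibbs [Nonempty σ] (β : ℝ) (r : σ → ℝ) : ∑ x, gibbs β r x = 1 := by
  simp only [gibbs]
  rw [← Finset.sum_div, div_self (sum_exp_pos β r).ne']

lemma hasDerivAt_sum_exp (β : ℝ) {r : ℝ → σ → ℝ} {r' : σ → ℝ} {t : ℝ}
    (hr : ∀ x, HasDerivAt (fun s => r s x) (r' x) t) :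
    HasDerivAt (fun s => ∑ x, Real.exp (-β * r s x))
      (∑ x, Real.exp (-β * r t x) * (-β * r' x)) t :=
  HasDerivAt.fun_sum fun x _ => ((hr x).const_mul (-β)).exp

lemma hasDerivAt_softMin [Nonempty σ] {β : ℝ} (hβ : 0 < β) {r : ℝ → σ → ℝ} {r' : σ → ℝ} {t : ℝ}
    (hr : ∀ x, HasDerivAt (fun s => r s x) (r' x) t) :
    HasDerivAt (fun s => softMin β (r s)) (∑ x, gibbs β (r t) x * r' x) t := by
  have hZ := sum_exp_pos β (r t)
  refine (((hasDerivAt_sum_exp β hr).log hZ.ne').const_mul (-β⁻¹)).congr_deriv ?_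
  simp only [gibbs]
  rw [Finset.sum_div, Finset.mul_sum]
  refine Finset.sum_congr rfl fun x _ => ?_
  field_simp

lemma hasDerivAt_gibbs [Nonempty σ] (β : ℝ) {r : ℝ → σ → ℝ} {r' : σ → ℝ} {t : ℝ}
    (hr : ∀ x, HasDerivAt (fun s => r s x) (r' x) t) (x : σ) :
    HasDerivAt (fun s => gibbs β (r s) x)
      (-β * gibbs β (r t) x * (r' x - ∑ z, gibbs β (r t) z * r' z)) t := by
  have hZ := sum_exp_pos β (r t)
  refine ((((hr x).const_mul (-β)).exp).div (hasDerivAt_sum_exp β hr) hZ.ne').congr_deriv ?_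
  have h1 : ∑ z, gibbs β (r t) z * r' z =
      (∑ z, Real.exp (-β * r t z) * r' z) / ∑ z, Real.exp (-β * r t z) := by
    simp only [gibbs]
    rw [Finset.sum_div]
    exact Finset.sum_congr rfl fun z _ => by ring
  have h2 : ∑ z, Real.exp (-β * r t z) * (-β * r' z) =
      -β * ∑ z, Real.exp (-β * r t z) * r' z := by
    rw [Finset.mul_sum]
    exact Finset.sum_congr rfl fun z _ => by ring
  rw [h1, h2, gibbs]
  field_simp
  ring

variable {E : Type*} [NormedAddCommGroup E] [InnerProductSpace ℝ E]

lemma abs_levelDeriv_le {ε : ℝ} (hε : 0 < ε) (y v : σ → E × ℝ) (x : σ) :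
    |levelDeriv ε y v x| ≤ 2 * ‖v‖ := by
  have h1 := abs_inner_div_smoothNorm_le hε (y x).1 (v x).1
  have h2 : ‖(v x).1‖ ≤ ‖v‖ := (norm_fst_le _).trans (norm_le_pi_norm v x)
  have h3 : |(v x).2| ≤ ‖v‖ := (norm_snd_le _).trans (norm_le_pi_norm v x)
  exact (abs_add_le _ _).trans (by linarith)

lemma abs_levelDeriv₂_le {ε : ℝ} (hε : 0 < ε) (y v : σ → E × ℝ) (x : σ) :
    |levelDeriv₂ ε y v x| ≤ ‖v‖ ^ 2 / ε := by
  have h1 := abs_inner_div_smoothNorm_le hε (y x).1 (v x).1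
  have h2 : ‖(v x).1‖ ≤ ‖v‖ := (norm_fst_le _).trans (norm_le_pi_norm v x)
  have hN := smoothNorm_pos hε (y x).1
  rw [levelDeriv₂, abs_div, abs_of_pos hN]
  have h4 := pow_le_pow_left₀ (abs_nonneg _) h1 2
  rw [sq_abs] at h4
  have h5 : ‖(v x).1‖ ^ 2 ≤ ‖v‖ ^ 2 := by gcongr
  refine div_le_div₀ (sq_nonneg _) ?_ hε (le_smoothNorm ε _)
  rw [abs_le]
  constructor <;> nlinarith [sq_nonneg (inner ℝ (y x).1 (v x).1 / smoothNorm ε (y x).1),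
    sq_nonneg ‖(v x).1‖]

/-- The differential of the soft minimum of `level`. -/
noncomputable def softMinLevelDeriv (β ε : ℝ) (y : σ → E × ℝ) : (σ → E × ℝ) →ₗ[ℝ] ℝ where
  toFun v := ∑ x, gibbs β (level ε y) x * levelDeriv ε y v x
  map_add' v v' := by
    rw [← Finset.sum_add_distrib]
    refine Finset.sum_congr rfl fun x _ => ?_
    simp only [levelDeriv, Pi.add_apply, Prod.fst_add, Prod.snd_add, inner_add_right]
    ring
  map_smul' a v := by
    rw [RingHom.id_apply, smul_eq_mul, Finset.mul_sum]
    refine Finset.sum_congr rfl fun x _ => ?_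
    simp only [levelDeriv, Pi.smul_apply, Prod.smul_fst, Prod.smul_snd, inner_smul_right,
      smul_eq_mul]
    ring

/-- The second directional derivative of the soft minimum of `level`. -/
noncomputable def softMinLevelDeriv₂ (β ε : ℝ) (y v : σ → E × ℝ) : ℝ :=
  ∑ x, gibbs β (level ε y) x * levelDeriv₂ ε y v x -
    β * (∑ x, gibbs β (level ε y) x * levelDeriv ε y v x ^ 2 -
      (∑ x, gibbs β (level ε y) x * levelDeriv ε y v x) ^ 2)

lemma hasDerivAt_softMin_level [Nonempty σ] {β ε : ℝ} (hβ : 0 < β) (hε : 0 < ε) (y : ℝ → σ → E × ℝ)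
    (y' : σ → E × ℝ) (t : ℝ) (hy : HasDerivAt y y' t) :
    HasDerivAt (fun s => softMin β (level ε (y s))) (softMinLevelDeriv β ε (y t) y') t :=
  hasDerivAt_softMin hβ (hasDerivAt_level hε (hasDerivAt_pi.1 hy))

lemma hasDerivAt_softMinLevelDeriv [Nonempty σ] {β ε : ℝ} (hε : 0 < ε) (y v : σ → E × ℝ) (a t : ℝ) :
    HasDerivAt (fun s : ℝ => softMinLevelDeriv β ε (y + s • a • v) v)
      (a * softMinLevelDeriv₂ β ε (y + t • a • v) v) t := by
  have hy : HasDerivAt (fun s : ℝ => y + s • a • v) (a • v) t := by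
    simpa using ((hasDerivAt_id t).smul_const (a • v)).const_add y
  have hy' := hasDerivAt_pi.1 hy
  set z := y + t • a • v with hz
  have hl := hasDerivAt_level hε hy'
  have hg := hasDerivAt_gibbs β hl
  have hd : ∀ x, HasDerivAt (fun s : ℝ => levelDeriv ε (y + s • a • v) v x)
      (a * levelDeriv₂ ε z v x) t := by
    intro x
    have h1 : HasDerivAt (fun s : ℝ => inner ℝ ((y + s • a • v) x).1 (v x).1)
        (inner ℝ (z x).1 (0 : E) + inner ℝ ((a • v) x).1 (v x).1) t :=
      HasDerivAt.inner ℝ (hy' x).fst (hasDerivAt_const t (v x).1)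
    have h2 := hasDerivAt_smoothNorm hε (hy' x).fst
    have hN := smoothNorm_pos hε (z x).1
    refine ((h1.div h2 hN.ne').add_const _).congr_deriv ?_
    rw [← hz]
    simp only [levelDeriv₂, Pi.smul_apply, Prod.smul_fst, inner_smul_left, inner_smul_right,
      inner_zero_right, real_inner_self_eq_norm_sq, RCLike.conj_to_real]
    field_simp
    ring
  have hs := HasDerivAt.fun_sum (u := Finset.univ) fun x _ => (hg x).mul (hd x)
  refine hs.congr_deriv ?_
  have hlin : ∀ x, levelDeriv ε z (a • v) x = a * levelDeriv ε z v x := by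
    intro x
    simp only [levelDeriv, Pi.smul_apply, Prod.smul_fst, Prod.smul_snd, inner_smul_right,
      smul_eq_mul]
    ring
  rw [← hz]
  simp only [hlin]
  have h3 : ∑ x, gibbs β (level ε z) x * (a * levelDeriv ε z v x) =
      a * ∑ x, gibbs β (level ε z) x * levelDeriv ε z v x := by
    rw [Finset.mul_sum]; exact Finset.sum_congr rfl fun x _ => by ring
  rw [h3, softMinLevelDeriv₂]
  set S := ∑ x, gibbs β (level ε z) x * levelDeriv ε z v x with hS
  have h4 : ∀ x, -β * gibbs β (level ε z) x * (a * levelDeriv ε z v x - a * S) *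
      levelDeriv ε z v x + gibbs β (level ε z) x * (a * levelDeriv₂ ε z v x) =
      a * (gibbs β (level ε z) x * levelDeriv₂ ε z v x) -
      a * β * (gibbs β (level ε z) x * levelDeriv ε z v x ^ 2) +
      a * β * S * (gibbs β (level ε z) x * levelDeriv ε z v x) := fun x => by ring
  simp only [h4]
  rw [Finset.sum_add_distrib, Finset.sum_sub_distrib, ← Finset.mul_sum, ← Finset.mul_sum,
    ← Finset.mul_sum, ← hS]
  ring

lemma continuous_softMin_level {E : Type*} [NormedAddCommGroup E] [Nonempty σ]
    (β ε : ℝ) :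
    Continuous fun y : σ → E × ℝ => softMin β (level ε y) := by
  refine continuous_const.mul (Continuous.log (continuous_finsetSum _ fun x _ =>
    (continuous_const.mul (continuous_level ε x)).rexp) fun _ => (sum_exp_pos _ _).ne')

lemma continuous_gibbs_level {E : Type*} [NormedAddCommGroup E] [Nonempty σ]
    (β ε : ℝ) (x : σ) :
    Continuous fun y : σ → E × ℝ => gibbs β (level ε y) x :=
  (continuous_const.mul (continuous_level ε x)).rexp.div (continuous_finsetSum _ fun x _ =>
    (continuous_const.mul (continuous_level ε x)).rexp) fun _ => (sum_exp_pos _ _).ne'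

lemma abs_sum_gibbs_mul_le [Nonempty σ] (β : ℝ) (r f : σ → ℝ) {C : ℝ} (hf : ∀ x, |f x| ≤ C) :
    |∑ x, gibbs β r x * f x| ≤ C := by
  calc |∑ x, gibbs β r x * f x| ≤ ∑ x, gibbs β r x * C := by
        refine (Finset.abs_sum_le_sum_abs _ _).trans (Finset.sum_le_sum fun x _ => ?_)
        rw [abs_mul, abs_of_nonneg (gibbs_nonneg β r x)]
        exact mul_le_mul_of_nonneg_left (hf x) (gibbs_nonneg β r x)
    _ = C := by rw [← Finset.sum_mul, sum_gibbs, one_mul]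

lemma exists_bound_softMinLevelDeriv [Nonempty σ] {β ε : ℝ} (hβ : 0 < β) (hε : 0 < ε) (v : σ → E × ℝ) :
    ∃ C, ∀ y, |softMinLevelDeriv β ε y v| ≤ C ∧ |softMinLevelDeriv₂ β ε y v| ≤ C := by
  refine ⟨2 * ‖v‖ + (‖v‖ ^ 2 / ε + β * ((2 * ‖v‖) ^ 2 + (2 * ‖v‖) ^ 2)), fun y => ?_⟩
  have h1 : |∑ x, gibbs β (level ε y) x * levelDeriv ε y v x| ≤ 2 * ‖v‖ :=
    abs_sum_gibbs_mul_le β _ _ (abs_levelDeriv_le hε y v)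
  have h2 : |∑ x, gibbs β (level ε y) x * levelDeriv₂ ε y v x| ≤ ‖v‖ ^ 2 / ε :=
    abs_sum_gibbs_mul_le β _ _ (abs_levelDeriv₂_le hε y v)
  have h3 : |∑ x, gibbs β (level ε y) x * levelDeriv ε y v x ^ 2| ≤ (2 * ‖v‖) ^ 2 :=
    abs_sum_gibbs_mul_le β _ _ fun x => by
      rw [abs_pow]; exact pow_le_pow_left₀ (abs_nonneg _) (abs_levelDeriv_le hε y v x) 2
  have hnn : 0 ≤ ‖v‖ ^ 2 / ε := by positivity
  constructor
  · refine h1.trans (le_add_of_nonneg_right ?_)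
    positivity
  · rw [softMinLevelDeriv₂]
    have h4 : |(∑ x, gibbs β (level ε y) x * levelDeriv ε y v x) ^ 2| ≤ (2 * ‖v‖) ^ 2 := by
      rw [abs_pow]; exact pow_le_pow_left₀ (abs_nonneg _) h1 2
    refine (abs_sub _ _).trans ?_
    rw [abs_mul, abs_of_pos hβ]
    have h5 := mul_le_mul_of_nonneg_left ((abs_sub _ _).trans (add_le_add h3 h4)) hβ.le
    linarith [norm_nonneg v]

end SoftMin

section Gordon

variable {σ κ ν : Type*} [Fintype σ] [Fintype κ] [Fintype ν]

lemma sum_sq_sum_mul (p : σ → ℝ) (f : σ → ν → ℝ) :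
    ∑ b, (∑ x, p x * f x b) ^ 2 = ∑ x, ∑ y, p x * p y * ∑ b, f x b * f y b := by
  simp only [sq, Finset.sum_mul_sum]
  rw [Finset.sum_comm]
  refine Finset.sum_congr rfl fun x _ => ?_
  rw [Finset.sum_comm]
  refine Finset.sum_congr rfl fun y _ => ?_
  rw [Finset.mul_sum]
  exact Finset.sum_congr rfl fun b _ => by ring

lemma sum_mul_le_one {σ : Type*} {f : σ → ν → ℝ} (hf : ∀ x, ∑ b, f x b ^ 2 ≤ 1) (x y : σ) :
    ∑ b, f x b * f y b ≤ 1 := by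
  have : ∑ b, f x b * f y b ≤ ∑ b, (f x b ^ 2 + f y b ^ 2) / 2 :=
    Finset.sum_le_sum fun b _ => by nlinarith [sq_nonneg (f x b - f y b)]
  rw [← Finset.sum_div, Finset.sum_add_distrib] at this
  linarith [hf x, hf y]

lemma sum_sq_add_sum_sq_le {p : σ → ℝ} (hp : ∀ x, 0 ≤ p x) (hp1 : ∑ x, p x = 1)
    {u : σ → ν → ℝ} (hu : ∀ x, ∑ b, u x b ^ 2 ≤ 1) {d : σ → κ → ℝ} (hd : ∀ x, ∑ j, d x j ^ 2 ≤ 1) :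
    ∑ b, (∑ x, p x * u x b) ^ 2 + ∑ j, (∑ x, p x * d x j) ^ 2 ≤
      1 + ∑ i : κ × ν, (∑ x, p x * (u x i.2 * d x i.1)) ^ 2 := by
  have h1 : (1 : ℝ) = ∑ x, ∑ y, p x * p y * 1 := by
    simp only [mul_one]
    rw [← Finset.sum_mul_sum, hp1, one_mul]
  rw [sum_sq_sum_mul p u, sum_sq_sum_mul p d, h1,
    sum_sq_sum_mul p (fun x (i : κ × ν) => u x i.2 * d x i.1),
    ← Finset.sum_add_distrib, ← Finset.sum_add_distrib]
  refine Finset.sum_le_sum fun x _ => ?_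
  rw [← Finset.sum_add_distrib, ← Finset.sum_add_distrib]
  refine Finset.sum_le_sum fun y _ => ?_
  have hprod : ∑ i : κ × ν, u x i.2 * d x i.1 * (u y i.2 * d y i.1) =
      (∑ b, u x b * u y b) * ∑ j, d x j * d y j := by
    rw [mul_comm, Finset.sum_mul_sum, Fintype.sum_prod_type]
    exact Finset.sum_congr rfl fun j _ => Finset.sum_congr rfl fun b _ => by ring
  rw [hprod]
  nlinarith [mul_nonneg (mul_nonneg (hp x) (hp y))
    (mul_nonneg (sub_nonneg.2 (sum_mul_le_one hu x y)) (sub_nonneg.2 (sum_mul_le_one hd x y)))]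

lemma continuous_softMinLevelDeriv [Nonempty σ] {E : Type*} [NormedAddCommGroup E]
    [InnerProductSpace ℝ E] {β ε : ℝ} (hε : 0 < ε) (v : σ → E × ℝ) :
    Continuous fun y : σ → E × ℝ => softMinLevelDeriv β ε y v :=
  continuous_finsetSum _ fun x _ =>
    (continuous_gibbs_level β ε x).mul (continuous_levelDeriv hε v x)

lemma continuous_softMinLevelDeriv₂ [Nonempty σ] {E : Type*} [NormedAddCommGroup E]
    [InnerProductSpace ℝ E] {β ε : ℝ} (hε : 0 < ε) (v : σ → E × ℝ) :
    Continuous fun y : σ → E × ℝ => softMinLevelDeriv₂ β ε y v := by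
  have hg := continuous_gibbs_level (E := E) (σ := σ) β ε
  have h1 := continuous_levelDeriv hε v
  have h2 := continuous_levelDeriv₂ hε v
  unfold softMinLevelDeriv₂
  fun_prop

/-- The directions of the Gordon interpolation: the entries of a Gaussian matrix, and those of two
independent Gaussian vectors. -/
noncomputable def gordonDir [DecidableEq κ] (u : σ → ν → ℝ) :
    (κ × ν) ⊕ (ν ⊕ κ) → σ → EuclideanSpace ℝ κ × ℝ
  | .inl i => fun x => (u x i.2 • EuclideanSpace.single i.1 1, 0)
  | .inr (.inl b) => fun x => (0, u x b)
  | .inr (.inr j) => fun _ => (EuclideanSpace.single j 1, 0)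

lemma gordonDir_sum_nonneg [Nonempty σ] [DecidableEq κ] {u : σ → ν → ℝ}
    (hu : ∀ x, ∑ b, u x b ^ 2 = 1) {β ε : ℝ} (hβ : 0 < β) (hε : 0 < ε)
    (y : σ → EuclideanSpace ℝ κ × ℝ) :
    0 ≤ ∑ i : κ × ν, softMinLevelDeriv₂ β ε y (gordonDir u (.inl i)) -
      (∑ b : ν, softMinLevelDeriv₂ β ε y (gordonDir u (.inr (.inl b))) +
      ∑ j : κ, softMinLevelDeriv₂ β ε y (gordonDir u (.inr (.inr j)))) := by
  set p := gibbs β (level ε y) with hp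
  set N : σ → ℝ := fun x => smoothNorm ε (y x).1 with hN
  have hNpos : ∀ x, 0 < N x := fun x => smoothNorm_pos hε _
  set d : σ → κ → ℝ := fun x j => (y x).1 j / N x with hd
  have hd1 : ∀ x, ∑ j, d x j ^ 2 ≤ 1 := by
    intro x
    simp only [hd, div_pow]
    rw [← Finset.sum_div, div_le_one (pow_pos (hNpos x) 2), ← EuclideanSpace.real_norm_sq_eq]
    exact pow_le_pow_left₀ (norm_nonneg _) (norm_le_smoothNorm ε _) 2
  have e1 : ∀ i : κ × ν, softMinLevelDeriv₂ β ε y (gordonDir u (.inl i)) =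
      ∑ x, p x * (u x i.2 ^ 2 * ((1 - d x i.1 ^ 2) / N x)) -
        β * (∑ x, p x * (u x i.2 ^ 2 * d x i.1 ^ 2) -
          (∑ x, p x * (u x i.2 * d x i.1)) ^ 2) := by
    intro i
    simp only [softMinLevelDeriv₂, levelDeriv₂, levelDeriv, gordonDir, inner_smul_right,
      EuclideanSpace.inner_single_right, norm_smul, PiLp.norm_single, hd, ← hp, hN,
      conj_trivial, one_mul, norm_one, mul_one, add_zero, Real.norm_eq_abs, sq_abs]
    congr 1
    · refine Finset.sum_congr rfl fun x _ => ?_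
      ring
    · congr 2
      · refine Finset.sum_congr rfl fun x _ => ?_
        ring
      · congr 1
        refine Finset.sum_congr rfl fun x _ => ?_
        ring
  have e2 : ∀ b : ν, softMinLevelDeriv₂ β ε y (gordonDir u (.inr (.inl b))) =
      - β * (∑ x, p x * (u x b ^ 2) - (∑ x, p x * u x b) ^ 2) := by
    intro b
    simp only [softMinLevelDeriv₂, levelDeriv₂, levelDeriv, gordonDir, ← hp, inner_zero_right,
      norm_zero, zero_div, zero_add]
    simp
  have e3 : ∀ j : κ, softMinLevelDeriv₂ β ε y (gordonDir u (.inr (.inr j))) =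
      ∑ x, p x * ((1 - d x j ^ 2) / N x) -
        β * (∑ x, p x * (d x j ^ 2) - (∑ x, p x * d x j) ^ 2) := by
    intro j
    simp only [softMinLevelDeriv₂, levelDeriv₂, levelDeriv, gordonDir,
      EuclideanSpace.inner_single_right, PiLp.norm_single, hd, ← hp, hN,
      conj_trivial, one_mul, norm_one, add_zero, one_pow]
  have marg : ∀ f : σ → κ → ℝ, ∑ i : κ × ν, ∑ x, p x * (u x i.2 ^ 2 * f x i.1) =
      ∑ j, ∑ x, p x * f x j := by
    intro f
    rw [Fintype.sum_prod_type]
    refine Finset.sum_congr rfl fun j _ => ?_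
    rw [Finset.sum_comm]
    refine Finset.sum_congr rfl fun x _ => ?_
    dsimp only
    rw [← Finset.mul_sum, ← Finset.sum_mul, hu x, one_mul]
  have m2 : ∑ b, ∑ x, p x * u x b ^ 2 = 1 := by
    rw [Finset.sum_comm]
    simp only [← Finset.mul_sum, hu, mul_one]
    exact sum_gibbs _ _
  simp only [e1, e2, e3]
  simp only [Finset.sum_sub_distrib, ← Finset.mul_sum]
  rw [marg fun x j => (1 - d x j ^ 2) / N x, marg fun x j => d x j ^ 2, m2]
  have := sum_sq_add_sum_sq_le (gibbs_nonneg β (level ε y)) (sum_gibbs _ _)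
    (fun x => (hu x).le) hd1
  rw [← hp] at this
  nlinarith

/-- **Gordon's inequality** for a Gaussian matrix and finitely many unit vectors, in a smoothed
form. -/
theorem gordon_softMin_le [Nonempty σ] {u : σ → ν → ℝ} (hu : ∀ x, ∑ b, u x b ^ 2 = 1) {β ε : ℝ}
    (hβ : 0 < β) (hε : 0 < ε) :
    ∫ w : (κ × ν) ⊕ (ν ⊕ κ) → ℝ, smoothNorm ε (WithLp.toLp 2 fun j => w (.inr (.inr j))) +
        softMin β (fun x => ∑ b, w (.inr (.inl b)) * u x b) ∂(piGauss _) ≤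
      ∫ w : (κ × ν) ⊕ (ν ⊕ κ) → ℝ, softMin β (fun x => smoothNorm ε
        (WithLp.toLp 2 fun j => ∑ b, w (.inl (j, b)) * u x b)) ∂(piGauss _) := by
  classical
  set c : (κ × ν) ⊕ (ν ⊕ κ) → ℝ → ℝ := Sum.elim (fun _ => Real.sin) (fun _ => Real.cos) with hc
  set c' : (κ × ν) ⊕ (ν ⊕ κ) → ℝ → ℝ :=
    Sum.elim (fun _ => Real.cos) (fun _ θ => -Real.sin θ) with hc'
  set f : ℝ → ℝ := fun θ => ∫ w : (κ × ν) ⊕ (ν ⊕ κ) → ℝ,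
    softMin β (level ε (∑ i, (c i θ * w i) • gordonDir u i)) ∂(piGauss _) with hf
  have hder := hasDerivAt_integral_piGauss_curve (F := fun y => softMin β (level ε y))
    (D := softMinLevelDeriv β ε) (D₂ := softMinLevelDeriv₂ β ε)
    (hasDerivAt_softMin_level hβ hε) (hasDerivAt_softMinLevelDeriv hε)
    (continuous_softMin_level β ε)
    (continuous_softMinLevelDeriv hε) (continuous_softMinLevelDeriv₂ hε)
    (exists_bound_softMinLevelDeriv hβ hε) (gordonDir (κ := κ) u) (c := c) (c' := c')
    (by rintro (i | i) θ
        · exact Real.hasDerivAt_sin θ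
        · exact Real.hasDerivAt_cos θ)
    (by rintro (i | i) θ
        · exact Real.abs_sin_le_one θ
        · exact Real.abs_cos_le_one θ)
    (by rintro (i | i) θ
        · exact Real.abs_cos_le_one θ
        · simpa [hc'] using Real.abs_sin_le_one θ)
  have hpi := Real.pi_pos
  have hmono : MonotoneOn f (Set.Icc 0 (Real.pi / 2)) := by
    refine monotoneOn_of_deriv_nonneg (convex_Icc _ _)
      (fun θ _ => (hder θ).continuousAt.continuousWithinAt)
      (fun θ _ => (hder θ).differentiableAt.differentiableWithinAt) fun θ hθ => ?_
    rw [interior_Icc] at hθ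
    rw [(hder θ).deriv]
    refine integral_nonneg fun w => ?_
    have hs : 0 ≤ Real.sin θ := Real.sin_nonneg_of_nonneg_of_le_pi hθ.1.le (by linarith [hθ.2])
    have hcs : 0 ≤ Real.cos θ := Real.cos_nonneg_of_mem_Icc ⟨by linarith [hθ.1], hθ.2.le⟩
    have := mul_nonneg (mul_nonneg hs hcs)
      (gordonDir_sum_nonneg hu hβ hε (∑ i, (c i θ * w i) • gordonDir (κ := κ) u i))
    refine this.trans_eq ?_
    generalize ∑ i, (c i θ * w i) • gordonDir (κ := κ) u i = y
    simp only [Fintype.sum_sum_type]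
    simp only [hc, hc', Sum.elim_inl, Sum.elim_inr, mul_sub, mul_add, Finset.mul_sum]
    rw [sub_eq_add_neg, neg_add, ← Finset.sum_neg_distrib, ← Finset.sum_neg_distrib]
    congr 2 <;> refine Finset.sum_congr rfl fun _ _ => ?_ <;> ring
  have h := hmono (Set.left_mem_Icc.2 (by positivity)) (Set.right_mem_Icc.2 (by positivity))
    (by positivity : (0 : ℝ) ≤ Real.pi / 2)
  have hval : ∀ θ (w : (κ × ν) ⊕ (ν ⊕ κ) → ℝ), level ε (∑ i, (c i θ * w i) • gordonDir u i) =
      fun x => smoothNorm ε (WithLp.toLp 2 fun j => Real.sin θ * (∑ b, w (.inl (j, b)) * u x b) +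
        Real.cos θ * w (.inr (.inr j))) +
        Real.cos θ * ∑ b, w (.inr (.inl b)) * u x b := by
    intro θ w
    ext x
    rw [level, Fintype.sum_sum_type, Fintype.sum_sum_type, Fintype.sum_prod_type]
    simp only [hc, Sum.elim_inl, Sum.elim_inr, gordonDir, Pi.add_apply, Finset.sum_apply,
      Pi.smul_apply, Prod.fst_add, Prod.snd_add, Prod.fst_sum, Prod.snd_sum, Prod.smul_fst,
      Prod.smul_snd, smul_zero, Finset.sum_const_zero, zero_add, add_zero, smul_eq_mul,
      mul_zero]
    congr 2
    · ext j
      simp [Finset.sum_apply, Pi.single_apply, Finset.mul_sum, mul_assoc]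
    · rw [Finset.mul_sum]
      exact Finset.sum_congr rfl fun _ _ => by ring
  simp only [hf, hval, Real.sin_zero, Real.cos_zero, Real.sin_pi_div_two, Real.cos_pi_div_two,
    zero_mul, one_mul, zero_add, add_zero, softMin_add_const hβ] at h
  exact h

end Gordon

section GaussianNorm

variable {ι : Type*} [Fintype ι]

lemma piGauss_eq_withDensity :
    piGauss ι = (volume : Measure (ι → ℝ)).withDensity
      fun w => ENNReal.ofReal (∏ i, gaussianPDFReal 0 1 (w i)) := by
  refine Measure.pi_eq fun s hs => ?_
  have hint : ∀ i, IntegrableOn (gaussianPDFReal 0 1) (s i) := fun i =>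
    (integrable_gaussianPDFReal 0 1).integrableOn
  rw [withDensity_apply _ (MeasurableSet.univ_pi hs), volume_pi, Measure.restrict_pi_pi,
    ← ofReal_integral_eq_lintegral_ofReal, integral_fintype_prod_eq_prod,
    ENNReal.ofReal_prod_of_nonneg]
  · refine Finset.prod_congr rfl fun i _ => ?_
    rw [gaussianReal_apply_eq_integral 0 one_ne_zero]
  · exact fun i _ => integral_nonneg fun _ => gaussianPDFReal_nonneg _ _ _
  · exact Integrable.fintype_prod fun i => hint i
  · exact ae_of_all _ fun w => Finset.prod_nonneg fun i _ => gaussianPDFReal_nonneg _ _ _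

lemma exists_integral_norm_piGauss [Nonempty ι] :
    ∃ K : ℝ, ∀ f : ℝ → ℝ, ∫ w : ι → ℝ, f ‖WithLp.toLp 2 w‖ ∂(piGauss ι) =
      K * ∫ y in Set.Ioi (0 : ℝ), y ^ (Fintype.card ι - 1) * (f y * Real.exp (-(1 / 2) * y ^ 2)) := by
  refine ⟨(√(2 * Real.pi))⁻¹ ^ Fintype.card ι * (Fintype.card ι *
    (volume : Measure (EuclideanSpace ℝ ι)).real (Metric.ball 0 1)), fun f => ?_⟩
  have hprod : ∀ w : ι → ℝ, ∏ i, gaussianPDFReal 0 1 (w i) =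
      (√(2 * Real.pi))⁻¹ ^ Fintype.card ι * Real.exp (-(1 / 2) * ‖WithLp.toLp 2 w‖ ^ 2) := by
    intro w
    simp only [gaussianPDFReal, Finset.prod_mul_distrib, ← Real.exp_sum,
      EuclideanSpace.real_norm_sq_eq, Finset.mul_sum]
    simp only [NNReal.coe_one, mul_one, Finset.prod_const, Finset.card_univ, sub_zero]
    congr 2
    exact Finset.sum_congr rfl fun i _ => by ring
  have hmeas : Measurable fun w : ι → ℝ => ∏ i, gaussianPDFReal 0 1 (w i) :=
    Finset.measurable_prod _ fun i _ =>
      (measurable_gaussianPDFReal 0 1).comp (measurable_pi_apply i)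
  rw [piGauss_eq_withDensity, integral_withDensity_eq_integral_toReal_smul
    hmeas.ennreal_ofReal (ae_of_all _ fun _ => ENNReal.ofReal_lt_top)]
  have h1 : ∀ w : ι → ℝ, (ENNReal.ofReal (∏ i, gaussianPDFReal 0 1 (w i))).toReal •
      f ‖WithLp.toLp 2 w‖ = (√(2 * Real.pi))⁻¹ ^ Fintype.card ι *
        (fun x : EuclideanSpace ℝ ι => (fun y => f y * Real.exp (-(1 / 2) * y ^ 2)) ‖x‖)
          (WithLp.toLp 2 w) := by
    intro w
    rw [ENNReal.toReal_ofReal (Finset.prod_nonneg fun i _ => gaussianPDFReal_nonneg _ _ _),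
      hprod, smul_eq_mul]
    ring
  have h2 := ((PiLp.volume_preserving_toLp ι).integral_comp
    (MeasurableEquiv.toLp 2 (ι → ℝ)).measurableEmbedding
    (fun x : EuclideanSpace ℝ ι => (fun y => f y * Real.exp (-(1 / 2) * y ^ 2)) ‖x‖)).trans
    (integral_fun_norm_addHaar (volume : Measure (EuclideanSpace ℝ ι))
      fun y => f y * Real.exp (-(1 / 2) * y ^ 2))
  rw [integral_congr_ae (ae_of_all _ h1), integral_const_mul, h2, finrank_euclideanSpace, nsmul_eq_mul]
  simp only [smul_eq_mul]
  ring

lemma integral_norm_piGauss [Nonempty ι] :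
    ∫ w : ι → ℝ, ‖WithLp.toLp 2 w‖ ∂(piGauss ι) =
      √2 * Real.Gamma ((Fintype.card ι + 1) / 2) / Real.Gamma (Fintype.card ι / 2) := by
  obtain ⟨K, hK⟩ := exists_integral_norm_piGauss (ι := ι)
  have hm : 1 ≤ Fintype.card ι := Fintype.card_pos
  set m := Fintype.card ι
  have hm' : (1 : ℝ) ≤ m := by exact_mod_cast hm
  have e : ∀ q : ℕ, ∫ y in Set.Ioi (0 : ℝ), y ^ q * Real.exp (-(1 / 2) * y ^ 2) =
      (1 / 2 : ℝ) ^ (-((q : ℝ) + 1) / 2) * (1 / 2) * Real.Gamma (((q : ℝ) + 1) / 2) := by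
    intro q
    rw [← integral_rpow_mul_exp_neg_mul_rpow two_pos (by linarith [q.cast_nonneg (α := ℝ)])
      (by norm_num)]
    simp only [Real.rpow_natCast, Real.rpow_ofNat]
  have h1 := hK fun _ => 1
  have h2 := hK fun y => y
  have e2 : ∀ y : ℝ, y ^ (m - 1) * (y * Real.exp (-(1 / 2) * y ^ 2)) =
      y ^ m * Real.exp (-(1 / 2) * y ^ 2) := by
    intro y
    rw [← mul_assoc, ← pow_succ, Nat.sub_add_cancel hm]
  simp only [integral_const, probReal_univ, smul_eq_mul, one_mul, e] at h1
  simp only [e2, e] at h2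
  rw [h2]
  rw [Nat.cast_sub hm, Nat.cast_one, sub_add_cancel] at h1
  have hG : 0 < Real.Gamma ((m : ℝ) / 2) := Real.Gamma_pos_of_pos (by linarith)
  rw [eq_div_iff hG.ne']
  have h3 : (1 / 2 : ℝ) ^ (-((m : ℝ) + 1) / 2) = (1 / 2 : ℝ) ^ (-(m : ℝ) / 2) * √2 := by
    rw [show -((m : ℝ) + 1) / 2 = -(m : ℝ) / 2 + -(1 / 2) by ring,
      Real.rpow_add (by norm_num), Real.rpow_neg (by norm_num) (1 / 2), ← Real.sqrt_eq_rpow,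
      Real.sqrt_div zero_le_one, Real.sqrt_one, one_div √2, inv_inv]
  rw [h3]
  linear_combination (-√2 * Real.Gamma ((m + 1) / 2)) * h1

lemma le_integral_norm_piGauss (hm : 2 ≤ Fintype.card ι) :
    √((Fintype.card ι + 1) / 2) ≤ ∫ w : ι → ℝ, ‖WithLp.toLp 2 w‖ ∂(piGauss ι) := by
  have : Nonempty ι := Fintype.card_pos_iff.1 (by omega)
  rw [integral_norm_piGauss]
  generalize Fintype.card ι = m at hm
  refine Real.sqrt_le_iff.2 ⟨by positivity, ?_⟩
  rw [div_pow, mul_pow, Real.sq_sqrt zero_le_two]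
  rcases hm.eq_or_lt with rfl | hm
  · norm_num
    rw [show (3 / 2 : ℝ) = 1 / 2 + 1 by norm_num, Real.Gamma_add_one (by norm_num),
      Real.Gamma_one_half_eq, mul_pow, Real.sq_sqrt Real.pi_pos.le]
    linarith [Real.pi_gt_three]
  · have hm' : (3 : ℝ) ≤ m := by exact_mod_cast hm
    have hx : (0 : ℝ) < (m - 1) / 2 := by linarith
    have hG : 0 < Real.Gamma ((m : ℝ) / 2) := Real.Gamma_pos_of_pos (by linarith)
    have hG1 : 0 < Real.Gamma (((m : ℝ) - 1) / 2) := Real.Gamma_pos_of_pos hx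
    have h1 : Real.Gamma (((m : ℝ) + 1) / 2) = (m - 1) / 2 * Real.Gamma ((m - 1) / 2) := by
      rw [← Real.Gamma_add_one hx.ne']
      ring_nf
    have h2 := Real.Gamma_mul_add_mul_le_rpow_Gamma_mul_rpow_Gamma hx
      (by linarith : (0 : ℝ) < ((m : ℝ) + 1) / 2) (a := 1 / 2) (b := 1 / 2) (by norm_num)
      (by norm_num) (by norm_num)
    rw [show (1 / 2 : ℝ) * ((m - 1) / 2) + 1 / 2 * ((m + 1) / 2) = m / 2 by ring,
      ← Real.sqrt_eq_rpow, ← Real.sqrt_eq_rpow, ← Real.sqrt_mul hG1.le] at h2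
    have h3 := (Real.le_sqrt' hG).1 h2
    rw [le_div_iff₀ (by positivity)]
    rw [h1] at h3 ⊢
    nlinarith [mul_pos hG1 hG1]

end GaussianNorm

section GaussianIntegrals

variable {ι ι' : Type*} [Fintype ι] [Fintype ι']

lemma measurePreserving_inl_piGauss :
    MeasurePreserving (fun (w : ι ⊕ ι' → ℝ) i => w (.inl i)) (piGauss (ι ⊕ ι')) (piGauss ι) :=
  measurePreserving_fst.comp
    (measurePreserving_sumPiEquivProdPi fun _ : ι ⊕ ι' => gaussianReal 0 1)

lemma measurePreserving_inr_piGauss :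
    MeasurePreserving (fun (w : ι ⊕ ι' → ℝ) i => w (.inr i)) (piGauss (ι ⊕ ι')) (piGauss ι') :=
  measurePreserving_snd.comp
    (measurePreserving_sumPiEquivProdPi fun _ : ι ⊕ ι' => gaussianReal 0 1)

lemma integrable_sq_norm_piGauss :
    Integrable (fun w : ι → ℝ => ‖WithLp.toLp 2 w‖ ^ 2) (piGauss ι) := by
  simp only [EuclideanSpace.real_norm_sq_eq]
  exact integrable_finsetSum _ fun i _ => (memLp_eval_piGauss i 2 (by simp)).integrable_sq

/-- A continuous function of quadratic growth is integrable against the Gaussian measure. -/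
lemma integrable_piGauss_of_le {f : (ι → ℝ) → ℝ} (hf : Continuous f) {a b : ℝ}
    (h : ∀ w, |f w| ≤ a + b * ‖WithLp.toLp 2 w‖ ^ 2) : Integrable f (piGauss ι) :=
  ((integrable_const a).add (integrable_sq_norm_piGauss.const_mul b)).mono'
    hf.aestronglyMeasurable (ae_of_all _ h)

lemma integral_inner_sq_piGauss (v : EuclideanSpace ℝ ι) :
    ∫ w : ι → ℝ, inner ℝ v (WithLp.toLp 2 w) ^ 2 ∂(piGauss ι) = ‖v‖ ^ 2 := by
  have h1 := variance_dual_stdGaussian (innerSL ℝ v)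
  rw [variance_of_integral_eq_zero (innerSL ℝ v).continuous.aemeasurable
    (integral_strongDual_stdGaussian _), innerSL_apply_norm, ← map_pi_eq_stdGaussian,
    integral_map (by fun_prop) (by fun_prop)] at h1
  exact h1

variable {Y : Type*} [SeminormedAddCommGroup Y] [NormedSpace ℝ Y] {n : ℕ}

lemma sq_norm_apply_le (S : EuclideanSpace ℝ ι →L[ℝ] Y) (w : ι → ℝ) :
    ‖S (WithLp.toLp 2 w)‖ ^ 2 ≤ ‖S‖ ^ 2 * ‖WithLp.toLp 2 w‖ ^ 2 := by
  rw [← mul_pow]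
  exact pow_le_pow_left₀ (norm_nonneg _) (S.le_opNorm _) 2

lemma integrable_sq_norm_apply (S : EuclideanSpace ℝ ι →L[ℝ] Y) :
    Integrable (fun w : ι → ℝ => ‖S (WithLp.toLp 2 w)‖ ^ 2) (piGauss ι) :=
  integrable_piGauss_of_le (a := 0) (b := ‖S‖ ^ 2) (by fun_prop) fun w => by
    rw [abs_of_nonneg (by positivity), zero_add]
    exact sq_norm_apply_le S w

lemma integrable_norm_apply (S : EuclideanSpace ℝ ι →L[ℝ] Y) :
    Integrable (fun w : ι → ℝ => ‖S (WithLp.toLp 2 w)‖) (piGauss ι) :=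
  integrable_piGauss_of_le (a := 1) (b := ‖S‖ ^ 2) (by fun_prop) fun w => by
    rw [abs_of_nonneg (by positivity)]
    nlinarith [sq_norm_apply_le S w, sq_nonneg (‖S (WithLp.toLp 2 w)‖ - 1)]

lemma ellNormFin_nonneg (S : EuclideanSpace ℝ (Fin n) →L[ℝ] Y) : 0 ≤ ellNormFin S :=
  Real.rpow_nonneg (integral_nonneg fun _ => by positivity) _

lemma sq_ellNormFin (S : EuclideanSpace ℝ (Fin n) →L[ℝ] Y) :
    ellNormFin S ^ 2 = ∫ w : Fin n → ℝ, ‖S (WithLp.toLp 2 w)‖ ^ 2 ∂(piGauss (Fin n)) := by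
  rw [ellNormFin, ← Real.sqrt_eq_rpow, Real.sq_sqrt (integral_nonneg fun _ => by positivity)]
  rfl

lemma integral_norm_apply_le (S : EuclideanSpace ℝ (Fin n) →L[ℝ] Y) :
    ∫ w : Fin n → ℝ, ‖S (WithLp.toLp 2 w)‖ ∂(piGauss (Fin n)) ≤ ellNormFin S := by
  refine le_of_sq_le_sq ?_ (ellNormFin_nonneg S)
  set c := ∫ w : Fin n → ℝ, ‖S (WithLp.toLp 2 w)‖ ∂(piGauss (Fin n)) with hc
  have h1 := integrable_sq_norm_apply S
  have h2 := (integrable_norm_apply S).const_mul (2 * c)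
  have h : 0 ≤ ∫ w : Fin n → ℝ, (‖S (WithLp.toLp 2 w)‖ - c) ^ 2 ∂(piGauss (Fin n)) :=
    integral_nonneg fun _ => by positivity
  have e : ∀ w : Fin n → ℝ, (‖S (WithLp.toLp 2 w)‖ - c) ^ 2 =
      ‖S (WithLp.toLp 2 w)‖ ^ 2 - 2 * c * ‖S (WithLp.toLp 2 w)‖ + c ^ 2 := fun w => by ring
  have h3 : Integrable (fun w : Fin n → ℝ => ‖S (WithLp.toLp 2 w)‖ ^ 2 -
      2 * c * ‖S (WithLp.toLp 2 w)‖) (piGauss (Fin n)) := h1.sub h2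
  simp only [e] at h
  rw [integral_add h3 (integrable_const _), integral_sub h1 h2, integral_const_mul,
    ← hc, ← sq_ellNormFin] at h
  simp only [integral_const, probReal_univ, one_smul] at h
  nlinarith

lemma norm_dual_comp_le_ellNormFin (S : EuclideanSpace ℝ (Fin n) →L[ℝ] Y) (y : Y →L[ℝ] ℝ) (hy : ‖y‖ ≤ 1) :
    ‖y.comp S‖ ≤ ellNormFin S := by
  refine le_of_sq_le_sq ?_ (ellNormFin_nonneg S)
  set v := (InnerProductSpace.toDual ℝ (EuclideanSpace ℝ (Fin n))).symm (y.comp S) with hv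
  have e : ∀ x, inner ℝ v x = y (S x) := fun x => by
    rw [hv, InnerProductSpace.toDual_symm_apply]; rfl
  have hn : ‖y.comp S‖ = ‖v‖ := by rw [hv, LinearIsometryEquiv.norm_map]
  rw [hn, ← integral_inner_sq_piGauss, sq_ellNormFin]
  refine integral_mono ?_ (integrable_sq_norm_apply S) fun w => ?_
  · simpa using integrable_sq_norm_apply (innerSL ℝ v)
  · simp only [e]
    rw [← sq_abs (y (S (WithLp.toLp 2 w)))]
    have := y.le_of_opNorm_le hy (S (WithLp.toLp 2 w))
    rw [one_mul, Real.norm_eq_abs] at this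
    exact pow_le_pow_left₀ (abs_nonneg _) this 2

lemma opNorm_le_ellNormFin (S : EuclideanSpace ℝ (Fin n) →L[ℝ] Y) : ‖S‖ ≤ ellNormFin S := by
  refine S.opNorm_le_bound (ellNormFin_nonneg S) fun x => ?_
  obtain ⟨y, hy, hyx⟩ := exists_dual_vector'' ℝ (S x)
  have := (y.comp S).le_of_opNorm_le (norm_dual_comp_le_ellNormFin S y hy) x
  rw [ContinuousLinearMap.comp_apply, hyx] at this
  simpa using this

end GaussianIntegrals

section GordonNet

lemma integrable_of_le_of_le {α : Type*} [MeasurableSpace α] {μ : Measure α} {f l u : α → ℝ}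
    (hf : AEStronglyMeasurable f μ) (hl : Integrable l μ) (hu : Integrable u μ)
    (hlf : ∀ x, l x ≤ f x) (hfu : ∀ x, f x ≤ u x) : Integrable f μ :=
  (hl.abs.add hu.abs).mono' hf <| ae_of_all _ fun x => by
    change |f x| ≤ |l x| + |u x|
    exact abs_le.2 ⟨by linarith [neg_abs_le (l x), abs_nonneg (u x), hlf x],
      by linarith [le_abs_self (u x), abs_nonneg (l x), hfu x]⟩

lemma integral_comp_eq_of_measurePreserving {α γ : Type*} [MeasurableSpace α] [MeasurableSpace γ]
    {μ : Measure α} {ν : Measure γ} {e : α → γ} (he : MeasurePreserving e μ ν) {f : γ → ℝ}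
    (hf : AEStronglyMeasurable f ν) : ∫ x, f (e x) ∂μ = ∫ y, f y ∂ν := by
  rw [← he.map_eq, integral_map he.measurable.aemeasurable (he.map_eq.symm ▸ hf)]

lemma continuous_softMin {σ : Type*} [Fintype σ] [Nonempty σ] (β : ℝ) :
    Continuous (softMin β : (σ → ℝ) → ℝ) :=
  continuous_const.mul (Continuous.log (by fun_prop) fun _ => (sum_exp_pos _ _).ne')

lemma norm_toLp_le_sum_abs {κ : Type*} [Fintype κ] (z : κ → ℝ) :
    ‖WithLp.toLp 2 z‖ ≤ ∑ j, |z j| := by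
  rw [EuclideanSpace.norm_eq, Real.sqrt_le_iff]
  exact ⟨Finset.sum_nonneg fun j _ => abs_nonneg _,
    Finset.sum_sq_le_sq_sum_of_nonneg fun j _ => norm_nonneg _⟩

lemma norm_toLp_sum_mul_le {κ ν : Type*} [Fintype κ] [Fintype ν] (G : κ × ν → ℝ)
    (v : EuclideanSpace ℝ ν) :
    ‖WithLp.toLp 2 fun j => ∑ b, G (j, b) * v b‖ ≤ ‖v‖ * ∑ p, |G p| := by
  refine (norm_toLp_le_sum_abs _).trans ?_
  rw [Fintype.sum_prod_type, Finset.mul_sum]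
  refine Finset.sum_le_sum fun j _ => (Finset.abs_sum_le_sum_abs _ _).trans ?_
  rw [Finset.mul_sum]
  refine Finset.sum_le_sum fun b _ => ?_
  rw [abs_mul, mul_comm]
  exact mul_le_mul_of_nonneg_right (PiLp.norm_apply_le v b) (abs_nonneg _)

/-- Gordon's escape through a mesh: a set of unit vectors which is small in the sense that it is
dominated by `ρ⁻¹ ‖U ·‖` misses the kernel of some `m × n` matrix. -/
lemma exists_matrix_ne_zero {X : Type*} [NormedAddCommGroup X] [NormedSpace ℝ X] {n m : ℕ}
    (hm : 2 ≤ m) (U : EuclideanSpace ℝ (Fin n) →L[ℝ] X) {ρ : ℝ} (hρ : 0 < ρ)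
    (h : ellNormFin U < ρ * √(((m : ℝ) + 1) / 2)) :
    ∃ G : Fin m × Fin n → ℝ, ∀ u : EuclideanSpace ℝ (Fin n), ‖u‖ = 1 →
      (∀ v, ρ * inner ℝ u v ≤ ‖U v‖) → ∃ j, ∑ b, G (j, b) * u b ≠ 0 := by
  by_contra! hcon
  set S : Set (EuclideanSpace ℝ (Fin n)) := {u | ‖u‖ = 1 ∧ ∀ v, ρ * inner ℝ u v ≤ ‖U v‖} with hS
  have hSc : IsCompact S := by
    refine (isCompact_sphere 0 1).of_isClosed_subset ?_ fun u hu => by simpa using hu.1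
    rw [hS, Set.ofPred_and, Set.ofPred_forall]
    exact (isClosed_eq continuous_norm continuous_const).inter
      (isClosed_iInter fun v => isClosed_le (by fun_prop) continuous_const)
  set a := ∫ w : Fin m → ℝ, ‖WithLp.toLp 2 w‖ ∂(piGauss (Fin m)) with ha
  have hae : √(((m : ℝ) + 1) / 2) ≤ a := by
    simpa using le_integral_norm_piGauss (ι := Fin m) (by simpa using hm)
  set η := a - ellNormFin U / ρ with hη
  have hη0 : 0 < η := by
    rw [hη, sub_pos, div_lt_iff₀ hρ, mul_comm]
    exact h.trans_le (mul_le_mul_of_nonneg_left hae hρ.le)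
  set D := ∫ G : Fin m × Fin n → ℝ, ∑ p, |G p| ∂(piGauss (Fin m × Fin n)) with hD
  have hD0 : 0 ≤ D := integral_nonneg fun G => Finset.sum_nonneg fun p _ => abs_nonneg _
  set ε₁ := η / (4 * (D + 1)) with hε₁
  have hε₁0 : 0 < ε₁ := by positivity
  obtain ⟨t, htS, htf, hcov⟩ := hSc.finite_cover_balls hε₁0
  have : Fintype t := htf.fintype
  have hne : Nonempty t := by
    obtain ⟨u, hu1, hu2, -⟩ := hcon 0
    have := hcov (⟨hu1, hu2⟩ : u ∈ S)
    simp only [Set.mem_iUnion] at this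
    obtain ⟨x, hx, -⟩ := this
    exact ⟨⟨x, hx⟩⟩
  set L := Real.log (Fintype.card t) with hL
  have hL0 : 0 ≤ L := Real.log_nonneg (by exact_mod_cast Fintype.card_pos)
  set β := 4 * (L + 1) / η with hβ
  have hβ0 : 0 < β := by positivity
  have hβL : β⁻¹ * L ≤ η / 4 := by
    rw [hβ, inv_div, div_mul_eq_mul_div, div_le_iff₀ (by positivity)]
    nlinarith
  have hε₁D : ε₁ * D ≤ η / 4 := by
    rw [hε₁, div_mul_eq_mul_div, div_le_iff₀ (by positivity)]
    nlinarith
  have hε0 : 0 < η / 4 := by positivity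
  have hu1 : ∀ x : t, ∑ b, (x : EuclideanSpace ℝ (Fin n)) b ^ 2 = 1 := fun x => by
    rw [← EuclideanSpace.real_norm_sq_eq, (htS x.2).1, one_pow]
  have gordon := gordon_softMin_le (κ := Fin m) hu1 hβ0 hε0
  have hsumint : Integrable (fun G : Fin m × Fin n → ℝ => ∑ p, |G p|) (piGauss (Fin m × Fin n)) :=
    integrable_finsetSum _ fun p _ => (integrable_eval_piGauss p).abs
  -- the matrix side
  have hR : ∫ w : (Fin m × Fin n) ⊕ (Fin n ⊕ Fin m) → ℝ, softMin β (fun x : t =>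
      smoothNorm (η / 4) (WithLp.toLp 2 fun j => ∑ b, w (.inl (j, b)) * x.1 b)) ∂(piGauss _) ≤
      η / 4 + ε₁ * D := by
    have hle : ∀ G : Fin m × Fin n → ℝ, softMin β (fun x : t =>
        smoothNorm (η / 4) (WithLp.toLp 2 fun j => ∑ b, G (j, b) * x.1 b)) ≤
        η / 4 + ε₁ * ∑ p, |G p| := by
      intro G
      obtain ⟨u, hu1, hu2, hu3⟩ := hcon G
      have := hcov (⟨hu1, hu2⟩ : u ∈ S)
      simp only [Set.mem_iUnion] at this
      obtain ⟨x, hx, hux⟩ := this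
      rw [Metric.mem_ball, dist_comm, dist_eq_norm] at hux
      refine (softMin_le hβ0 _ ⟨x, hx⟩).trans ((smoothNorm_le hε0.le _).trans ?_)
      have e : (fun j => ∑ b, G (j, b) * x b) = fun j => ∑ b, G (j, b) * (x - u) b := by
        ext j
        simp only [PiLp.sub_apply, mul_sub, Finset.sum_sub_distrib, hu3, sub_zero]
      rw [e]
      gcongr
      exact (norm_toLp_sum_mul_le G (x - u)).trans
        (mul_le_mul_of_nonneg_right hux.le (Finset.sum_nonneg fun p _ => abs_nonneg _))
    have hcont : Continuous fun G : Fin m × Fin n → ℝ => softMin β (fun x : t =>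
        smoothNorm (η / 4) (WithLp.toLp 2 fun j => ∑ b, G (j, b) * x.1 b)) := by
      refine (continuous_softMin β).comp (continuous_pi fun x =>
        (continuous_smoothNorm (η / 4)).comp ?_)
      fun_prop
    have hup : Integrable (fun G : Fin m × Fin n → ℝ => η / 4 + ε₁ * ∑ p, |G p|)
        (piGauss (Fin m × Fin n)) := (integrable_const _).add (hsumint.const_mul ε₁)
    have hint := integrable_of_le_of_le hcont.aestronglyMeasurable
      (integrable_const (0 - β⁻¹ * L) : Integrable _ (piGauss (Fin m × Fin n))) hup
      (fun G => le_softMin hβ0 fun x => (smoothNorm_pos hε0 _).le) hle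
    rw [integral_comp_eq_of_measurePreserving measurePreserving_inl_piGauss
      hcont.aestronglyMeasurable]
    refine (integral_mono hint hup hle).trans ?_
    rw [integral_add (integrable_const _) (hsumint.const_mul ε₁), integral_const_mul]
    simp [← hD]
  -- the vector side
  have hLft : η - η / 4 ≤ ∫ w : (Fin m × Fin n) ⊕ (Fin n ⊕ Fin m) → ℝ,
      smoothNorm (η / 4) (WithLp.toLp 2 fun j => w (.inr (.inr j))) +
        softMin β (fun x : t => ∑ b, w (.inr (.inl b)) * x.1 b) ∂(piGauss _) := by
    have hmp := measurePreserving_inr_piGauss (ι := Fin m × Fin n) (ι' := Fin n ⊕ Fin m)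
    have hg := measurePreserving_inl_piGauss.comp hmp
    have hh := measurePreserving_inr_piGauss.comp hmp
    have j1 := integrable_norm_apply (ContinuousLinearMap.id ℝ (EuclideanSpace ℝ (Fin m)))
    have i1 : Integrable (fun w : (Fin m × Fin n) ⊕ (Fin n ⊕ Fin m) → ℝ =>
      ‖WithLp.toLp 2 fun j => w (.inr (.inr j))‖) (piGauss _) := hh.integrable_comp_of_integrable j1
    have i2 : Integrable (fun w : (Fin m × Fin n) ⊕ (Fin n ⊕ Fin m) → ℝ =>
      ‖U (WithLp.toLp 2 fun b => w (.inr (.inl b)))‖ / ρ + β⁻¹ * L) (piGauss _) :=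
      ((hg.integrable_comp_of_integrable (integrable_norm_apply U)).div_const ρ).add
        (integrable_const _)
    have i3 : Integrable (fun w : (Fin m × Fin n) ⊕ (Fin n ⊕ Fin m) → ℝ =>
        ∑ b, |w (.inr (.inl b))|) (piGauss _) :=
      integrable_finsetSum _ fun b _ => (integrable_eval_piGauss _).abs
    have hlow : ∀ w : (Fin m × Fin n) ⊕ (Fin n ⊕ Fin m) → ℝ,
        ‖WithLp.toLp 2 fun j => w (.inr (.inr j))‖ -
          (‖U (WithLp.toLp 2 fun b => w (.inr (.inl b)))‖ / ρ + β⁻¹ * L) ≤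
        smoothNorm (η / 4) (WithLp.toLp 2 fun j => w (.inr (.inr j))) +
          softMin β (fun x : t => ∑ b, w (.inr (.inl b)) * x.1 b) := by
      intro w
      have h1 := norm_le_smoothNorm (η / 4) (WithLp.toLp 2 fun j => w (.inr (.inr j)))
      have h2 : -(‖U (WithLp.toLp 2 fun b => w (.inr (.inl b)))‖ / ρ) - β⁻¹ * L ≤
          softMin β (fun x : t => ∑ b, w (.inr (.inl b)) * x.1 b) := by
        refine le_softMin hβ0 fun x => ?_
        have := (htS x.2).2 (-WithLp.toLp 2 fun b => w (.inr (.inl b)))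
        rw [map_neg, norm_neg, inner_neg_right, PiLp.inner_apply] at this
        simp only [RCLike.inner_apply, conj_trivial] at this
        rw [neg_le, le_div_iff₀ hρ]
        linarith
      linarith
    have hupp : ∀ w : (Fin m × Fin n) ⊕ (Fin n ⊕ Fin m) → ℝ,
        smoothNorm (η / 4) (WithLp.toLp 2 fun j => w (.inr (.inr j))) +
          softMin β (fun x : t => ∑ b, w (.inr (.inl b)) * x.1 b) ≤
        η / 4 + ‖WithLp.toLp 2 fun j => w (.inr (.inr j))‖ + ∑ b, |w (.inr (.inl b))| := by
      intro w
      obtain ⟨x⟩ := hne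
      refine add_le_add (smoothNorm_le hε0.le _) ((softMin_le hβ0 _ x).trans
        (Finset.sum_le_sum fun b _ => (le_abs_self _).trans ?_))
      rw [abs_mul]
      refine mul_le_of_le_one_right (abs_nonneg _) ?_
      rw [← (htS x.2).1]
      exact PiLp.norm_apply_le x.1 b
    have hcont : Continuous fun w : (Fin m × Fin n) ⊕ (Fin n ⊕ Fin m) → ℝ =>
        smoothNorm (η / 4) (WithLp.toLp 2 fun j => w (.inr (.inr j))) +
          softMin β (fun x : t => ∑ b, w (.inr (.inl b)) * x.1 b) := by
      refine ((continuous_smoothNorm (η / 4)).comp ?_).add ((continuous_softMin β).comp ?_) <;>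
        fun_prop
    refine le_trans ?_ (integral_mono (i1.sub i2) (integrable_of_le_of_le
      hcont.aestronglyMeasurable (i1.sub i2) (((integrable_const _).add i1).add i3) hlow hupp) hlow)
    have e1 := integral_comp_eq_of_measurePreserving hh j1.aestronglyMeasurable
    have e2 := integral_comp_eq_of_measurePreserving hg
      (((integrable_norm_apply U).div_const ρ).add (integrable_const (β⁻¹ * L))).aestronglyMeasurable
    have e3 := integral_sub i1 i2
    refine le_trans ?_ (e3.trans (congrArg₂ (· - ·) e1 e2)).ge
    have e4 := integral_add ((integrable_norm_apply U).div_const ρ)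
      (integrable_const (μ := piGauss (Fin n)) (β⁻¹ * L))
    rw [integral_div, integral_const, probReal_univ, one_smul] at e4
    have e5 : (∫ w : Fin n → ℝ, ‖U (WithLp.toLp 2 w)‖ ∂(piGauss (Fin n))) / ρ ≤
        ellNormFin U / ρ := by
      gcongr
      exact integral_norm_apply_le U
    refine le_trans ?_ (sub_le_sub_left e4.le _)
    change η - η / 4 ≤ a - _
    linarith
  linarith

end GordonNet

section FiniteDimensional

variable {X : Type*} [NormedAddCommGroup X] [NormedSpace ℝ X]

lemma exists_dual_eq_infDist (F : Submodule ℝ X) (z : X) :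
    ∃ y : X →L[ℝ] ℝ, ‖y‖ ≤ 1 ∧ (∀ f ∈ F, y f = 0) ∧ y z = Metric.infDist z F := by
  obtain ⟨g, hg, hgz⟩ := exists_dual_vector'' ℝ (F.mkQL z)
  refine ⟨g.comp F.mkQL, ContinuousLinearMap.opNorm_le_bound _ zero_le_one fun x => ?_,
    fun f hf => ?_, ?_⟩
  · exact (g.le_of_opNorm_le hg _).trans
      (mul_le_mul_of_nonneg_left (Submodule.Quotient.norm_mk_le F x) zero_le_one)
  · rw [ContinuousLinearMap.comp_apply, F.mkQL_apply, Submodule.mkQ_apply,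
      (Submodule.Quotient.mk_eq_zero F).2 hf, map_zero]
  · exact hgz.trans (QuotientAddGroup.norm_mk z)

lemma exists_submodule_infDist_le {n : ℕ} (U : EuclideanSpace ℝ (Fin n) →L[ℝ] X) {k : ℕ}
    (hk : 1 ≤ k) {ρ : ℝ} (hρ : 0 < ρ) (h : ellNormFin U < ρ * √((k : ℝ) / 2)) :
    ∃ F : Submodule ℝ X, FiniteDimensional ℝ F ∧ Module.finrank ℝ F < k ∧
      ∀ x, ‖x‖ ≤ 1 → Metric.infDist (U x) F ≤ ρ := by
  rcases le_or_gt k 2 with hk2 | hk2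
  · refine ⟨⊥, inferInstance, by rw [finrank_bot]; omega, fun x hx => ?_⟩
    have h1 : √((k : ℝ) / 2) ≤ 1 := by
      rw [Real.sqrt_le_one, div_le_one two_pos]
      exact_mod_cast hk2
    have h2 := U.le_of_opNorm_le_of_le (opNorm_le_ellNormFin U) hx
    simp only [Submodule.bot_coe, Metric.infDist_singleton, dist_zero_right]
    nlinarith
  · obtain ⟨m, rfl⟩ : ∃ m, k = m + 1 := ⟨k - 1, by omega⟩
    obtain ⟨G, hG⟩ := exists_matrix_ne_zero (m := m) (by omega) U hρ (by exact_mod_cast h)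
    set g : Fin m → EuclideanSpace ℝ (Fin n) := fun j => WithLp.toLp 2 fun b => G (j, b) with hg
    refine ⟨Submodule.span ℝ (Set.range fun j => U (g j)),
      FiniteDimensional.span_of_finite ℝ (Set.finite_range _),
      (finrank_range_le_card (R := ℝ) fun j => U (g j)).trans_lt (by simp), fun x hx => ?_⟩
    by_contra! hlt
    obtain ⟨y, hy, hyF, hyx⟩ :=
      exists_dual_eq_infDist (Submodule.span ℝ (Set.range fun j => U (g j))) (U x)
    set w := (InnerProductSpace.toDual ℝ (EuclideanSpace ℝ (Fin n))).symm (y.comp U) with hw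
    have e : ∀ v, inner ℝ w v = y (U v) := fun v => by
      rw [hw, InnerProductSpace.toDual_symm_apply]; rfl
    have hwρ : ρ < ‖w‖ := by
      have h1 := real_inner_le_norm w x
      rw [e, hyx] at h1
      nlinarith [norm_nonneg w]
    have hw0 : 0 < ‖w‖ := hρ.trans hwρ
    obtain ⟨j, hj⟩ := hG (‖w‖⁻¹ • w) (by rw [norm_smul, norm_inv, norm_norm,
      inv_mul_cancel₀ hw0.ne']) fun v => by
        rw [real_inner_smul_left, e]
        have h1 := y.le_of_opNorm_le hy (U v)
        rw [one_mul] at h1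
        have h2 : ρ * ‖w‖⁻¹ ≤ 1 := by rw [← div_eq_mul_inv, div_le_one hw0]; exact hwρ.le
        calc ρ * (‖w‖⁻¹ * y (U v)) = ρ * ‖w‖⁻¹ * y (U v) := by ring
          _ ≤ ρ * ‖w‖⁻¹ * ‖U v‖ :=
            mul_le_mul_of_nonneg_left ((le_abs_self _).trans h1) (by positivity)
          _ ≤ ‖U v‖ := mul_le_of_le_one_left (norm_nonneg _) h2
    refine hj ?_
    have h1 : inner ℝ w (g j) = 0 := by
      rw [e]
      exact hyF _ (Submodule.subset_span ⟨j, rfl⟩)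
    rw [PiLp.inner_apply] at h1
    simp only [RCLike.inner_apply, conj_trivial, hg] at h1
    simp only [PiLp.smul_apply, smul_eq_mul, mul_left_comm _ ‖w‖⁻¹, ← Finset.mul_sum, h1, mul_zero]

end FiniteDimensional

section SmallBall

lemma gaussianReal_pos_of_isOpen {s : Set ℝ} (hs : IsOpen s) (hne : s.Nonempty) :
    0 < gaussianReal 0 1 s := by
  refine pos_iff_ne_zero.2 fun h => ?_
  exact (hs.measure_pos volume hne).ne' (gaussianReal_absolutelyContinuous' 0 one_ne_zero h)

lemma prob_lt_one_of_compl_pos {s : Set ℝ} (hs : MeasurableSet s)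
    (h : 0 < gaussianReal 0 1 sᶜ) : gaussianReal 0 1 s < 1 := by
  refine lt_of_le_of_ne prob_le_one fun h1 => ?_
  rw [prob_compl_eq_one_sub hs, h1, tsub_self] at h
  exact lt_irrefl _ h

/-- Slabs of bounded relative width have Gaussian measure bounded away from one. -/
lemma exists_gaussianReal_slab_le (t : ℝ) {ε : ℝ} (hε : 0 < ε) :
    ∃ q : ENNReal, q < 1 ∧ ∀ b c : ℝ, ε < c → gaussianReal 0 1 {s | |b + c * s| ≤ t} ≤ q := by
  rcases lt_or_ge t 0 with ht | ht
  · refine ⟨0, zero_lt_one, fun b c _ => ?_⟩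
    have : {s : ℝ | |b + c * s| ≤ t} = ∅ := by
      ext s
      simpa using ht.trans_le (abs_nonneg _)
    simp [this]
  refine ⟨max (gaussianReal 0 1 (Set.Iic (t / ε))) (gaussianReal 0 1 (Set.Ici (-(t / ε)))),
    max_lt (prob_lt_one_of_compl_pos measurableSet_Iic ?_)
      (prob_lt_one_of_compl_pos measurableSet_Ici ?_), fun b c hc => ?_⟩
  · exact gaussianReal_pos_of_isOpen (by simp [isOpen_Ioi]) (by simp)
  · exact gaussianReal_pos_of_isOpen (by simp [isOpen_Iio]) (by simp)
  have hc0 := hε.trans hc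
  have htc : t / c ≤ t / ε := div_le_div_of_nonneg_left ht hε hc.le
  rcases le_total 0 b with hb | hb
  · refine le_max_of_le_left (measure_mono fun s hs => Set.mem_Iic.2 (le_trans ?_ htc))
    rw [le_div_iff₀ hc0]
    have := (abs_le.1 (show |b + c * s| ≤ t from hs)).2
    linarith
  · refine le_max_of_le_right (measure_mono fun s hs => Set.mem_Ici.2 ?_)
    have := (abs_le.1 (show |b + c * s| ≤ t from hs)).1
    have h2 : -s ≤ t / c := by
      rw [le_div_iff₀ hc0]; linarith
    linarith

/-- Small ball estimate for lower triangular linear maps. -/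
lemma piGauss_triangular_le {n : ℕ} {c : Fin n → Fin n → ℝ} {t ε : ℝ} {q : ENNReal}
    (hq : ∀ b c : ℝ, ε < c → gaussianReal 0 1 {s | |b + c * s| ≤ t} ≤ q)
    (hc : ∀ i j, i < j → c i j = 0) (hd : ∀ i, ε < c i i) {r : ℕ} (hr : r ≤ n) :
    piGauss (Fin n) {w | ∀ i : Fin n, i.val < r → |∑ j, c i j * w j| ≤ t} ≤ q ^ r := by
  induction r with
  | zero => simp
  | succ r ih =>
    set i₀ : Fin n := ⟨r, hr⟩ with hi₀
    set B : ℕ → Set (Fin n → ℝ) := fun r =>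
      {w | ∀ i : Fin n, i.val < r → |∑ j, c i j * w j| ≤ t} with hB
    have hmB : ∀ r, MeasurableSet (B r) := fun r => by
      simp only [hB, Set.ofPred_forall]
      exact MeasurableSet.iInter fun i => MeasurableSet.iInter fun _ =>
        measurableSet_le (by fun_prop) measurable_const
    have hmp := measurePreserving_update_piGauss i₀
    have hsum : ∀ (w : Fin n → ℝ) (s : ℝ) (i : Fin n), ∑ j, c i j * Function.update w i₀ s j =
        ∑ j ∈ Finset.univ.erase i₀, c i j * w j + c i i₀ * s := fun w s i => by
      rw [← Finset.sum_erase_add _ _ (Finset.mem_univ i₀), Function.update_self]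
      congr 1
      refine Finset.sum_congr rfl fun j hj => ?_
      rw [Function.update_of_ne (Finset.ne_of_mem_erase hj)]
    have key : ∀ w, gaussianReal 0 1 (Prod.mk w ⁻¹'
        ((fun p : (Fin n → ℝ) × ℝ => Function.update p.1 i₀ p.2) ⁻¹' B (r + 1))) ≤
        (B r).indicator (fun _ => q) w := by
      intro w
      by_cases hw : w ∈ B r
      · rw [Set.indicator_of_mem hw]
        refine (measure_mono fun s hs => ?_).trans
          (hq (∑ j ∈ Finset.univ.erase i₀, c i₀ j * w j) (c i₀ i₀) (hd i₀))
        have h1 := hs i₀ (Nat.lt_succ_self r)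
        simp only [hsum] at h1
        exact h1
      · rw [Set.indicator_of_notMem hw, nonpos_iff_eq_zero]
        convert measure_empty (μ := gaussianReal 0 1)
        refine Set.eq_empty_of_forall_notMem fun s hs => hw fun i hi => ?_
        have h1 := hs i (Nat.lt_succ_of_lt hi)
        have h0 : c i i₀ = 0 := hc i i₀ hi
        simp only [hsum, h0] at h1
        rw [← Finset.sum_erase_add _ _ (Finset.mem_univ i₀), h0]
        simpa using h1
    calc piGauss (Fin n) (B (r + 1))
        = ((piGauss (Fin n)).prod (gaussianReal 0 1))
          ((fun p : (Fin n → ℝ) × ℝ => Function.update p.1 i₀ p.2) ⁻¹' B (r + 1)) :=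
          (hmp.measure_preimage (hmB _).nullMeasurableSet).symm
      _ ≤ ∫⁻ w, (B r).indicator (fun _ => q) w ∂(piGauss (Fin n)) := by
          rw [Measure.prod_apply (hmp.measurable (hmB _))]
          exact lintegral_mono key
      _ = q * piGauss (Fin n) (B r) := lintegral_indicator_const (hmB r) q
      _ ≤ q * q ^ r := by gcongr; exact ih (by omega)
      _ = q ^ (r + 1) := (pow_succ' q r).symm

end SmallBall

section Tail

variable {H : Type*} [NormedAddCommGroup H] [InnerProductSpace ℝ H]

/-- The contraction `v ↦ ∑ v i • e i` associated with an orthonormal family `e`. -/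
noncomputable def orthonormalSum {n : ℕ} (e : Fin n → H) : EuclideanSpace ℝ (Fin n) →L[ℝ] H :=
  ∑ i, (EuclideanSpace.proj i : EuclideanSpace ℝ (Fin n) →L[ℝ] ℝ).smulRight (e i)

lemma orthonormalSum_apply {n : ℕ} (e : Fin n → H) (v : EuclideanSpace ℝ (Fin n)) :
    orthonormalSum e v = ∑ i, v i • e i := by
  simp [orthonormalSum]

lemma norm_orthonormalSum_apply {n : ℕ} {e : Fin n → H} (he : Orthonormal ℝ e)
    (v : EuclideanSpace ℝ (Fin n)) : ‖orthonormalSum e v‖ = ‖v‖ := by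
  refine (sq_eq_sq₀ (norm_nonneg _) (norm_nonneg _)).1 ?_
  rw [orthonormalSum_apply, ← real_inner_self_eq_norm_sq, he.inner_sum,
    EuclideanSpace.real_norm_sq_eq]
  simp [sq]

lemma norm_orthonormalSum_le {n : ℕ} {e : Fin n → H} (he : Orthonormal ℝ e) :
    ‖orthonormalSum e‖ ≤ 1 :=
  ContinuousLinearMap.opNorm_le_bound _ zero_le_one fun v => by
    rw [norm_orthonormalSum_apply he, one_mul]

variable [CompleteSpace H] {X : Type*} [NormedAddCommGroup X] [NormedSpace ℝ X]

/-- An operator that is not small off any finite-dimensional subspace admits triangular biorthogonal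
sequences. -/
lemma exists_orthonormal_triangular (S : H →L[ℝ] X) {ε : ℝ}
    (h : ∀ E : Submodule ℝ H, FiniteDimensional ℝ E → ∃ e ∈ Eᗮ, ‖e‖ = 1 ∧ ε < ‖S e‖) :
    ∃ (e : ℕ → H) (y : ℕ → X →L[ℝ] ℝ), Orthonormal ℝ e ∧ (∀ i, ‖y i‖ ≤ 1) ∧
      (∀ i j, i < j → y i (S (e j)) = 0) ∧ ∀ i, ε < y i (S (e i)) := by
  choose! e heE he1 heS using h
  choose y hy hye using fun z : X => exists_dual_vector'' ℝ z
  set g : Submodule ℝ H → H := fun E =>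
    (InnerProductSpace.toDual ℝ H).symm ((y (S (e E))).comp S) with hg
  have hge : ∀ E x, inner ℝ (g E) x = y (S (e E)) (S x) := fun E x => by
    rw [hg, InnerProductSpace.toDual_symm_apply]; rfl
  set E : ℕ → Submodule ℝ H := fun i =>
    Nat.rec ⊥ (fun _ E => E ⊔ Submodule.span ℝ {e E, g E}) i with hE
  have hsucc : ∀ i, E (i + 1) = E i ⊔ Submodule.span ℝ {e (E i), g (E i)} := fun i => rfl
  have hfin : ∀ i, FiniteDimensional ℝ (E i) := by
    intro i
    induction i with
    | zero => exact inferInstanceAs (FiniteDimensional ℝ (⊥ : Submodule ℝ H))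
    | succ i ih =>
      rw [hsucc]
      have := FiniteDimensional.span_of_finite ℝ (Set.toFinite {e (E i), g (E i)})
      exact Submodule.finiteDimensional_sup _ _
  have hmono : Monotone E := monotone_nat_of_le_succ fun i => by rw [hsucc]; exact le_sup_left
  have hmem : ∀ i j, i < j → e (E i) ∈ E j ∧ g (E i) ∈ E j := fun i j hij => by
    have h1 : Submodule.span ℝ {e (E i), g (E i)} ≤ E j :=
      le_trans (by rw [hsucc]; exact le_sup_right) (hmono (Nat.succ_le_of_lt hij))
    exact ⟨h1 (Submodule.subset_span (by simp)), h1 (Submodule.subset_span (by simp))⟩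
  have horth : ∀ i j, i < j → inner ℝ (e (E i)) (e (E j)) = 0 := fun i j hij =>
    Submodule.inner_right_of_mem_orthogonal (hmem i j hij).1 (heE _ (hfin j))
  refine ⟨fun i => e (E i), fun i => y (S (e (E i))), ⟨fun i => he1 _ (hfin i), fun i j hij => ?_⟩,
    fun i => hy _, fun i j hij => ?_, fun i => ?_⟩
  · rcases lt_or_gt_of_ne hij with h | h
    · exact horth i j h
    · rw [real_inner_comm]
      exact horth j i h
  · rw [← hge]
    exact Submodule.inner_right_of_mem_orthogonal (hmem i j hij).2 (heE _ (hfin j))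
  · rw [hye]
    exact heS _ (hfin i)

lemma exists_finiteDimensional_norm_apply_le (S : H →L[ℝ] X) {M : ℝ}
    (hS : ∀ (n : ℕ) (A : EuclideanSpace ℝ (Fin n) →L[ℝ] H), ‖A‖ ≤ 1 → ellNormFin (S.comp A) ≤ M)
    {ε : ℝ} (hε : 0 < ε) :
    ∃ E : Submodule ℝ H, FiniteDimensional ℝ E ∧ ∀ x ∈ Eᗮ, ‖S x‖ ≤ ε * ‖x‖ := by
  by_contra! hcon
  obtain ⟨e, y, he, hy, hye, hyd⟩ := exists_orthonormal_triangular S (ε := ε) fun E hE => by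
    obtain ⟨x, hx, hSx⟩ := hcon E hE
    have hx0 : 0 < ‖x‖ := norm_pos_iff.2 fun h => by simp [h] at hSx
    refine ⟨‖x‖⁻¹ • x, Submodule.smul_mem _ _ hx, ?_, ?_⟩
    · rw [norm_smul, norm_inv, norm_norm, inv_mul_cancel₀ hx0.ne']
    · rw [map_smul, norm_smul, norm_inv, norm_norm, inv_mul_eq_div, lt_div_iff₀ hx0]
      exact hSx
  set t : ℝ := 2 * (|M| + 1) with ht
  have hM := abs_nonneg M
  obtain ⟨q, hq1, hq⟩ := exists_gaussianReal_slab_le t hε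
  obtain ⟨n, hn⟩ : ∃ n, q ^ n < 2⁻¹ := by
    have := ENNReal.tendsto_pow_atTop_nhds_zero_of_lt_one hq1
    exact (this.eventually (gt_mem_nhds (by simp))).exists
  set A := orthonormalSum fun i : Fin n => e i with hA
  have heA : Orthonormal ℝ fun i : Fin n => e i := he.comp _ Fin.val_injective
  have h1 := hS n A (norm_orthonormalSum_le heA)
  set U := S.comp A with hU
  have hUw : ∀ (i : Fin n) (w : Fin n → ℝ),
      ∑ j : Fin n, y i (S (e j)) * w j = y i (U (WithLp.toLp 2 w)) := fun i w => by
    simp [hU, hA, orthonormalSum_apply, mul_comm]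
  have hsub : {w : Fin n → ℝ | ‖U (WithLp.toLp 2 w)‖ < t} ⊆
      {w | ∀ i : Fin n, i.val < n → |∑ j : Fin n, y i (S (e j)) * w j| ≤ t} := fun w hw i _ => by
    rw [hUw]
    have h2 := (y i).le_of_opNorm_le (hy i) (U (WithLp.toLp 2 w))
    rw [one_mul, Real.norm_eq_abs] at h2
    exact h2.trans (le_of_lt hw)
  have hsmall : piGauss (Fin n) {w : Fin n → ℝ | ‖U (WithLp.toLp 2 w)‖ < t} < 2⁻¹ :=
    ((measure_mono hsub).trans (piGauss_triangular_le (c := fun i j => y i (S (e j))) hq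
      (fun i j hij => hye i j hij) (fun i => hyd i) le_rfl)).trans_lt hn
  have hms : MeasurableSet {w : Fin n → ℝ | ‖U (WithLp.toLp 2 w)‖ < t} :=
    measurableSet_lt (Continuous.measurable (by fun_prop)) measurable_const
  have hlarge : (2 : ℝ)⁻¹ ≤
      (piGauss (Fin n)).real {w : Fin n → ℝ | t ^ 2 ≤ ‖U (WithLp.toLp 2 w)‖ ^ 2} := by
    have e1 : {w : Fin n → ℝ | t ^ 2 ≤ ‖U (WithLp.toLp 2 w)‖ ^ 2} =
        {w : Fin n → ℝ | ‖U (WithLp.toLp 2 w)‖ < t}ᶜ := by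
      ext w
      simp only [Set.mem_ofPred_eq, Set.mem_compl_iff, not_lt]
      exact pow_le_pow_iff_left₀ (by positivity) (norm_nonneg _) two_ne_zero
    rw [e1, probReal_compl_eq_one_sub hms]
    have h3 := (ENNReal.toReal_lt_toReal (measure_ne_top _ _) (by simp)).2 hsmall
    rw [ENNReal.toReal_inv, ENNReal.toReal_ofNat] at h3
    rw [Measure.real]
    linarith
  have hmarkov := mul_meas_ge_le_integral_of_nonneg (μ := piGauss (Fin n))
    (f := fun w : Fin n → ℝ => ‖U (WithLp.toLp 2 w)‖ ^ 2) (ae_of_all _ fun _ => by positivity)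
    (integrable_sq_norm_apply U) (t ^ 2)
  rw [← sq_ellNormFin] at hmarkov
  have h4 : ellNormFin U ^ 2 ≤ |M| ^ 2 :=
    pow_le_pow_left₀ (ellNormFin_nonneg U) (h1.trans (le_abs_self M)) 2
  have h5 := mul_le_mul_of_nonneg_left hlarge (sq_nonneg t)
  nlinarith

end Tail

section FiniteRank

variable {H : Type*} [NormedAddCommGroup H] [InnerProductSpace ℝ H] [CompleteSpace H]
  {X : Type*} [NormedAddCommGroup X] [NormedSpace ℝ X]

lemma exists_orthonormal_apply_sum_of_finiteDimensional_range (A : H →L[ℝ] X)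
    [FiniteDimensional ℝ (LinearMap.range (A : H →ₗ[ℝ] X))] :
    ∃ (r : ℕ) (e : Fin r → H), Orthonormal ℝ e ∧ ∀ x, A x = ∑ i, inner ℝ (e i) x • A (e i) := by
  set K : Submodule ℝ H := LinearMap.ker (A : H →ₗ[ℝ] X) with hK
  have hKc : IsClosed (K : Set H) := A.isClosed_ker
  have : CompleteSpace K := hKc.completeSpace_coe
  have hinj : Function.Injective ((A : H →ₗ[ℝ] X).rangeRestrict.comp Kᗮ.subtype) := by
    rw [← LinearMap.ker_eq_bot, LinearMap.ker_eq_bot']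
    rintro ⟨x, hx⟩ h
    have h1 : x ∈ K := by
      rw [hK, LinearMap.mem_ker]
      exact congrArg Subtype.val h
    have : x ∈ K ⊓ Kᗮ := ⟨h1, hx⟩
    rw [K.inf_orthogonal_eq_bot, Submodule.mem_bot] at this
    exact Subtype.ext this
  have : FiniteDimensional ℝ Kᗮ := FiniteDimensional.of_injective _ hinj
  set b := stdOrthonormalBasis ℝ Kᗮ with hb
  refine ⟨_, fun i => (b i : H), b.orthonormal.comp_linearIsometry Kᗮ.subtypeₗᵢ, fun x => ?_⟩
  have h1 : A x = A (Kᗮ.starProjection x) := by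
    have h2 : x - Kᗮ.starProjection x ∈ K := by
      have := Kᗮ.sub_starProjection_mem_orthogonal x
      rwa [K.orthogonal_orthogonal] at this
    have h3 : A (x - Kᗮ.starProjection x) = 0 := h2
    rwa [map_sub, sub_eq_zero] at h3
  rw [h1, Submodule.starProjection_apply, ← b.sum_repr' (Kᗮ.orthogonalProjectionOnto x)]
  simp [map_sum]

/-- Finite rank operators have finite `l`-norm. -/
lemma exists_sq_ellNormFin_comp_le (A : H →L[ℝ] X)
    [FiniteDimensional ℝ (LinearMap.range (A : H →ₗ[ℝ] X))] :
    ∃ M : ℝ, ∀ (n : ℕ) (B : EuclideanSpace ℝ (Fin n) →L[ℝ] H), ‖B‖ ≤ 1 →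
      ellNormFin (A.comp B) ^ 2 ≤ M := by
  obtain ⟨r, e, he, hA⟩ := exists_orthonormal_apply_sum_of_finiteDimensional_range A
  refine ⟨‖A‖ ^ 2 * r, fun n B hB => ?_⟩
  set v : Fin r → EuclideanSpace ℝ (Fin n) := fun i =>
    (InnerProductSpace.toDual ℝ _).symm ((innerSL ℝ (e i)).comp B) with hv
  have hvB : ∀ i x, inner ℝ (v i) x = inner ℝ (e i) (B x) := fun i x => by
    rw [hv, InnerProductSpace.toDual_symm_apply]; rfl
  have hvn : ∀ i, ‖v i‖ ≤ 1 := fun i => by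
    rw [hv, LinearIsometryEquiv.norm_map]
    refine (ContinuousLinearMap.opNorm_comp_le _ _).trans ?_
    rw [innerSL_apply_norm, he.1 i, one_mul]
    exact hB
  have hint : ∀ i, Integrable (fun w : Fin n → ℝ => inner ℝ (v i) (WithLp.toLp 2 w) ^ 2)
      (piGauss (Fin n)) := fun i => by
    simpa using integrable_sq_norm_apply (innerSL ℝ (v i))
  have hpt : ∀ w : Fin n → ℝ, ‖A.comp B (WithLp.toLp 2 w)‖ ^ 2 ≤
      ‖A‖ ^ 2 * ∑ i, inner ℝ (v i) (WithLp.toLp 2 w) ^ 2 := fun w => by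
    have h1 : A.comp B (WithLp.toLp 2 w) =
        A (orthonormalSum e (WithLp.toLp 2 fun i => inner ℝ (v i) (WithLp.toLp 2 w))) := by
      rw [ContinuousLinearMap.comp_apply, hA, orthonormalSum_apply, map_sum]
      simp [hvB]
    have h2 := A.le_opNorm
      (orthonormalSum e (WithLp.toLp 2 fun i => inner ℝ (v i) (WithLp.toLp 2 w)))
    rw [← h1, norm_orthonormalSum_apply he] at h2
    refine (pow_le_pow_left₀ (norm_nonneg _) h2 2).trans_eq ?_
    rw [mul_pow, EuclideanSpace.real_norm_sq_eq]
  rw [sq_ellNormFin]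
  refine (integral_mono (integrable_sq_norm_apply _)
    ((integrable_finsetSum _ fun i _ => hint i).const_mul _) hpt).trans ?_
  rw [integral_const_mul, integral_finsetSum _ fun i _ => hint i]
  refine mul_le_mul_of_nonneg_left ?_ (sq_nonneg _)
  simp only [integral_inner_sq_piGauss]
  refine (Finset.sum_le_card_nsmul _ _ 1 fun i _ => pow_le_one₀ (norm_nonneg _) (hvn i)).trans_eq ?_
  simp

lemma sq_ellNormFin_sub_le {n : ℕ} (S T : EuclideanSpace ℝ (Fin n) →L[ℝ] X) :
    ellNormFin (S - T) ^ 2 ≤ 2 * ellNormFin S ^ 2 + 2 * ellNormFin T ^ 2 := by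
  have h1 := (integrable_sq_norm_apply S).const_mul 2
  have h2 := (integrable_sq_norm_apply T).const_mul 2
  simp only [sq_ellNormFin]
  rw [← integral_const_mul, ← integral_const_mul, ← integral_add h1 h2]
  refine integral_mono (integrable_sq_norm_apply _) (h1.add h2) fun w => ?_
  have h3 := norm_sub_le (S (WithLp.toLp 2 w)) (T (WithLp.toLp 2 w))
  have h4 := pow_le_pow_left₀ (norm_nonneg _) h3 2
  have h5 := sq_nonneg (‖S (WithLp.toLp 2 w)‖ - ‖T (WithLp.toLp 2 w)‖)
  simp only [sub_apply]
  linarith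

lemma ellNormFin_comp_le_ellNorm_sub (T A : H →L[ℝ] X)
    (hT : BddAbove {c : ℝ | ∃ (n : ℕ) (B : EuclideanSpace ℝ (Fin n) →L[ℝ] H),
      ‖B‖ ≤ 1 ∧ c = ellNormFin (T.comp B)})
    [FiniteDimensional ℝ (LinearMap.range (A : H →ₗ[ℝ] X))] {n : ℕ}
    (B : EuclideanSpace ℝ (Fin n) →L[ℝ] H) (hB : ‖B‖ ≤ 1) :
    ellNormFin ((T - A).comp B) ≤ ellNorm (T - A) := by
  refine le_csSup ?_ ⟨n, B, hB, rfl⟩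
  obtain ⟨M, hM⟩ := hT
  obtain ⟨M', hM'⟩ := exists_sq_ellNormFin_comp_le A
  refine ⟨√(2 * M ^ 2 + 2 * M'), ?_⟩
  rintro _ ⟨m, C, hC, rfl⟩
  refine Real.le_sqrt_of_sq_le ?_
  rw [ContinuousLinearMap.sub_comp]
  refine (sq_ellNormFin_sub_le _ _).trans ?_
  have h1 := pow_le_pow_left₀ (ellNormFin_nonneg _) (hM ⟨m, C, hC, rfl⟩) 2
  have h2 := hM' m C hC
  linarith

end FiniteRank

lemma infDist_sup_range_le {H X : Type*} [SeminormedAddCommGroup H] [NormedSpace ℝ H]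
    [NormedAddCommGroup X] [NormedSpace ℝ X] (T A : H →L[ℝ] X) (F : Submodule ℝ X) (x : H) :
    Metric.infDist (T x) ((F ⊔ LinearMap.range (A : H →ₗ[ℝ] X) : Submodule ℝ X) : Set X) ≤
      Metric.infDist ((T - A) x) F := by
  refine (Metric.le_infDist ⟨0, F.zero_mem⟩).2 fun f hf => ?_
  refine (Metric.infDist_le_dist_of_mem (y := f + A x) (Submodule.add_mem_sup hf
    (LinearMap.mem_range_self (A : H →ₗ[ℝ] X) x))).trans_eq ?_
  rw [dist_eq_norm, dist_eq_norm, sub_apply]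
  congr 1
  abel

lemma kolmogorovNum_le_of_forall {H X : Type*} [SeminormedAddCommGroup H] [NormedSpace ℝ H]
    [NormedAddCommGroup X] [NormedSpace ℝ X] {T : H →L[ℝ] X} {n : ℕ}
    {F : Submodule ℝ X}
    (hF : Module.rank ℝ F < n) {c : ℝ} (hc : ∀ x, ‖x‖ ≤ 1 → Metric.infDist (T x) F ≤ c) :
    kolmogorovNum T n ≤ c := by
  refine csInf_le ⟨0, ?_⟩ ⟨F, hF, fun x hx => hc x (by simpa using hx)⟩
  rintro d ⟨G, -, hG⟩
  exact Metric.infDist_nonneg.trans (hG 0 (by simp))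

section Kolmogorov

variable {H : Type*} [NormedAddCommGroup H] [InnerProductSpace ℝ H] [CompleteSpace H]
  {X : Type*} [NormedAddCommGroup X] [NormedSpace ℝ X]

lemma exists_finrank_lt_infDist_le (S : H →L[ℝ] X) {c : ℝ}
    (hS : ∀ (n : ℕ) (B : EuclideanSpace ℝ (Fin n) →L[ℝ] H), ‖B‖ ≤ 1 → ellNormFin (S.comp B) ≤ c)
    {k : ℕ} (hk : 1 ≤ k) {ρ δ : ℝ} (hρ : 0 < ρ) (hδ : 0 < δ) (h : c < ρ * √((k : ℝ) / 2)) :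
    ∃ F : Submodule ℝ X, FiniteDimensional ℝ F ∧ Module.finrank ℝ F < k ∧
      ∀ x, ‖x‖ ≤ 1 → Metric.infDist (S x) F ≤ ρ + δ := by
  obtain ⟨E, hE, hES⟩ := exists_finiteDimensional_norm_apply_le S hS hδ
  set b := stdOrthonormalBasis ℝ E with hb
  have he : Orthonormal ℝ fun i => (b i : H) := b.orthonormal.comp_linearIsometry E.subtypeₗᵢ
  set B := orthonormalSum fun i => (b i : H) with hB
  obtain ⟨F, hF, hFk, hFS⟩ := exists_submodule_infDist_le (S.comp B) hk hρ
    ((hS _ B (norm_orthonormalSum_le he)).trans_lt h)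
  refine ⟨F, hF, hFk, fun x hx => ?_⟩
  set v := b.repr (E.orthogonalProjectionOnto x) with hv
  have hBv : B v = E.starProjection x := by
    rw [Submodule.starProjection_apply, ← b.sum_repr (E.orthogonalProjectionOnto x), hB,
      orthonormalSum_apply]
    simp [hv]
  have hv1 : ‖v‖ ≤ 1 := by
    rw [hv, LinearIsometryEquiv.norm_map]
    exact (E.norm_orthogonalProjectionOnto_apply_le x).trans hx
  have h1 := hES _ (E.sub_starProjection_mem_orthogonal x)
  have h2 : ‖x - E.starProjection x‖ ≤ 1 := by
    rw [← E.starProjection_orthogonal_val]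
    exact (Eᗮ.norm_orthogonalProjectionOnto_apply_le x).trans hx
  have h3 := Metric.infDist_le_infDist_add_dist (s := (F : Set X)) (x := S x)
    (y := S (E.starProjection x))
  rw [dist_eq_norm, ← map_sub] at h3
  have h4 := hFS v hv1
  rw [ContinuousLinearMap.comp_apply, hBv] at h4
  nlinarith

lemma kolmogorovNum_le_of_ellNorm_lt {T A : H →L[ℝ] X}
    (hT : BddAbove {c : ℝ | ∃ (n : ℕ) (B : EuclideanSpace ℝ (Fin n) →L[ℝ] H),
      ‖B‖ ≤ 1 ∧ c = ellNormFin (T.comp B)}) {k n : ℕ} (hk : 1 ≤ k)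
    (hA : Module.rank ℝ (LinearMap.range (A : H →ₗ[ℝ] X)) < (n : Cardinal)) {ρ : ℝ} (hρ : 0 < ρ)
    (h : ellNorm (T - A) < ρ * √((k : ℝ) / 2)) : kolmogorovNum T (k + n - 1) ≤ ρ := by
  have hfin : FiniteDimensional ℝ (LinearMap.range (A : H →ₗ[ℝ] X)) :=
    Module.rank_lt_aleph0_iff.1 (hA.trans Cardinal.natCast_lt_aleph0)
  rw [← Module.finrank_eq_rank, Nat.cast_lt] at hA
  refine le_of_forall_pos_le_add fun δ hδ => ?_
  obtain ⟨F, hF, hFk, hFS⟩ := exists_finrank_lt_infDist_le (T - A)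
    (fun m B hB => ellNormFin_comp_le_ellNorm_sub T A hT B hB) hk hρ hδ h
  refine kolmogorovNum_le_of_forall (F := F ⊔ LinearMap.range (A : H →ₗ[ℝ] X)) ?_ fun x hx =>
    (infDist_sup_range_le T A F x).trans (hFS x hx)
  rw [← Module.finrank_eq_rank, Nat.cast_lt]
  have := Submodule.finrank_add_le_finrank_add_finrank F (LinearMap.range (A : H →ₗ[ℝ] X))
  omega

end Kolmogorov

/-- `H` Hilbert, `X` Banach, `T : H → X` bounded with `l(T) < ∞`. Then
`k^{1/2} d_{k+n−1}(T) ≤ √2 aₙ(T; l)` for all `k, n ∈ ℕ`. -/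
theorem stmt16 {H : Type*} [NormedAddCommGroup H] [InnerProductSpace ℝ H] [CompleteSpace H]
    {X : Type*} [NormedAddCommGroup X] [NormedSpace ℝ X] [CompleteSpace X]
    (T : H →L[ℝ] X)
    (hT : BddAbove {c : ℝ | ∃ (n : ℕ) (A : EuclideanSpace ℝ (Fin n) →L[ℝ] H),
      ‖A‖ ≤ 1 ∧ c = ellNormFin (T.comp A)})
    (k n : ℕ) (hk : 1 ≤ k) (hn : 1 ≤ n) :
    (k : ℝ) ^ ((1 : ℝ) / 2) * kolmogorovNum T (k + n - 1) ≤
      Real.sqrt 2 * approxNumEll T n := by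
  rw [← Real.sqrt_eq_rpow]
  have hk0 : 0 < √(k : ℝ) := Real.sqrt_pos.2 (by exact_mod_cast hk)
  have h2 : 0 < √(2 : ℝ) := Real.sqrt_pos.2 two_pos
  rw [mul_comm √2, ← div_le_iff₀ h2]
  refine le_csInf ⟨_, 0, ?_, rfl⟩ ?_
  · rw [ContinuousLinearMap.toLinearMap_zero, LinearMap.range_zero, rank_bot]
    exact_mod_cast hn
  rintro _ ⟨A, hA, rfl⟩
  rw [div_le_iff₀ h2]
  have hnn : 0 ≤ ellNorm (T - A) := Real.sSup_nonneg fun c hc => by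
    obtain ⟨m, B, -, rfl⟩ := hc
    exact ellNormFin_nonneg _
  refine le_of_forall_pos_le_add fun η hη => ?_
  have hρ : 0 < (ellNorm (T - A) * √2 + η) / √(k : ℝ) := by positivity
  have := kolmogorovNum_le_of_ellNorm_lt hT hk hA hρ (by
    rw [Real.sqrt_div' _ two_pos.le, div_mul_div_cancel₀ hk0.ne', lt_div_iff₀ h2]
    linarith)
  rwa [le_div_iff₀ hk0, mul_comm] at this
end

section
/- Let k : (0,1] → ℝ be non-negative, continuous and strictly decreasing with lim_{x→0} k(x) = ∞ and k ∈ L_2[0,1], and let T_K : L_2[0,1] → L_q[0,1], 1 ≤ q < ∞, be the weakly singular integral operator (T_K f)(t) = ∫_0^1 k(|t−x|) f(x) dx. Then there is an absolute constant c ≥ 1 such that for all n ∈ ℕ: n^{1/2} d_n(T_K : L_2[0,1] → L_q[0,1]) ≤ c · √q · (∫_0^{1/n} (k(u))^2 du)^{1/2}. -/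
open MeasureTheory

section Signs

/-- Averaging over a function space splits off the first coordinate. -/
theorem expect_fin_cons {α : Type*} [Fintype α] {n : ℕ} (f : (Fin (n + 1) → α) → ℝ) :
    Finset.expect Finset.univ f =
      Finset.expect Finset.univ fun a : α =>
        Finset.expect Finset.univ fun r : Fin n → α => f (Fin.cons a r) := by
  rw [← Fintype.expect_equiv (Fin.consEquiv fun _ : Fin (n + 1) => α)
    (fun p => f (Fin.cons p.1 p.2)) f (fun _ => rfl), ← Finset.univ_product_univ,
    Finset.expect_product]

theorem expect_units_int (f : ℤˣ → ℝ) :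
    Finset.expect Finset.univ f = (f 1 + f (-1)) / 2 := by
  rw [Fintype.expect_eq_sum_div_card, UnitsInt.univ]
  rw [Finset.sum_pair (by decide)]
  simp

theorem expect_sign_sum_cons {N : ℕ} (a : Fin (N + 1) → ℝ) (f : ℝ → ℝ) :
    (Finset.expect Finset.univ fun r : Fin (N + 1) → ℤˣ => f (∑ j, ((r j : ℤ) : ℝ) * a j)) =
      Finset.expect Finset.univ fun r : Fin N → ℤˣ =>
        (f (a 0 + ∑ j, ((r j : ℤ) : ℝ) * a j.succ) +
          f (-a 0 + ∑ j, ((r j : ℤ) : ℝ) * a j.succ)) / 2 := by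
  rw [expect_fin_cons, expect_units_int, ← Finset.expect_add_distrib, Finset.expect_div]
  simp [Fin.sum_univ_succ]

theorem expect_sign_sum_sq {N : ℕ} (a : Fin N → ℝ) :
    (Finset.expect Finset.univ fun r : Fin N → ℤˣ => (∑ j, ((r j : ℤ) : ℝ) * a j) ^ 2) =
      ∑ j, a j ^ 2 := by
  induction N with
  | zero => simp
  | succ N ih =>
    rw [expect_sign_sum_cons a (fun x => x ^ 2), Fin.sum_univ_succ, ← ih (fun j => a j.succ),
      ← Fintype.expect_const (ι := Fin N → ℤˣ) (a 0 ^ 2), ← Finset.expect_add_distrib]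
    refine Finset.expect_congr rfl fun r _ => ?_
    ring

theorem expect_sign_sum_pow_four_le {N : ℕ} (a : Fin N → ℝ) :
    (Finset.expect Finset.univ fun r : Fin N → ℤˣ => (∑ j, ((r j : ℤ) : ℝ) * a j) ^ 4) ≤
      3 * (∑ j, a j ^ 2) ^ 2 := by
  induction N with
  | zero => simp
  | succ N ih =>
    rw [expect_sign_sum_cons a (fun x => x ^ 4), Fin.sum_univ_succ]
    have h2 := expect_sign_sum_sq (fun j => a j.succ)
    have h4 := ih (fun j => a j.succ)
    have : (Finset.expect Finset.univ fun r : Fin N → ℤˣ =>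
        ((a 0 + ∑ j, ((r j : ℤ) : ℝ) * a j.succ) ^ 4 +
          (-a 0 + ∑ j, ((r j : ℤ) : ℝ) * a j.succ) ^ 4) / 2) =
        (Finset.expect Finset.univ fun r : Fin N → ℤˣ => (∑ j, ((r j : ℤ) : ℝ) * a j.succ) ^ 4) +
        6 * a 0 ^ 2 *
        (Finset.expect Finset.univ fun r : Fin N → ℤˣ => (∑ j, ((r j : ℤ) : ℝ) * a j.succ) ^ 2) +
        a 0 ^ 4 := by
      rw [Finset.mul_expect, ← Finset.expect_add_distrib,
        ← Fintype.expect_const (ι := Fin N → ℤˣ) (a 0 ^ 4), ← Finset.expect_add_distrib]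
      refine Finset.expect_congr rfl fun r _ => ?_
      ring
    rw [this, h2]
    nlinarith [sq_nonneg (a 0 ^ 2)]

/-- The lower Khinchine inequality in `L₁`. -/
theorem half_sqrt_le_expect_abs_sign_sum {N : ℕ} (a : Fin N → ℝ) :
    Real.sqrt (∑ j, a j ^ 2) / 2 ≤
      Finset.expect Finset.univ fun r : Fin N → ℤˣ => |∑ j, ((r j : ℤ) : ℝ) * a j| := by
  set s := Real.sqrt (∑ j, a j ^ 2) with hs
  have hs2 : s ^ 2 = ∑ j, a j ^ 2 := Real.sq_sqrt (Finset.sum_nonneg fun _ _ => sq_nonneg _)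
  have hs0 : 0 ≤ s := Real.sqrt_nonneg _
  rcases hs0.eq_or_lt with h0 | h0
  · rw [← h0, zero_div]
    exact Finset.expect_nonneg fun _ _ => abs_nonneg _
  have h2 := expect_sign_sum_sq a
  have h4 := expect_sign_sum_pow_four_le a
  rw [← hs2] at h2 h4
  have hpt : ∀ x : ℝ, 12 * s ^ 2 * x ^ 2 - x ^ 4 ≤ 16 * s ^ 3 * |x| := by
    intro x
    rw [← sq_abs x, show x ^ 4 = |x| ^ 4 by rw [← abs_pow, abs_of_nonneg (by positivity)]]
    have hx := abs_nonneg x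
    have : 0 ≤ |x| * ((|x| - 2 * s) ^ 2 * (|x| + 4 * s)) := by positivity
    nlinarith
  have key := Finset.expect_le_expect (s := Finset.univ)
    (fun (r : Fin N → ℤˣ) _ => hpt (∑ j, ((r j : ℤ) : ℝ) * a j))
  rw [Finset.expect_sub_distrib, ← Finset.mul_expect, ← Finset.mul_expect, h2] at key
  have h3 : 0 < s ^ 3 := by positivity
  have : s ^ 3 * (9 * s) ≤ s ^ 3 * (16 *
      Finset.expect Finset.univ fun r : Fin N → ℤˣ => |∑ j, ((r j : ℤ) : ℝ) * a j|) := by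
    nlinarith
  have := le_of_mul_le_mul_left this h3
  linarith

theorem expect_exp_sign_sum_le {ι : Type*} [Fintype ι] [DecidableEq ι] (a : ι → ℝ) :
    (Finset.expect Finset.univ fun r : ι → ℤˣ => Real.exp (∑ j, ((r j : ℤ) : ℝ) * a j)) ≤
      Real.exp ((∑ j, a j ^ 2) / 2) := by
  have h : (∑ r : ι → ℤˣ, Real.exp (∑ j, ((r j : ℤ) : ℝ) * a j)) =
      ∏ j, (2 * Real.cosh (a j)) := by
    simp_rw [Real.exp_sum]
    rw [← Fintype.piFinset_univ, ← Finset.prod_univ_sum (fun _ : ι => Finset.univ)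
      (fun j (u : ℤˣ) => Real.exp (((u : ℤ) : ℝ) * a j))]
    refine Finset.prod_congr rfl fun j _ => ?_
    rw [UnitsInt.univ, Finset.sum_pair (by decide), Real.cosh_eq]
    simp
    ring
  rw [Fintype.expect_eq_sum_div_card, h, Finset.prod_mul_distrib, Finset.sum_div, Real.exp_sum]
  simp only [Finset.prod_const, Finset.card_univ, Fintype.card_pi, Fintype.card_units_int,
    Nat.cast_pow, Nat.cast_ofNat]
  rw [mul_div_cancel_left₀ _ (by positivity)]
  exact Finset.prod_le_prod (fun j _ => (Real.cosh_pos _).le)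
    fun j _ => Real.cosh_le_exp_half_sq _

/-- The upper Khinchine inequality with constant of order `√q`. -/
theorem expect_abs_sign_sum_rpow_le {ι : Type*} [Fintype ι] [DecidableEq ι] (a : ι → ℝ)
    {q s : ℝ} (hq : 1 ≤ q) (hs : 0 ≤ s) (ha : ∑ j, a j ^ 2 ≤ s ^ 2) :
    (Finset.expect Finset.univ fun r : ι → ℤˣ => |∑ j, ((r j : ℤ) : ℝ) * a j| ^ q) ≤
      (4 * Real.sqrt q * s) ^ q := by
  have hq0 : 0 < q := by linarith
  rcases hs.eq_or_lt with rfl | hs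
  · have h0 : ∀ j, a j = 0 := by
      intro j
      have h1 : a j ^ 2 ≤ ∑ j, a j ^ 2 :=
        Finset.single_le_sum (f := fun j => a j ^ 2) (fun _ _ => sq_nonneg _) (Finset.mem_univ j)
      have : a j ^ 2 ≤ 0 := by linarith
      nlinarith
    simp [h0, Real.zero_rpow hq0.ne']
  set l := Real.sqrt q / s with hl
  have hsq : 0 < Real.sqrt q := Real.sqrt_pos.2 hq0
  have hl0 : 0 < l := by positivity
  have hpt : ∀ x : ℝ, |x| ^ q ≤ (q / l) ^ q * (Real.exp (l * x) + Real.exp (l * (-x))) := by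
    intro x
    have h1 : l * |x| / q ≤ Real.exp (l * |x| / q) := by
      linarith [Real.add_one_le_exp (l * |x| / q)]
    have h2 : |x| ^ q ≤ (q / l * Real.exp (l * |x| / q)) ^ q := by
      refine Real.rpow_le_rpow (abs_nonneg _) ?_ hq0.le
      calc |x| = q / l * (l * |x| / q) := by field_simp
        _ ≤ _ := by gcongr
    rw [Real.mul_rpow (by positivity) (Real.exp_pos _).le, ← Real.exp_mul,
      div_mul_cancel₀ _ hq0.ne'] at h2
    refine h2.trans ?_
    gcongr
    rcases abs_cases x with ⟨h, _⟩ | ⟨h, _⟩ <;> rw [h]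
    · linarith [Real.exp_pos (l * -x)]
    · linarith [Real.exp_pos (l * x)]
  have hmgf : ∀ b : ℝ, b ^ 2 = l ^ 2 → (Finset.expect Finset.univ fun r : ι → ℤˣ =>
      Real.exp (b * ∑ j, ((r j : ℤ) : ℝ) * a j)) ≤ Real.exp (q / 2) := by
    intro b hb
    have h := expect_exp_sign_sum_le fun j => b * a j
    have h2 : (∑ j, (b * a j) ^ 2) / 2 ≤ q / 2 := by
      simp_rw [mul_pow, ← Finset.mul_sum, hb]
      have : l ^ 2 * s ^ 2 = q := by
        rw [hl, div_pow, Real.sq_sqrt hq0.le]; field_simp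
      nlinarith [sq_nonneg l]
    refine le_trans (le_of_eq ?_) (h.trans (Real.exp_le_exp.2 h2))
    refine Finset.expect_congr rfl fun r _ => ?_
    rw [Finset.mul_sum]
    congr 1
    refine Finset.sum_congr rfl fun j _ => by ring
  have key := Finset.expect_le_expect (s := Finset.univ)
    (fun (r : ι → ℤˣ) _ => hpt (∑ j, ((r j : ℤ) : ℝ) * a j))
  rw [← Finset.mul_expect, Finset.expect_add_distrib] at key
  refine key.trans ?_
  have e1 := hmgf l rfl
  have e2 := hmgf (-l) (by ring)
  simp_rw [neg_mul, ← mul_neg] at e2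
  have hql : q / l = Real.sqrt q * s := by
    rw [hl]
    field_simp
    rw [Real.sq_sqrt hq0.le]
  have hexp : Real.exp (q / 2) ≤ 2 ^ q := by
    have : Real.exp (1 / 2) ≤ 2 := by
      have h := Real.exp_one_lt_d9
      have h' : Real.exp (1 / 2) ^ 2 = Real.exp 1 := by
        rw [← Real.exp_nat_mul]; norm_num
      nlinarith [Real.exp_pos (1 / 2)]
    calc Real.exp (q / 2) = Real.exp (1 / 2) ^ q := by rw [← Real.exp_mul]; congr 1; ring
      _ ≤ _ := Real.rpow_le_rpow (Real.exp_pos _).le this hq0.le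
  have h2q : (2 : ℝ) ≤ 2 ^ q := by
    simpa using Real.rpow_le_rpow_of_exponent_le (x := 2) (by norm_num) hq
  have h4 : (4 * Real.sqrt q * s) ^ q = (Real.sqrt q * s) ^ q * (2 ^ q * 2 ^ q) := by
    rw [← Real.mul_rpow (by norm_num) (by norm_num), ← Real.mul_rpow (by positivity) (by norm_num)]
    congr 1; ring
  rw [h4, hql]
  gcongr
  nlinarith

end Signs

section Selection

/-- A sign-symmetric one-step symmetrization and contraction argument: an upper bound for
`c + 2 b` yields, with the same average, an upper bound for `c + m - |b|`. -/
theorem exists_majorant_sub_abs {Ξ : Type*} {N : ℕ} (a : Ξ → Fin N → ℝ) (c : Ξ → ℝ)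
    (U : (Fin N → ℤˣ) → ℝ)
    (hU : ∀ r ξ, c ξ + 2 * ∑ j, ((r j : ℤ) : ℝ) * a ξ j ≤ U r) :
    ∃ V : (Fin N → ℤˣ) → ℝ,
      (∀ r ξ, c ξ + (Real.sqrt (∑ j, a ξ j ^ 2) / 2 - |∑ j, ((r j : ℤ) : ℝ) * a ξ j|) ≤ V r) ∧
      Finset.expect Finset.univ V = Finset.expect Finset.univ U := by
  set E : ℝ := Finset.expect Finset.univ fun r => max (U r) (U (-r)) with hE
  have hneg : Finset.expect Finset.univ (fun r => U (-r)) = Finset.expect Finset.univ U :=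
    Fintype.expect_equiv (Equiv.neg _) _ _ fun _ => rfl
  have hU' : ∀ r ξ, c ξ - 2 * ∑ j, ((r j : ℤ) : ℝ) * a ξ j ≤ U (-r) := by
    intro r ξ
    have := hU (-r) ξ
    simp only [Pi.neg_apply, Units.val_neg, Int.cast_neg, neg_mul, Finset.sum_neg_distrib] at this
    linarith
  refine ⟨fun r => (E + min (U r) (U (-r))) / 2, fun r ξ => ?_, ?_⟩
  · have h1 : c ξ + 2 * (Finset.expect Finset.univ fun r : Fin N → ℤˣ =>
        |∑ j, ((r j : ℤ) : ℝ) * a ξ j|) ≤ E := by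
      rw [hE, Finset.mul_expect, ← Fintype.expect_const (ι := Fin N → ℤˣ) (c ξ),
        ← Finset.expect_add_distrib]
      refine Finset.expect_le_expect fun r _ => ?_
      have e1 := hU r ξ
      have e2 := hU' r ξ
      rcases abs_cases (∑ j, ((r j : ℤ) : ℝ) * a ξ j) with ⟨h, _⟩ | ⟨h, _⟩ <;> rw [h]
      · exact e1.trans (le_max_left _ _)
      · exact le_trans (by linarith) (le_max_right _ _)
    have h2 : c ξ - 2 * |∑ j, ((r j : ℤ) : ℝ) * a ξ j| ≤ min (U r) (U (-r)) := by
      have e1 := hU r ξ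
      have e2 := hU' r ξ
      rcases abs_cases (∑ j, ((r j : ℤ) : ℝ) * a ξ j) with ⟨h, _⟩ | ⟨h, _⟩ <;> rw [h] <;>
        refine le_min ?_ ?_ <;> linarith
    have h3 := half_sqrt_le_expect_abs_sign_sum (a ξ)
    linarith
  · rw [← Finset.expect_div, Finset.expect_add_distrib, Fintype.expect_const, hE,
      ← Finset.expect_add_distrib]
    simp_rw [max_add_min]
    rw [Finset.expect_add_distrib, hneg]
    ring

/-- Selection of `n` sign vectors for which the `ℓ₁`-average of the coordinates
controls the Euclidean norm up to an error given by an average. -/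
theorem exists_signs_sub_abs_le {Ξ : Type*} {N : ℕ} (a : Ξ → Fin N → ℝ) (n : ℕ) (c : Ξ → ℝ)
    (U : (Fin n → Fin N → ℤˣ) → ℝ)
    (hU : ∀ r ξ, c ξ + 2 * ∑ i, ∑ j, ((r i j : ℤ) : ℝ) * a ξ j ≤ U r) :
    ∃ r : Fin n → Fin N → ℤˣ, ∀ ξ,
      c ξ + ∑ i, (Real.sqrt (∑ j, a ξ j ^ 2) / 2 - |∑ j, ((r i j : ℤ) : ℝ) * a ξ j|) ≤
        Finset.expect Finset.univ U := by
  induction n generalizing c with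
  | zero =>
    refine ⟨finZeroElim, fun ξ => ?_⟩
    have : U = fun _ => U finZeroElim := by
      ext r; congr 1; exact Subsingleton.elim _ _
    rw [this, Fintype.expect_const]
    simpa using hU finZeroElim ξ
  | succ n ih =>
    have hV : ∀ rs : Fin n → Fin N → ℤˣ, ∃ V : (Fin N → ℤˣ) → ℝ,
        (∀ r ξ, c ξ + 2 * (∑ i, ∑ j, ((rs i j : ℤ) : ℝ) * a ξ j) +
          (Real.sqrt (∑ j, a ξ j ^ 2) / 2 - |∑ j, ((r j : ℤ) : ℝ) * a ξ j|) ≤ V r) ∧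
        Finset.expect Finset.univ V =
          Finset.expect Finset.univ fun r => U (Fin.cons r rs) := by
      intro rs
      refine exists_majorant_sub_abs a
        (fun ξ => c ξ + 2 * ∑ i, ∑ j, ((rs i j : ℤ) : ℝ) * a ξ j) _ fun r ξ => ?_
      have := hU (Fin.cons r rs) ξ
      simp only [Fin.sum_univ_succ, Fin.cons_zero, Fin.cons_succ] at this
      linarith
    choose V hV hVE using hV
    have hEU : (Finset.expect Finset.univ fun r => Finset.expect Finset.univ fun rs => V rs r) =
        Finset.expect Finset.univ U := by
      rw [Finset.expect_comm, expect_fin_cons]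
      exact (Finset.expect_congr rfl fun rs _ => hVE rs).trans (Finset.expect_comm _ _ _)
    obtain ⟨r₀, -, hr₀⟩ := Finset.exists_le_of_expect_le Finset.univ_nonempty hEU.le
    obtain ⟨rs, hrs⟩ := ih
      (fun ξ => c ξ + (Real.sqrt (∑ j, a ξ j ^ 2) / 2 - |∑ j, ((r₀ j : ℤ) : ℝ) * a ξ j|))
      (fun rs => V rs r₀) fun rs ξ => by linarith [hV rs r₀ ξ]
    refine ⟨Fin.cons r₀ rs, fun ξ => ?_⟩
    have := hrs ξ
    simp only [Fin.sum_univ_succ, Fin.cons_zero, Fin.cons_succ]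
    linarith

end Selection

section Widths

theorem rank_span_range_fin_le {Y : Type*} [AddCommGroup Y] [Module ℝ Y] {n : ℕ}
    (v : Fin n → Y) : Module.rank ℝ (Submodule.span ℝ (Set.range v)) ≤ (n : Cardinal) := by
  have : Module.Finite ℝ (Submodule.span ℝ (Set.range v)) :=
    Module.Finite.span_of_finite ℝ (Set.finite_range v)
  rw [← Module.finrank_eq_rank]
  exact_mod_cast (finrank_range_le_card v).trans (by simp)

/-- Duality formula for the distance to a subspace, upper bound. -/
theorem infDist_le_of_forall_dual {Y : Type*} [NormedAddCommGroup Y] [NormedSpace ℝ Y]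
    (F : Submodule ℝ Y) (y : Y) {ε : ℝ}
    (h : ∀ ξ : StrongDual ℝ Y, ‖ξ‖ ≤ 1 → (∀ w ∈ F, ξ w = 0) → ξ y ≤ ε) :
    Metric.infDist y (F : Set Y) ≤ ε := by
  obtain ⟨g, hg, hgy⟩ := exists_dual_vector'' ℝ (F.mkQ y)
  have hn : ∀ z, ‖F.mkQ z‖ = Metric.infDist z (F : Set Y) := fun z =>
    QuotientAddGroup.norm_mk (S := F.toAddSubgroup) z
  have hle : ∀ z, ‖F.mkQ z‖ ≤ 1 * ‖z‖ := by
    intro z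
    rw [hn, one_mul]
    simpa using Metric.infDist_le_dist_of_mem (x := z) F.zero_mem
  let Q : Y →L[ℝ] Y ⧸ F := F.mkQ.mkContinuous 1 hle
  have hQ : ‖Q‖ ≤ 1 := LinearMap.mkContinuous_norm_le _ zero_le_one _
  have := h (g.comp Q) ((ContinuousLinearMap.opNorm_comp_le _ _).trans (by
    nlinarith [norm_nonneg g, norm_nonneg Q])) (fun w hw => by
      have : F.mkQ w = 0 := by simpa using hw
      simp [Q, this])
  rw [← hn]
  calc ‖F.mkQ y‖ = g (F.mkQ y) := by rw [hgy]; rfl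
    _ ≤ ε := this

/-- An upper bound for Kolmogorov widths in terms of Rademacher averages. -/
theorem exists_submodule_infDist_le_expect {Y : Type*} [NormedAddCommGroup Y] [NormedSpace ℝ Y]
    {N : ℕ} (y : Fin N → Y) (n : ℕ) (hn : 1 ≤ n) :
    ∃ F : Submodule ℝ Y, Module.rank ℝ F ≤ (n : Cardinal) ∧
      ∀ x : Fin N → ℝ, ∑ j, x j ^ 2 ≤ 1 →
        Metric.infDist (∑ j, x j • y j) (F : Set Y) ≤
          4 / n * Finset.expect Finset.univ fun r : Fin n → Fin N → ℤˣ =>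
            ‖∑ i, ∑ j, ((r i j : ℤ) : ℝ) • y j‖ := by
  obtain ⟨r, hr⟩ := exists_signs_sub_abs_le
    (fun (ξ : {ξ : StrongDual ℝ Y // ‖ξ‖ ≤ 1}) j => ξ.1 (y j)) n (fun _ => 0)
    (fun r => 2 * ‖∑ i, ∑ j, ((r i j : ℤ) : ℝ) • y j‖) (fun r ξ => by
      have h1 : (∑ i, ∑ j, ((r i j : ℤ) : ℝ) * ξ.1 (y j)) =
          ξ.1 (∑ i, ∑ j, ((r i j : ℤ) : ℝ) • y j) := by simp [map_sum]
      rw [h1, zero_add]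
      have h2 := (le_abs_self _).trans
        (ξ.1.le_of_opNorm_le ξ.2 (∑ i, ∑ j, ((r i j : ℤ) : ℝ) • y j))
      linarith)
  rw [← Finset.mul_expect] at hr
  set E : ℝ := Finset.expect Finset.univ fun r : Fin n → Fin N → ℤˣ =>
            ‖∑ i, ∑ j, ((r i j : ℤ) : ℝ) • y j‖ with hE
  refine ⟨Submodule.span ℝ (Set.range fun i => ∑ j, ((r i j : ℤ) : ℝ) • y j), ?_, ?_⟩
  · exact rank_span_range_fin_le _
  · intro x hx
    refine infDist_le_of_forall_dual _ _ fun ξ hξ h0 => ?_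
    have h1 := hr ⟨ξ, hξ⟩
    have h2 : ∀ i, ∑ j, ((r i j : ℤ) : ℝ) * ξ (y j) = 0 := by
      intro i
      have := h0 _ (Submodule.subset_span ⟨i, rfl⟩)
      simpa [map_sum] using this
    simp only [h2, abs_zero, sub_zero, zero_add, Finset.sum_const, Finset.card_univ,
      Fintype.card_fin, nsmul_eq_mul] at h1
    have hn0 : (0 : ℝ) < n := by exact_mod_cast hn
    have h3 : ξ (∑ j, x j • y j) ≤ Real.sqrt (∑ j, ξ (y j) ^ 2) := by
      rw [map_sum]
      simp only [map_smul, smul_eq_mul]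
      refine (Real.sum_mul_le_sqrt_mul_sqrt _ _ _).trans ?_
      have : Real.sqrt (∑ j, x j ^ 2) ≤ 1 := Real.sqrt_le_one.2 hx
      nlinarith [Real.sqrt_nonneg (∑ j, ξ (y j) ^ 2)]
    refine h3.trans ?_
    rw [div_mul_eq_mul_div, le_div_iff₀ hn0]
    linarith

end Widths

section LpWidths

variable {Ω : Type*} [MeasurableSpace Ω] {μ : Measure Ω}

theorem expect_rpow_le {ι : Type*} [Fintype ι] [Nonempty ι] (z : ι → ℝ) (hz : ∀ i, 0 ≤ z i)
    {q : ℝ} (hq : 1 ≤ q) :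
    (Finset.expect Finset.univ z) ^ q ≤ Finset.expect Finset.univ fun i => z i ^ q := by
  have hc : (0 : ℝ) < Fintype.card ι := by exact_mod_cast Fintype.card_pos
  have := Real.rpow_arith_mean_le_arith_mean_rpow Finset.univ
    (fun _ : ι => (Fintype.card ι : ℝ)⁻¹) z (fun _ _ => by positivity)
    (by simp) (fun i _ => hz i) hq
  rw [← Finset.mul_sum, ← Finset.mul_sum] at this
  rwa [Fintype.expect_eq_sum_div_card, Fintype.expect_eq_sum_div_card, div_eq_inv_mul,
    div_eq_inv_mul]

theorem Lp_norm_rpow_eq {q : ℝ} (hq : 1 ≤ q) (f : Lp ℝ (ENNReal.ofReal q) μ) :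
    ‖f‖ ^ q = ∫ t, |f t| ^ q ∂μ := by
  have hq0 : 0 < q := by linarith
  have h := (Lp.memLp f).eLpNorm_eq_integral_rpow_norm (by simpa using hq0) (by simp)
  rw [ENNReal.toReal_ofReal hq0.le] at h
  have hnn : 0 ≤ ∫ t, ‖f t‖ ^ q ∂μ := integral_nonneg fun t => by positivity
  rw [Lp.norm_def, h, ENNReal.toReal_ofReal (by positivity), ← Real.rpow_mul hnn,
    inv_mul_cancel₀ hq0.ne', Real.rpow_one]
  rfl

variable [IsProbabilityMeasure μ]

theorem expect_norm_sign_sum_le {q : ℝ} (hq : 1 ≤ q) [Fact (1 ≤ ENNReal.ofReal q)] {N : ℕ}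
    (y : Fin N → Lp ℝ (ENNReal.ofReal q) μ) {M : ℝ} (hM : 0 ≤ M)
    (hy : ∀ᵐ t ∂μ, ∑ j, y j t ^ 2 ≤ M ^ 2) (n : ℕ) :
    (Finset.expect Finset.univ fun r : Fin n → Fin N → ℤˣ =>
      ‖∑ i, ∑ j, ((r i j : ℤ) : ℝ) • y j‖) ≤ 4 * Real.sqrt q * (Real.sqrt n * M) := by
  have hq0 : 0 < q := by linarith
  have hB : 0 ≤ 4 * Real.sqrt q * (Real.sqrt n * M) := by positivity
  rw [← Real.rpow_le_rpow_iff (Finset.expect_nonneg fun _ _ => norm_nonneg _) hB hq0]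
  refine (expect_rpow_le _ (fun _ => norm_nonneg _) hq).trans ?_
  simp_rw [Lp_norm_rpow_eq hq]
  have hint : ∀ f : Lp ℝ (ENNReal.ofReal q) μ, Integrable (fun t => |f t| ^ q) μ := by
    intro f
    have := (Lp.memLp f).integrable_norm_rpow (by simpa using hq0) (by simp)
    rwa [ENNReal.toReal_ofReal hq0.le] at this
  rw [Fintype.expect_eq_sum_div_card, ← integral_finsetSum _ fun r _ => hint _, ← integral_div]
  have hae : ∀ᵐ t ∂μ, ∀ r : Fin n → Fin N → ℤˣ,
      (∑ i, ∑ j, ((r i j : ℤ) : ℝ) • y j : Lp ℝ (ENNReal.ofReal q) μ) t =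
        ∑ p : Fin n × Fin N, ((r p.1 p.2 : ℤ) : ℝ) * y p.2 t := by
    rw [ae_all_iff]
    intro r
    rw [← Finset.univ_product_univ, ← Finset.sum_product']
    have h1 := Lp.coeFn_finsetSum (Finset.univ ×ˢ Finset.univ)
      (fun p : Fin n × Fin N => ((r p.1 p.2 : ℤ) : ℝ) • y p.2)
    have h2 : ∀ᵐ t ∂μ, ∀ p : Fin n × Fin N,
        (((r p.1 p.2 : ℤ) : ℝ) • y p.2 : Lp ℝ (ENNReal.ofReal q) μ) t =
          ((r p.1 p.2 : ℤ) : ℝ) * y p.2 t := by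
      rw [ae_all_iff]
      intro p
      filter_upwards [Lp.coeFn_smul ((r p.1 p.2 : ℤ) : ℝ) (y p.2)] with t ht
      simpa using ht
    filter_upwards [h1, h2] with t h1 h2
    rw [h1]
    simp [h2]
  have hbound : ∀ᵐ t ∂μ, (∑ r : Fin n → Fin N → ℤˣ,
      |(∑ i, ∑ j, ((r i j : ℤ) : ℝ) • y j : Lp ℝ (ENNReal.ofReal q) μ) t| ^ q) /
        (Fintype.card (Fin n → Fin N → ℤˣ) : ℝ) ≤ (4 * Real.sqrt q * (Real.sqrt n * M)) ^ q := by
    filter_upwards [hae, hy] with t ht hyt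
    simp_rw [ht]
    rw [← Fintype.expect_eq_sum_div_card]
    have := expect_abs_sign_sum_rpow_le (fun p : Fin n × Fin N => y p.2 t) hq
      (s := Real.sqrt n * M) (by positivity) (by
        rw [Fintype.sum_prod_type]
        simp only [Finset.sum_const, Finset.card_univ, Fintype.card_fin, nsmul_eq_mul]
        rw [mul_pow, Real.sq_sqrt (by positivity)]
        gcongr)
    refine le_trans (le_of_eq ?_) this
    exact Fintype.expect_equiv (Equiv.curry _ _ _).symm _ _ fun _ => rfl
  have := integral_mono_ae ((integrable_finsetSum _ fun r _ => hint _).div_const _)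
    (integrable_const _) hbound
  simpa using this

/-- Kolmogorov widths in `L_q` of a finite-dimensional ellipsoid. -/
theorem exists_submodule_Lp_infDist_le {q : ℝ} (hq : 1 ≤ q) [Fact (1 ≤ ENNReal.ofReal q)] {N : ℕ}
    (y : Fin N → Lp ℝ (ENNReal.ofReal q) μ) {M : ℝ} (hM : 0 ≤ M)
    (hy : ∀ᵐ t ∂μ, ∑ j, y j t ^ 2 ≤ M ^ 2) (n : ℕ) (hn : 1 ≤ n) :
    ∃ F : Submodule ℝ (Lp ℝ (ENNReal.ofReal q) μ), Module.rank ℝ F ≤ (n : Cardinal) ∧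
      ∀ x : Fin N → ℝ, ∑ j, x j ^ 2 ≤ 1 →
        Metric.infDist (∑ j, x j • y j) (F : Set (Lp ℝ (ENNReal.ofReal q) μ)) ≤
          16 * Real.sqrt q * M / Real.sqrt n := by
  obtain ⟨F, hF, h⟩ := exists_submodule_infDist_le_expect y n hn
  refine ⟨F, hF, fun x hx => (h x hx).trans ?_⟩
  have hn0 : (0 : ℝ) < n := by exact_mod_cast hn
  have hs : 0 < Real.sqrt n := Real.sqrt_pos.2 hn0
  calc _ ≤ 4 / (n : ℝ) * (4 * Real.sqrt q * (Real.sqrt n * M)) := by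
        gcongr
        exact expect_norm_sign_sum_le hq y hM hy n
    _ = _ := by
        have hnn : (n : ℝ) = Real.sqrt n * Real.sqrt n := (Real.mul_self_sqrt hn0.le).symm
        rw [eq_div_iff hs.ne', div_mul_eq_mul_div, div_mul_eq_mul_div, div_eq_iff hn0.ne']
        linear_combination (-16 * Real.sqrt q * M) * hnn

end LpWidths

section StepApproximation

theorem infDist_sup_le {Y : Type*} [NormedAddCommGroup Y] [NormedSpace ℝ Y]
    (F₁ F₂ : Submodule ℝ Y) (z y w : Y) (hw : w ∈ F₁) :
    Metric.infDist z ((F₁ ⊔ F₂ : Submodule ℝ Y) : Set Y) ≤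
      ‖z - w - y‖ + Metric.infDist y (F₂ : Set Y) := by
  have hn : ∀ z, Metric.infDist z ((F₁ ⊔ F₂ : Submodule ℝ Y) : Set Y) =
      ‖(F₁ ⊔ F₂).mkQ z‖ := fun z =>
    (QuotientAddGroup.norm_mk (S := (F₁ ⊔ F₂).toAddSubgroup) z).symm
  have h1 : (F₁ ⊔ F₂).mkQ w = 0 := by
    simpa using (le_sup_left : F₁ ≤ F₁ ⊔ F₂) hw
  have h2 : (F₁ ⊔ F₂).mkQ z = (F₁ ⊔ F₂).mkQ (z - w - y) + (F₁ ⊔ F₂).mkQ y := by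
    rw [map_sub, map_sub, h1]; abel
  have h3 : Metric.infDist y ((F₁ ⊔ F₂ : Submodule ℝ Y) : Set Y) ≤ Metric.infDist y (F₂ : Set Y) :=
    Metric.infDist_le_infDist_of_subset (le_sup_right : F₂ ≤ F₁ ⊔ F₂) ⟨0, F₂.zero_mem⟩
  have h4 : Metric.infDist (z - w - y) ((F₁ ⊔ F₂ : Submodule ℝ Y) : Set Y) ≤ ‖z - w - y‖ := by
    simpa using Metric.infDist_le_dist_of_mem (x := z - w - y) (F₁ ⊔ F₂).zero_mem
  rw [hn, h2]
  refine (norm_add_le _ _).trans ?_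
  rw [← hn, ← hn]
  linarith

instance isProbabilityMeasure_restrict_unitInterval :
    IsProbabilityMeasure (volume.restrict (Set.Icc (0 : ℝ) 1)) :=
  ⟨by simp⟩

/-- Step functions on the grid of mesh `1 / p` form a space of dimension at most `p + 1`. -/
theorem exists_submodule_step (Q : ENNReal) [Fact (1 ≤ Q)] (p : ℕ) :
    ∃ F : Submodule ℝ (Lp ℝ Q (volume.restrict (Set.Icc (0 : ℝ) 1))),
      Module.rank ℝ F ≤ ((p + 1 : ℕ) : Cardinal) ∧
      ∀ g : ℕ → ℝ, ∃ w ∈ F, ∀ᵐ t ∂(volume.restrict (Set.Icc (0 : ℝ) 1)), w t = g ⌊(p : ℝ) * t⌋₊ := by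
  have hms : ∀ i : ℕ, MeasurableSet {t : ℝ | ⌊(p : ℝ) * t⌋₊ = i} := fun i =>
    (Nat.measurable_floor.comp (measurable_const_mul (p : ℝ))) (measurableSet_singleton i)
  let e : Fin (p + 1) → Lp ℝ Q (volume.restrict (Set.Icc (0 : ℝ) 1)) := fun i =>
    indicatorConstLp Q (hms i) (measure_ne_top _ _) (1 : ℝ)
  refine ⟨Submodule.span ℝ (Set.range e), ?_, fun g => ⟨∑ i : Fin (p + 1), g i • e i, ?_, ?_⟩⟩
  · exact rank_span_range_fin_le e
  · exact Submodule.sum_mem _ fun i _ => Submodule.smul_mem _ _ (Submodule.subset_span ⟨i, rfl⟩)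
  · have h1 := Lp.coeFn_finsetSum Finset.univ (fun i : Fin (p + 1) => g i • e i)
    have h2 : ∀ᵐ t ∂(volume.restrict (Set.Icc (0 : ℝ) 1)), ∀ i : Fin (p + 1),
        (g i • e i : Lp ℝ Q (volume.restrict (Set.Icc (0 : ℝ) 1))) t =
          g i * Set.indicator {t : ℝ | ⌊(p : ℝ) * t⌋₊ = i} (fun _ => (1 : ℝ)) t := by
      rw [ae_all_iff]
      intro i
      filter_upwards [Lp.coeFn_smul (g i) (e i), indicatorConstLp_coeFn (p := Q) (hs := hms i)
        (hμs := measure_ne_top (volume.restrict (Set.Icc (0 : ℝ) 1)) _) (c := (1 : ℝ))] with t h h'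
      rw [h, Pi.smul_apply, smul_eq_mul]
      exact congrArg _ h'
    filter_upwards [h1, h2, ae_restrict_mem measurableSet_Icc] with t h1 h2 ht
    have hlt : ⌊(p : ℝ) * t⌋₊ < p + 1 := by
      have : (p : ℝ) * t ≤ p := mul_le_of_le_one_right (Nat.cast_nonneg _) ht.2
      have := Nat.floor_le_floor this
      rw [Nat.floor_natCast] at this
      omega
    rw [h1]
    simp only [Finset.sum_apply, h2]
    rw [Finset.sum_eq_single ⟨⌊(p : ℝ) * t⌋₊, hlt⟩]
    · simp
    · intro i _ hi
      have : ⌊(p : ℝ) * t⌋₊ ≠ i := fun h => hi (Fin.ext h.symm)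
      simp [this]
    · simp

theorem floor_mul_div_bounds {m : ℕ} (hm : 1 ≤ m) {t : ℝ} (ht : 0 ≤ t) :
    (⌊(m : ℝ) * t⌋₊ : ℝ) / m ≤ t ∧ t ≤ (⌊(m : ℝ) * t⌋₊ : ℝ) / m + 1 / m := by
  have hm0 : (0 : ℝ) < m := by exact_mod_cast hm
  constructor
  · rw [div_le_iff₀ hm0, mul_comm]
    exact Nat.floor_le (by positivity)
  · rw [← add_div, le_div_iff₀ hm0, mul_comm]
    exact (Nat.lt_floor_add_one _).le

theorem inner_eq_sum_of_mem {E : Type*} [NormedAddCommGroup E] [InnerProductSpace ℝ E]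
    (V : Submodule ℝ E) {ι : Type*} [Fintype ι] (b : OrthonormalBasis ι ℝ V) {v : E}
    (hv : v ∈ V) (f : E) :
    inner ℝ v f = ∑ j, inner ℝ (b j : E) f * inner ℝ (b j : E) v := by
  have h := congrArg (fun z : V => inner ℝ (z : E) f) (b.sum_repr' ⟨v, hv⟩)
  simp only [Submodule.coe_sum, Submodule.coe_smul, sum_inner, real_inner_smul_left,
    Submodule.coe_inner] at h
  rw [← h]
  exact Finset.sum_congr rfl fun j _ => mul_comm _ _

/-- Widths of an operator `f ↦ ⟪κ ·, f⟫` into `L_q` given by a Hilbert space valued curve with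
modulus of continuity `ω`. -/
theorem exists_submodule_infDist_le_of_curve {E : Type*} [NormedAddCommGroup E]
    [InnerProductSpace ℝ E] {q : ℝ} (hq : 1 ≤ q) [Fact (1 ≤ ENNReal.ofReal q)]
    (κ : ℝ → E) (ω : ℝ → ℝ)
    (hω : ∀ δ, ∀ s ∈ Set.Icc (0 : ℝ) 1, ∀ t ∈ Set.Icc (0 : ℝ) 1, |t - s| ≤ δ → ‖κ t - κ s‖ ≤ ω δ)
    (T : E → Lp ℝ (ENNReal.ofReal q) (volume.restrict (Set.Icc (0 : ℝ) 1)))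
    (hT : ∀ f, ∀ᵐ t ∂(volume.restrict (Set.Icc (0 : ℝ) 1)), T f t = inner ℝ (κ t) f)
    (p m : ℕ) (hp : 1 ≤ p) (hpm : p ≤ m) :
    ∃ F : Submodule ℝ (Lp ℝ (ENNReal.ofReal q) (volume.restrict (Set.Icc (0 : ℝ) 1))),
      Module.rank ℝ F ≤ ((2 * p + 1 : ℕ) : Cardinal) ∧
      ∀ f ∈ Metric.closedBall (0 : E) 1, Metric.infDist (T f) (F : Set _) ≤
        ω (1 / m) + 16 * Real.sqrt q * ω (1 / p) / Real.sqrt p := by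
  have hm : 1 ≤ m := hp.trans hpm
  have hp0 : (0 : ℝ) < p := by exact_mod_cast hp
  have hm0 : (0 : ℝ) < m := by exact_mod_cast hm
  have hpm' : (1 : ℝ) / m ≤ 1 / p := one_div_le_one_div_of_le hp0 (by exact_mod_cast hpm)
  have hω0 : ∀ δ, 0 ≤ δ → 0 ≤ ω δ := fun δ hδ =>
    (norm_nonneg _).trans (hω δ 0 (by simp) 0 (by simp) (by simpa using hδ))
  have hgrid : ∀ l : ℕ, 1 ≤ l → ∀ t ∈ Set.Icc (0 : ℝ) 1,
      (⌊(l : ℝ) * t⌋₊ : ℝ) / l ∈ Set.Icc (0 : ℝ) 1 := fun l hl t ht =>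
    ⟨by positivity, (floor_mul_div_bounds hl ht.1).1.trans ht.2⟩
  have hfl : ∀ l : ℕ, ∀ t ∈ Set.Icc (0 : ℝ) 1, ⌊(l : ℝ) * t⌋₊ ≤ l := by
    intro l t ht
    have := Nat.floor_le_floor (mul_le_of_le_one_right (Nat.cast_nonneg l) ht.2)
    rwa [Nat.floor_natCast] at this
  let S : Set E := (fun i : ℕ => κ ((i : ℝ) / m)) '' Set.Iic m ∪
    (fun i : ℕ => κ ((i : ℝ) / p)) '' Set.Iic p
  have hS : S.Finite := ((Set.finite_Iic m).image _).union ((Set.finite_Iic p).image _)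
  let V : Submodule ℝ E := Submodule.span ℝ S
  have : FiniteDimensional ℝ V := FiniteDimensional.span_of_finite ℝ hS
  let b := stdOrthonormalBasis ℝ V
  have hmem : ∀ t ∈ Set.Icc (0 : ℝ) 1,
      κ ((⌊(m : ℝ) * t⌋₊ : ℝ) / m) - κ ((⌊(p : ℝ) * t⌋₊ : ℝ) / p) ∈ V := fun t ht =>
    Submodule.sub_mem _
      (Submodule.subset_span (Or.inl ⟨_, hfl m t ht, rfl⟩))
      (Submodule.subset_span (Or.inr ⟨_, hfl p t ht, rfl⟩))
  obtain ⟨F₁, hF₁, hstep⟩ := exists_submodule_step (ENNReal.ofReal q) p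
  obtain ⟨F₀, -, hstep'⟩ := exists_submodule_step (ENNReal.ofReal q) m
  have hy : ∀ j, ∃ y : Lp ℝ (ENNReal.ofReal q) (volume.restrict (Set.Icc (0 : ℝ) 1)),
      ∀ᵐ t ∂(volume.restrict (Set.Icc (0 : ℝ) 1)), y t = inner ℝ (b j : E)
        (κ ((⌊(m : ℝ) * t⌋₊ : ℝ) / m) - κ ((⌊(p : ℝ) * t⌋₊ : ℝ) / p)) := by
    intro j
    obtain ⟨w₁, -, h₁⟩ := hstep' fun i => inner ℝ (b j : E) (κ ((i : ℝ) / m))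
    obtain ⟨w₂, -, h₂⟩ := hstep fun i => inner ℝ (b j : E) (κ ((i : ℝ) / p))
    refine ⟨w₁ - w₂, ?_⟩
    filter_upwards [h₁, h₂, Lp.coeFn_sub w₁ w₂] with t h₁ h₂ h
    rw [h, Pi.sub_apply, h₁, h₂, inner_sub_right]
  choose y hy using hy
  have hyall := ae_all_iff.2 hy
  obtain ⟨F₂, hF₂, hdist⟩ := exists_submodule_Lp_infDist_le hq y (hω0 (1 / p) (by positivity))
    (by
      filter_upwards [hyall, ae_restrict_mem measurableSet_Icc] with t hyt ht
      have h := inner_eq_sum_of_mem V b (hmem t ht)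
        (κ ((⌊(m : ℝ) * t⌋₊ : ℝ) / m) - κ ((⌊(p : ℝ) * t⌋₊ : ℝ) / p))
      rw [real_inner_self_eq_norm_sq] at h
      simp_rw [hyt, pow_two (inner ℝ (b _ : E) _)]
      rw [← h]
      refine pow_le_pow_left₀ (norm_nonneg _)
        (hω _ _ (hgrid p hp t ht) _ (hgrid m hm t ht) ?_) 2
      have h1 := floor_mul_div_bounds hp ht.1
      have h2 := floor_mul_div_bounds hm ht.1
      rw [abs_le]
      constructor <;> linarith) p hp
  refine ⟨F₁ ⊔ F₂, ?_, fun f hf => ?_⟩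
  · refine (Submodule.rank_add_le_rank_add_rank F₁ F₂).trans ((add_le_add hF₁ hF₂).trans ?_)
    exact_mod_cast (by omega : p + 1 + p ≤ 2 * p + 1)
  · have hf1 : ‖f‖ ≤ 1 := by simpa using hf
    obtain ⟨w, hw, hwt⟩ := hstep fun i => inner ℝ (κ ((i : ℝ) / p)) f
    refine (infDist_sup_le F₁ F₂ (T f) (∑ j, (inner ℝ (b j : E) f : ℝ) • y j) w hw).trans ?_
    refine add_le_add ?_ (hdist _ ?_)
    · have hbd : ∀ᵐ t ∂(volume.restrict (Set.Icc (0 : ℝ) 1)),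
          ‖(T f - w - ∑ j, (inner ℝ (b j : E) f : ℝ) • y j :
            Lp ℝ (ENNReal.ofReal q) (volume.restrict (Set.Icc (0 : ℝ) 1))) t‖ ≤ ω (1 / m) := by
        have hsm : ∀ᵐ t ∂(volume.restrict (Set.Icc (0 : ℝ) 1)), ∀ j,
            ((inner ℝ (b j : E) f : ℝ) • y j :
              Lp ℝ (ENNReal.ofReal q) (volume.restrict (Set.Icc (0 : ℝ) 1))) t =
              (inner ℝ (b j : E) f : ℝ) * y j t := by
          rw [ae_all_iff]
          intro j
          filter_upwards [Lp.coeFn_smul (inner ℝ (b j : E) f : ℝ) (y j)] with t h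
          simpa using h
        filter_upwards [Lp.coeFn_sub (T f - w) (∑ j, (inner ℝ (b j : E) f : ℝ) • y j),
          Lp.coeFn_sub (T f) w,
          Lp.coeFn_finsetSum Finset.univ (fun j => (inner ℝ (b j : E) f : ℝ) • y j),
          hsm, hyall, hwt, hT f, ae_restrict_mem measurableSet_Icc] with t e1 e2 e3 e4 e5 e6 e7 ht
        have h := inner_eq_sum_of_mem V b (hmem t ht) f
        rw [e1, Pi.sub_apply, e2, Pi.sub_apply, e3, Finset.sum_apply, e6, e7]
        simp_rw [e4, e5]
        rw [← h, ← inner_sub_left, ← inner_sub_left]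
        refine (norm_inner_le_norm _ _).trans ?_
        have h2 := floor_mul_div_bounds hm ht.1
        have h3 := hω (1 / m) _ (hgrid m hm t ht) t ht (by rw [abs_le]; constructor <;> linarith)
        rw [show κ t - κ ((⌊(p : ℝ) * t⌋₊ : ℝ) / p) -
          (κ ((⌊(m : ℝ) * t⌋₊ : ℝ) / m) - κ ((⌊(p : ℝ) * t⌋₊ : ℝ) / p)) =
          κ t - κ ((⌊(m : ℝ) * t⌋₊ : ℝ) / m) by abel]
        nlinarith [norm_nonneg (κ t - κ ((⌊(m : ℝ) * t⌋₊ : ℝ) / m)), norm_nonneg f]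
      have h1 : measureUnivNNReal (volume.restrict (Set.Icc (0 : ℝ) 1)) = 1 := by
        simp [measureUnivNNReal]
      simpa [h1] using Lp.norm_le_of_ae_bound (hω0 _ (by positivity)) hbd
    · have ho : Orthonormal ℝ fun j => (b j : E) :=
        b.orthonormal.comp_linearIsometry V.subtypeₗᵢ
      have := ho.sum_inner_products_le (s := Finset.univ) f
      simp only [Real.norm_eq_abs, sq_abs] at this
      nlinarith [norm_nonneg f]

end StepApproximation

section Kernel

variable {g : ℝ → ℝ}

theorem integrable_comp_abs_sq (hgz : ∀ x ≤ 0, g x = 0) (hgi : Integrable fun x => g x ^ 2) :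
    Integrable fun x => g |x| ^ 2 := by
  refine (hgi.add hgi.comp_neg).congr (Filter.Eventually.of_forall fun x => ?_)
  rcases le_total 0 x with h | h
  · simp [abs_of_nonneg h, hgz (-x) (by linarith)]
  · simp [abs_of_nonpos h, hgz x h]

theorem intervalIntegral_sq_mono (hgi : Integrable fun x => g x ^ 2) {a b : ℝ}
    (ha : 0 ≤ a) (hab : a ≤ b) : ∫ u in (0 : ℝ)..a, g u ^ 2 ≤ ∫ u in (0 : ℝ)..b, g u ^ 2 :=
  intervalIntegral.integral_mono_interval le_rfl ha hab
    (Filter.Eventually.of_forall fun _ => sq_nonneg _) hgi.intervalIntegrable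

theorem intervalIntegral_comp_abs_sq (hgz : ∀ x ≤ 0, g x = 0)
    (hgi : Integrable fun x => g x ^ 2) {e : ℝ} (he : 0 ≤ e) :
    ∫ u in (-e)..e, g |u| ^ 2 = 2 * ∫ u in (0 : ℝ)..e, g u ^ 2 := by
  have hH := integrable_comp_abs_sq hgz hgi
  have h1 : ∫ u in (0 : ℝ)..e, g |u| ^ 2 = ∫ u in (0 : ℝ)..e, g u ^ 2 := by
    refine intervalIntegral.integral_congr fun u hu => ?_
    rw [Set.uIcc_of_le he] at hu
    simp only [abs_of_nonneg hu.1]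
  have h2 : ∫ u in (-e)..0, g |u| ^ 2 = ∫ u in (0 : ℝ)..e, g |u| ^ 2 := by
    have := intervalIntegral.integral_comp_neg (a := 0) (b := e) fun u => g |u| ^ 2
    simpa using this.symm
  rw [← intervalIntegral.integral_add_adjacent_intervals (b := 0) hH.intervalIntegrable
    hH.intervalIntegrable, h2, h1]
  ring

theorem intervalIntegral_sq_le_mul (hga : AntitoneOn g (Set.Ioi 0)) (hg0 : ∀ x, 0 ≤ g x)
    (hgi : Integrable fun x => g x ^ 2) {a b : ℝ} (ha : 0 < a) (hab : a ≤ b) :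
    ∫ u in (0 : ℝ)..b, g u ^ 2 ≤ b / a * ∫ u in (0 : ℝ)..a, g u ^ 2 := by
  have hc : 1 ≤ b / a := (one_le_div ha).2 hab
  have hc0 : b / a ≠ 0 := by positivity
  have h := intervalIntegral.integral_comp_mul_left (a := 0) (b := a) (fun u => g u ^ 2) hc0
  rw [mul_zero, div_mul_cancel₀ _ ha.ne', smul_eq_mul] at h
  have h2 : ∫ u in (0 : ℝ)..a, g (b / a * u) ^ 2 ≤ ∫ u in (0 : ℝ)..a, g u ^ 2 := by
    refine intervalIntegral.integral_mono_on_of_le_Ioo ha.le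
      (hgi.comp_mul_left' hc0).intervalIntegrable hgi.intervalIntegrable fun u hu => ?_
    have hu0 : 0 < u := hu.1
    refine pow_le_pow_left₀ (hg0 _) (hga hu0 (Set.mem_Ioi.2 (by positivity)) ?_) 2
    nlinarith
  rw [h] at h2
  rwa [inv_mul_le_iff₀ (by positivity)] at h2

theorem intervalIntegral_sq_sub_le (hgm : Measurable g) (hg0 : ∀ x, 0 ≤ g x)
    (hgz : ∀ x ≤ 0, g x = 0) (hga : AntitoneOn g (Set.Ioi 0))
    (hgi : Integrable fun x => g x ^ 2) {s t : ℝ} (hs : s ∈ Set.Icc (0 : ℝ) 1)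
    (ht : t ∈ Set.Icc (0 : ℝ) 1) (hst : s ≤ t) :
    ∫ x in (0 : ℝ)..1, (g |t - x| - g |s - x|) ^ 2 ≤ 4 * ∫ u in (0 : ℝ)..(t - s), g u ^ 2 := by
  have hH := integrable_comp_abs_sq hgz hgi
  rcases hst.eq_or_lt with rfl | hst
  · simp
  have hHc : ∀ c : ℝ, Integrable fun x => g |c - x| ^ 2 := fun c => hH.comp_sub_left c
  have hm : ∀ c : ℝ, AEStronglyMeasurable (fun x => g |c - x|) volume := fun c =>
    (hgm.comp (by fun_prop)).aestronglyMeasurable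
  have hL : ∀ c : ℝ, MemLp (fun x => g |c - x|) 2 volume := fun c =>
    (memLp_two_iff_integrable_sq (hm c)).2 (hHc c)
  have hD : Integrable fun x => (g |t - x| - g |s - x|) ^ 2 :=
    (memLp_two_iff_integrable_sq ((hm t).sub (hm s))).1 ((hL t).sub (hL s))
  set d := (t - s) / 2 with hd
  have hd0 : 0 < d := by rw [hd]; linarith
  set e := (s + t) / 2 with he
  have hcore : ∫ u in (-d)..d, g |u| ^ 2 ≤ 2 * ∫ u in (0 : ℝ)..(t - s), g u ^ 2 := by
    rw [intervalIntegral_comp_abs_sq hgz hgi hd0.le]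
    have := intervalIntegral_sq_mono hgi hd0.le (show d ≤ t - s by rw [hd]; linarith)
    linarith
  have hpt : ∀ a b : ℝ, 0 < a → a ≤ b → (g a - g b) ^ 2 ≤ g a ^ 2 - g b ^ 2 := by
    intro a b ha hab
    have := hga ha (ha.trans_le hab) hab
    nlinarith [hg0 b]
  have hright : ∫ x in e..1, (g |t - x| - g |s - x|) ^ 2 ≤ ∫ u in (-d)..d, g |u| ^ 2 := by
    have h1 : ∫ x in e..1, (g |t - x| - g |s - x|) ^ 2 ≤
        ∫ x in e..1, (g |t - x| ^ 2 - g |s - x| ^ 2) := by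
      refine intervalIntegral.integral_mono_ae_restrict (by rw [he]; linarith [hs.2, ht.2])
        hD.intervalIntegrable ((hHc t).sub (hHc s)).intervalIntegrable ?_
      have hne : ∀ᵐ x ∂(volume.restrict (Set.Icc e 1)), x ≠ t :=
        ae_restrict_of_ae (Measure.ae_ne volume t)
      filter_upwards [hne, ae_restrict_mem measurableSet_Icc] with x hx hxe
      refine hpt _ _ (abs_pos.2 (sub_ne_zero.2 hx.symm)) ?_
      have := hxe.1
      rw [abs_of_nonpos (show s - x ≤ 0 by linarith), abs_le]
      constructor <;> linarith
    rw [intervalIntegral.integral_sub (hHc t).intervalIntegrable (hHc s).intervalIntegrable,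
      intervalIntegral.integral_comp_sub_left (fun u => g |u| ^ 2) t,
      intervalIntegral.integral_comp_sub_left (fun u => g |u| ^ 2) s,
      show t - e = d by rw [hd, he]; ring, show s - e = -d by rw [hd, he]; ring] at h1
    have h2 : 0 ≤ ∫ u in (s - 1)..(t - 1), g |u| ^ 2 :=
      intervalIntegral.integral_nonneg (by linarith) fun _ _ => sq_nonneg _
    have h3 := intervalIntegral.integral_interval_sub_interval_comm
      (hH.intervalIntegrable (a := t - 1) (b := d)) (hH.intervalIntegrable (a := s - 1) (b := -d))
      (hH.intervalIntegrable (a := t - 1) (b := s - 1))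
    have h4 := intervalIntegral.integral_symm (μ := volume) (f := fun u => g |u| ^ 2) (s - 1) (t - 1)
    have h5 := intervalIntegral.integral_symm (μ := volume) (f := fun u => g |u| ^ 2) (-d) d
    linarith
  have hleft : ∫ x in (0 : ℝ)..e, (g |t - x| - g |s - x|) ^ 2 ≤ ∫ u in (-d)..d, g |u| ^ 2 := by
    have h1 : ∫ x in (0 : ℝ)..e, (g |t - x| - g |s - x|) ^ 2 ≤
        ∫ x in (0 : ℝ)..e, (g |s - x| ^ 2 - g |t - x| ^ 2) := by
      refine intervalIntegral.integral_mono_ae_restrict (by rw [he]; linarith [hs.1, ht.1])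
        hD.intervalIntegrable ((hHc s).sub (hHc t)).intervalIntegrable ?_
      have hne : ∀ᵐ x ∂(volume.restrict (Set.Icc 0 e)), x ≠ s :=
        ae_restrict_of_ae (Measure.ae_ne volume s)
      filter_upwards [hne, ae_restrict_mem measurableSet_Icc] with x hx hxe
      rw [sub_sq_comm]
      refine hpt _ _ (abs_pos.2 (sub_ne_zero.2 hx.symm)) ?_
      have := hxe.2
      rw [abs_of_nonneg (show 0 ≤ t - x by linarith), abs_le]
      constructor <;> linarith
    rw [intervalIntegral.integral_sub (hHc s).intervalIntegrable (hHc t).intervalIntegrable,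
      intervalIntegral.integral_comp_sub_left (fun u => g |u| ^ 2) t,
      intervalIntegral.integral_comp_sub_left (fun u => g |u| ^ 2) s,
      show t - e = d by rw [hd, he]; ring, show s - e = -d by rw [hd, he]; ring, sub_zero,
      sub_zero] at h1
    have h2 : 0 ≤ ∫ u in s..t, g |u| ^ 2 :=
      intervalIntegral.integral_nonneg hst.le fun _ _ => sq_nonneg _
    have h3 := intervalIntegral.integral_interval_sub_interval_comm
      (hH.intervalIntegrable (a := -d) (b := s)) (hH.intervalIntegrable (a := d) (b := t))
      (hH.intervalIntegrable (a := -d) (b := d))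
    linarith
  rw [← intervalIntegral.integral_add_adjacent_intervals (b := e) hD.intervalIntegrable
    hD.intervalIntegrable]
  linarith

/-- The kernel sections `x ↦ g |t - x|`, as a curve in `L₂[0,1]`. -/
theorem exists_kernel_curve (hgm : Measurable g) (hg0 : ∀ x, 0 ≤ g x)
    (hgz : ∀ x ≤ 0, g x = 0) (hga : AntitoneOn g (Set.Ioi 0))
    (hgi : Integrable fun x => g x ^ 2) :
    ∃ κ : ℝ → Lp ℝ 2 (volume.restrict (Set.Icc (0 : ℝ) 1)),
      (∀ t f, inner ℝ (κ t) f = ∫ x in (0 : ℝ)..1, g |t - x| * f x) ∧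
      (∀ t ∈ Set.Icc (0 : ℝ) 1, ‖κ t‖ ≤ Real.sqrt (2 * ∫ u in (0 : ℝ)..1, g u ^ 2)) ∧
      ∀ δ, ∀ s ∈ Set.Icc (0 : ℝ) 1, ∀ t ∈ Set.Icc (0 : ℝ) 1, |t - s| ≤ δ →
        ‖κ t - κ s‖ ≤ 2 * Real.sqrt (∫ u in (0 : ℝ)..δ, g u ^ 2) := by
  have hH := integrable_comp_abs_sq hgz hgi
  have hL : ∀ c : ℝ, MemLp (fun x => g |c - x|) 2 (volume.restrict (Set.Icc (0 : ℝ) 1)) := fun c =>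
    ((memLp_two_iff_integrable_sq (hgm.comp (by fun_prop)).aestronglyMeasurable).2
      (hH.comp_sub_left c)).restrict _
  have hint : ∀ f : ℝ → ℝ, ∫ x in Set.Icc (0 : ℝ) 1, f x = ∫ x in (0 : ℝ)..1, f x := fun f => by
    rw [integral_Icc_eq_integral_Ioc, intervalIntegral.integral_of_le zero_le_one]
  have hnorm : ∀ h : Lp ℝ 2 (volume.restrict (Set.Icc (0 : ℝ) 1)), ∀ f : ℝ → ℝ,
      h =ᵐ[volume.restrict (Set.Icc (0 : ℝ) 1)] f → ‖h‖ ^ 2 = ∫ x in (0 : ℝ)..1, f x ^ 2 := by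
    intro h f hf
    rw [← real_inner_self_eq_norm_sq, L2.inner_def, ← hint]
    refine integral_congr_ae ?_
    filter_upwards [hf] with x hx
    simp [hx, pow_two]
  refine ⟨fun t => (hL t).toLp, fun t f => ?_, fun t ht => ?_, ?_⟩
  · rw [L2.inner_def, ← hint]
    refine integral_congr_ae ?_
    filter_upwards [(hL t).coeFn_toLp] with x hx
    simp [hx, mul_comm]
  · refine Real.le_sqrt_of_sq_le ?_
    rw [hnorm _ _ (hL t).coeFn_toLp,
      intervalIntegral.integral_comp_sub_left (fun u => g |u| ^ 2) t,
      ← intervalIntegral_comp_abs_sq hgz hgi zero_le_one]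
    exact intervalIntegral.integral_mono_interval (by linarith [ht.1]) (by linarith) (by linarith [ht.2])
      (Filter.Eventually.of_forall fun _ => sq_nonneg _) hH.intervalIntegrable
  · have main : ∀ δ, ∀ s ∈ Set.Icc (0 : ℝ) 1, ∀ t ∈ Set.Icc (0 : ℝ) 1, s ≤ t → t - s ≤ δ →
        ‖(hL t).toLp - (hL s).toLp‖ ≤ 2 * Real.sqrt (∫ u in (0 : ℝ)..δ, g u ^ 2) := by
      intro δ s hs t ht hst hδ
      have h1 : ‖(hL t).toLp - (hL s).toLp‖ ^ 2 ≤ 4 * ∫ u in (0 : ℝ)..δ, g u ^ 2 := by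
        rw [hnorm _ (fun x => g |t - x| - g |s - x|) (by
          filter_upwards [Lp.coeFn_sub (hL t).toLp (hL s).toLp, (hL t).coeFn_toLp,
            (hL s).coeFn_toLp] with x h h1 h2
          rw [h, Pi.sub_apply, h1, h2])]
        refine (intervalIntegral_sq_sub_le hgm hg0 hgz hga hgi hs ht hst).trans ?_
        have := intervalIntegral_sq_mono hgi (sub_nonneg.2 hst) hδ
        linarith
      have h2 := Real.le_sqrt_of_sq_le h1
      rwa [Real.sqrt_mul (by norm_num), show Real.sqrt 4 = 2 by
        rw [show (4 : ℝ) = 2 ^ 2 by norm_num]; exact Real.sqrt_sq (by norm_num)] at h2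
    intro δ s hs t ht hδ
    rcases le_total s t with h | h
    · exact main δ s hs t ht h ((le_abs_self _).trans hδ)
    · rw [norm_sub_rev]
      exact main δ t ht s hs h (by rw [abs_sub_comm] at hδ; exact (le_abs_self _).trans hδ)

end Kernel

section KolmogorovNumbers

theorem kolmogorovNum_le {X Y : Type*} [SeminormedAddCommGroup X] [NormedSpace ℝ X]
    [NormedAddCommGroup Y] [NormedSpace ℝ Y] (T : X →L[ℝ] Y) {n : ℕ} (F : Submodule ℝ Y)
    (hF : Module.rank ℝ F < (n : Cardinal)) {c : ℝ}
    (h : ∀ x ∈ Metric.closedBall (0 : X) 1, Metric.infDist (T x) (F : Set Y) ≤ c) :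
    kolmogorovNum T n ≤ c := by
  refine csInf_le ⟨0, ?_⟩ ⟨F, hF, h⟩
  rintro d ⟨F', -, h'⟩
  exact Metric.infDist_nonneg.trans (h' 0 (by simp))

theorem sqrt_mul_kolmogorovNum_le {q : ℝ} (hq : 1 ≤ q) [Fact (1 ≤ ENNReal.ofReal q)]
    {g : ℝ → ℝ} (hgm : Measurable g) (hg0 : ∀ x, 0 ≤ g x)
    (hgz : ∀ x ≤ 0, g x = 0) (hga : AntitoneOn g (Set.Ioi 0))
    (hgi : Integrable fun x => g x ^ 2)
    (T : Lp ℝ 2 (volume.restrict (Set.Icc (0 : ℝ) 1)) →L[ℝ]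
      Lp ℝ (ENNReal.ofReal q) (volume.restrict (Set.Icc (0 : ℝ) 1)))
    (hT : ∀ f : Lp ℝ 2 (volume.restrict (Set.Icc (0 : ℝ) 1)),
      ∀ᵐ t ∂(volume.restrict (Set.Icc (0 : ℝ) 1)), T f t = ∫ x in (0 : ℝ)..1, g |t - x| * f x)
    (n : ℕ) (hn : 1 ≤ n) :
    Real.sqrt n * kolmogorovNum T n ≤
      160 * Real.sqrt q * Real.sqrt (∫ u in (0 : ℝ)..(1 / (n : ℝ)), g u ^ 2) := by
  obtain ⟨κ, hκ, hκ1, hκω⟩ := exists_kernel_curve hgm hg0 hgz hga hgi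
  have hn0 : (0 : ℝ) < n := by exact_mod_cast hn
  have hsn : 0 < Real.sqrt n := Real.sqrt_pos.2 hn0
  have hsq : 1 ≤ Real.sqrt q := Real.one_le_sqrt.2 hq
  set J : ℝ → ℝ := fun δ => ∫ u in (0 : ℝ)..δ, g u ^ 2 with hJ
  have hJn : 0 ≤ J (1 / n) :=
    intervalIntegral.integral_nonneg (by positivity) fun _ _ => sq_nonneg _
  have hJp : ∀ p : ℕ, 1 ≤ p → p ≤ n → J (1 / p) ≤ (n : ℝ) / p * J (1 / n) := by
    intro p hp hpn
    have hp0 : (0 : ℝ) < p := by exact_mod_cast hp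
    have h := intervalIntegral_sq_le_mul hga hg0 hgi (a := 1 / (n : ℝ)) (b := 1 / (p : ℝ))
      (by positivity) (one_div_le_one_div_of_le hp0 (by exact_mod_cast hpn))
    rwa [show (1 : ℝ) / p / (1 / n) = n / p by field_simp] at h
  rcases Nat.lt_or_ge n 4 with hn4 | hn4
  · have hK : kolmogorovNum T n ≤ Real.sqrt (2 * J 1) := by
      refine kolmogorovNum_le T ⊥ (by simpa using Nat.pos_of_ne_zero (by lia)) fun f hf => ?_
      have hf1 : ‖f‖ ≤ 1 := by simpa using hf
      have h0 : Metric.infDist (T f) ((⊥ : Submodule ℝ (Lp ℝ (ENNReal.ofReal q)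
          (volume.restrict (Set.Icc (0 : ℝ) 1)))) : Set _) ≤ ‖T f‖ := by
        simp
      refine h0.trans ?_
      have h1 : measureUnivNNReal (volume.restrict (Set.Icc (0 : ℝ) 1)) = 1 := by
        simp [measureUnivNNReal]
      have hbd : ∀ᵐ t ∂(volume.restrict (Set.Icc (0 : ℝ) 1)), ‖T f t‖ ≤ Real.sqrt (2 * J 1) := by
        filter_upwards [hT f, ae_restrict_mem measurableSet_Icc] with t h ht
        rw [h, ← hκ]
        refine (norm_inner_le_norm _ _).trans ?_
        nlinarith [hκ1 t ht, norm_nonneg f, norm_nonneg (κ t)]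
      simpa [h1] using Lp.norm_le_of_ae_bound (Real.sqrt_nonneg _) hbd
    have hn3 : (n : ℝ) ≤ 3 := by exact_mod_cast (by omega : n ≤ 3)
    have h1 := hJp 1 le_rfl hn
    simp only [Nat.cast_one, div_one] at h1
    have hmain : Real.sqrt n * Real.sqrt (2 * J 1) ≤ 5 * Real.sqrt (J (1 / n)) := by
      rw [← Real.sqrt_mul hn0.le, show (5 : ℝ) = Real.sqrt (5 ^ 2) by
        rw [Real.sqrt_sq (by norm_num)], ← Real.sqrt_mul (by norm_num)]
      refine Real.sqrt_le_sqrt ?_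
      nlinarith [mul_nonneg (sub_nonneg.2 hn3) hJn, mul_nonneg hn0.le hJn]
    have h2 := mul_le_mul_of_nonneg_left hK hsn.le
    nlinarith [Real.sqrt_nonneg (J (1 / n)), mul_nonneg (sub_nonneg.2 hsq) (Real.sqrt_nonneg (J (1 / n)))]
  · obtain ⟨p, hp, hpn, hn5⟩ : ∃ p : ℕ, 1 ≤ p ∧ 2 * p + 1 < n ∧ n ≤ 5 * p :=
      ⟨(n - 2) / 2, by omega, by omega, by omega⟩
    have hp0 : (0 : ℝ) < p := by exact_mod_cast hp
    have hsp : 0 < Real.sqrt p := Real.sqrt_pos.2 hp0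
    have hK : ∀ m : ℕ, p ≤ m → Real.sqrt n * kolmogorovNum T n ≤
        Real.sqrt n * (2 * Real.sqrt (J (1 / m))) + 160 * Real.sqrt q * Real.sqrt (J (1 / n)) := by
      intro m hpm
      obtain ⟨F, hF, hd⟩ := exists_submodule_infDist_le_of_curve hq κ
        (fun δ => 2 * Real.sqrt (J δ)) hκω T (fun f => by
          filter_upwards [hT f] with t h
          rw [h, hκ]) p m hp hpm
      have h1 := kolmogorovNum_le T F (hF.trans_lt (by exact_mod_cast hpn)) hd
      refine (mul_le_mul_of_nonneg_left h1 hsn.le).trans ?_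
      rw [mul_add]
      refine add_le_add le_rfl ?_
      have hn5' : (n : ℝ) ≤ 5 * p := by exact_mod_cast hn5
      have hnp : (n : ℝ) / p ≤ 5 := (div_le_iff₀ hp0).2 hn5'
      have h2 : Real.sqrt n / Real.sqrt p * Real.sqrt (J (1 / p)) ≤ 5 * Real.sqrt (J (1 / n)) := by
        rw [← Real.sqrt_div hn0.le, ← Real.sqrt_mul (by positivity), show (5 : ℝ) = Real.sqrt (5 ^ 2)
          by rw [Real.sqrt_sq (by norm_num)], ← Real.sqrt_mul (by norm_num)]
        refine Real.sqrt_le_sqrt ?_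
        calc (n : ℝ) / p * J (1 / p) ≤ n / p * (n / p * J (1 / n)) := by
              gcongr
              exact hJp p hp (by omega)
          _ ≤ 5 * (5 * J (1 / n)) := by gcongr
          _ = _ := by ring
      calc Real.sqrt n * (16 * Real.sqrt q * (2 * Real.sqrt (J (1 / p))) / Real.sqrt p)
          = 32 * Real.sqrt q * (Real.sqrt n / Real.sqrt p * Real.sqrt (J (1 / p))) := by ring
        _ ≤ 32 * Real.sqrt q * (5 * Real.sqrt (J (1 / n))) := by gcongr
        _ = _ := by ring
    have hlim : Filter.Tendsto (fun m : ℕ => Real.sqrt n * (2 * Real.sqrt (J (1 / m))) +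
        160 * Real.sqrt q * Real.sqrt (J (1 / n))) Filter.atTop
        (nhds (Real.sqrt n * (2 * Real.sqrt (J 0)) +
          160 * Real.sqrt q * Real.sqrt (J (1 / n)))) := by
      have hJc : Continuous J := hgi.continuous_primitive 0
      have := (hJc.tendsto 0).comp (tendsto_one_div_atTop_nhds_zero_nat (𝕜 := ℝ))
      exact ((((Real.continuous_sqrt.tendsto _).comp this).const_mul 2).const_mul _).add_const _
    have hfin := ge_of_tendsto hlim (Filter.eventually_atTop.2 ⟨p, hK⟩)
    have hJ0 : J 0 = 0 := intervalIntegral.integral_same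
    simpa [hJ0] using hfin

end KolmogorovNumbers

/-- There is an absolute constant `c ≥ 1` such that for every
`1 ≤ q < ∞`, every kernel function `k ∈ L₂[0,1]` and the weakly singular integral operator
`T_K : L₂[0,1] → L_q[0,1]`, `(T_K f)(t) = ∫₀¹ k(|t−x|) f(x) dx`:
`n^{1/2} dₙ(T_K) ≤ c √q (∫₀^{1/n} k(u)² du)^{1/2}` for all `n ∈ ℕ`. -/
theorem stmt17 :
    ∃ c : ℝ, 1 ≤ c ∧
      ∀ (q : ℝ) (hq : 1 ≤ q),
      ∀ k : ℝ → ℝ,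
      (∀ x ∈ Set.Ioc (0 : ℝ) 1, 0 ≤ k x) →
      ContinuousOn k (Set.Ioc 0 1) →
      StrictAntiOn k (Set.Ioc 0 1) →
      Filter.Tendsto k (nhdsWithin 0 (Set.Ioi 0)) Filter.atTop →
      MeasureTheory.IntegrableOn (fun x => k x ^ 2) (Set.Ioc 0 1) →
      letI : Fact (1 ≤ ENNReal.ofReal q) := ⟨ENNReal.one_le_ofReal.mpr hq⟩
      ∀ T : Lp ℝ 2 (volume.restrict (Set.Icc (0:ℝ) 1)) →L[ℝ]
          Lp ℝ (ENNReal.ofReal q) (volume.restrict (Set.Icc (0:ℝ) 1)),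
        (∀ f : Lp ℝ 2 (volume.restrict (Set.Icc (0:ℝ) 1)),
          ∀ᵐ t ∂(volume.restrict (Set.Icc (0:ℝ) 1)),
            T f t = ∫ x in (0:ℝ)..1, k |t - x| * f x) →
        ∀ n : ℕ, 1 ≤ n →
          (n : ℝ) ^ ((1 : ℝ) / 2) * kolmogorovNum T n ≤
            c * Real.sqrt q * (∫ u in (0:ℝ)..(1 / (n : ℝ)), k u ^ 2) ^ ((1 : ℝ) / 2) := by
  refine ⟨160, by norm_num, ?_⟩
  intro q hq k hk0 hkc hka _ hki
  have : Fact (1 ≤ ENNReal.ofReal q) := ⟨ENNReal.one_le_ofReal.mpr hq⟩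
  intro T hT n hn
  have hn0 : (0 : ℝ) < n := by exact_mod_cast hn
  set g : ℝ → ℝ := (Set.Ioc (0 : ℝ) 1).indicator k with hg
  have hgm : Measurable g := by
    classical
    rw [hg, ← Set.piecewise_eq_indicator]
    exact hkc.measurable_piecewise continuousOn_const measurableSet_Ioc
  have hg0 : ∀ x, 0 ≤ g x := fun x => Set.indicator_nonneg hk0 x
  have hgz : ∀ x ≤ 0, g x = 0 := fun x hx =>
    Set.indicator_of_notMem (fun h => absurd h.1 (not_lt.2 hx)) _
  have hga : AntitoneOn g (Set.Ioi 0) := by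
    intro x hx y hy hxy
    by_cases hy1 : y ≤ 1
    · rw [hg, Set.indicator_of_mem (show x ∈ Set.Ioc (0 : ℝ) 1 from ⟨hx, hxy.trans hy1⟩),
        Set.indicator_of_mem (show y ∈ Set.Ioc (0 : ℝ) 1 from ⟨hy, hy1⟩)]
      exact hka.antitoneOn ⟨hx, hxy.trans hy1⟩ ⟨hy, hy1⟩ hxy
    · have : g y = 0 := Set.indicator_of_notMem (fun h => hy1 h.2) _
      rw [this]
      exact hg0 x
  have hgi : Integrable fun x => g x ^ 2 := by
    refine (hki.integrable_indicator measurableSet_Ioc).congr (Filter.Eventually.of_forall ?_)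
    intro x
    by_cases hx : x ∈ Set.Ioc (0 : ℝ) 1 <;> simp [hg, hx]
  have hTg : ∀ f : Lp ℝ 2 (volume.restrict (Set.Icc (0 : ℝ) 1)),
      ∀ᵐ t ∂(volume.restrict (Set.Icc (0 : ℝ) 1)),
        T f t = ∫ x in (0 : ℝ)..1, g |t - x| * f x := by
    intro f
    filter_upwards [hT f, ae_restrict_mem measurableSet_Icc] with t h ht
    rw [h]
    refine intervalIntegral.integral_congr_ae ?_
    filter_upwards [Measure.ae_ne volume t] with x hx hxI
    rw [Set.uIoc_of_le zero_le_one] at hxI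
    have hmem : |t - x| ∈ Set.Ioc (0 : ℝ) 1 :=
      ⟨abs_pos.2 (sub_ne_zero.2 hx.symm), abs_le.2 ⟨by linarith [ht.1, hxI.2],
        by linarith [ht.2, hxI.1]⟩⟩
    rw [hg, Set.indicator_of_mem hmem]
  have hint : ∫ u in (0 : ℝ)..(1 / (n : ℝ)), k u ^ 2 = ∫ u in (0 : ℝ)..(1 / (n : ℝ)), g u ^ 2 := by
    refine intervalIntegral.integral_congr_ae (Filter.Eventually.of_forall fun u hu => ?_)
    rw [Set.uIoc_of_le (by positivity)] at hu
    have : (1 : ℝ) / n ≤ 1 := (div_le_one hn0).2 (by exact_mod_cast hn)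
    rw [hg, Set.indicator_of_mem (show u ∈ Set.Ioc (0 : ℝ) 1 from ⟨hu.1, hu.2.trans this⟩)]
  rw [hint, ← Real.sqrt_eq_rpow, ← Real.sqrt_eq_rpow]
  exact sqrt_mul_kolmogorovNum_le hq hgm hg0 hgz hga hgi T hTg n hn
end
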